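/- arXiv:2504.12912 — 2 statements merged into one kernel-verified Lean document; each statement's English description precedes it below -/
import Mathlib

section
/- Let n ≥ 1, K > 1, 0 < T₁ < T and 0 < δ < 1. There exist constants κ > 0 and μ > 0, depending only on n, δ, T₁, T and K, such that: if u is continuous on the closure of B₁ × (0,T], is a viscosity supersolution of ∂_t u − M_K⁻(D²u) ≥ −κ in B₁ × (0,T], satisfies u(x,0) ≥ 1 for all |x| ≤ δ, and u ≥ 0 on the parabolic boundary ∂_p(B₁ × (0,T]), then u(x,t) ≥ μ · dist(x, ∂B₁) for all (x,t) ∈ B₁ × [T₁, T]. -/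
open MeasureTheory Metric Set

noncomputable section

abbrev En (n : ℕ) := EuclideanSpace ℝ (Fin n)

def PucciSet (n : ℕ) (K : ℝ) : Set (Matrix (Fin n) (Fin n) ℝ) :=
  {A | A.IsSymm ∧ (A - K⁻¹ • (1 : Matrix (Fin n) (Fin n) ℝ)).PosSemidef ∧
    ((K • (1 : Matrix (Fin n) (Fin n) ℝ)) - A).PosSemidef}

/-- Pucci minimal operator `M_K⁻`. -/
def PucciMinus (n : ℕ) (K : ℝ) (N : Matrix (Fin n) (Fin n) ℝ) : ℝ :=
  sInf ((fun A => (A * N).trace) '' PucciSet n K)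

/-- spatial Hessian matrix -/
def hessian (n : ℕ) (φ : En n → ℝ) (x : En n) : Matrix (Fin n) (Fin n) ℝ :=
  fun i j => fderiv ℝ (fun y => fderiv ℝ φ y (EuclideanSpace.single j (1:ℝ))) x
    (EuclideanSpace.single i (1:ℝ))

/-- parabolic cylinder `B_r(x₀) × (t₀ - r², t₀]` -/
def parCyl (n : ℕ) (x₀ : En n) (t₀ r : ℝ) : Set (En n × ℝ) :=
  Metric.ball x₀ r ×ˢ Set.Ioc (t₀ - r ^ 2) t₀

/-- viscosity supersolution of `∂ₜ u - F(D²u) ≥ f` in `Q`: whenever a test function `φ`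
(C² in space, C¹ in time) touches `u` from below at `(x₀,t₀) ∈ Q` relative to a parabolic
cylinder contained in `Q`, then `∂ₜ φ - F(D²φ) ≥ f` at `(x₀,t₀)`. -/
def IsViscSuperSol (n : ℕ) (F : Matrix (Fin n) (Fin n) ℝ → ℝ) (f : En n → ℝ → ℝ)
    (Q : Set (En n × ℝ)) (u : En n → ℝ → ℝ) : Prop :=
  ∀ (φ : En n → ℝ → ℝ) (x₀ : En n) (t₀ r : ℝ), 0 < r → (x₀, t₀) ∈ Q →
    parCyl n x₀ t₀ r ⊆ Q →
    (∀ t : ℝ, ContDiff ℝ 2 (fun y => φ y t)) →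
    (∀ x : En n, ContDiff ℝ 1 (fun s => φ x s)) →
    (∀ p ∈ parCyl n x₀ t₀ r, u x₀ t₀ - φ x₀ t₀ ≤ u p.1 p.2 - φ p.1 p.2) →
    f x₀ t₀ ≤ deriv (fun s => φ x₀ s) t₀ - F (hessian n (fun y => φ y t₀) x₀)

/-- Comparison on a parabolic cylinder: a smooth function that lies below a viscosity supersolution
on the parabolic boundary and is a strict subsolution where it exceeds `u` lies below `u`. -/
theorem IsViscSuperSol.le_of_strict_subsolution {n : ℕ} {F : Matrix (Fin n) (Fin n) ℝ → ℝ}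
    {κ T τ : ℝ} (hτ : 0 < τ) (hτT : τ ≤ T) {u φ : En n → ℝ → ℝ}
    (hu : ContinuousOn (fun p : En n × ℝ => u p.1 p.2) (closedBall (0 : En n) 1 ×ˢ Icc (0:ℝ) T))
    (hsol : IsViscSuperSol n F (fun _ _ => -κ) (ball (0 : En n) 1 ×ˢ Ioc (0:ℝ) T) u)
    (hφ : Continuous (fun p : En n × ℝ => φ p.1 p.2))
    (hφx : ∀ t : ℝ, ContDiff ℝ 2 (fun y => φ y t))
    (hφt : ∀ x : En n, ContDiff ℝ 1 (fun s => φ x s))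
    (hinit : ∀ x : En n, ‖x‖ ≤ 1 → φ x 0 ≤ u x 0)
    (hlat : ∀ x : En n, ‖x‖ = 1 → ∀ t ∈ Icc (0:ℝ) τ, φ x t ≤ u x t)
    (hstrict : ∀ x : En n, ‖x‖ < 1 → ∀ t ∈ Ioc (0:ℝ) τ, u x t < φ x t →
      deriv (fun s => φ x s) t - F (hessian n (fun y => φ y t) x) < -κ) :
    ∀ x : En n, ‖x‖ ≤ 1 → ∀ t ∈ Icc (0:ℝ) τ, φ x t ≤ u x t := by
  have hcpt : IsCompact (closedBall (0 : En n) 1 ×ˢ Icc (0:ℝ) τ) :=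
    (isCompact_closedBall _ _).prod isCompact_Icc
  have hne : (closedBall (0 : En n) 1 ×ˢ Icc (0:ℝ) τ).Nonempty :=
    ⟨(0, 0), by simp [hτ.le]⟩
  have hsub : closedBall (0 : En n) 1 ×ˢ Icc (0:ℝ) τ ⊆ closedBall (0 : En n) 1 ×ˢ Icc (0:ℝ) T :=
    prod_mono le_rfl (Icc_subset_Icc_right hτT)
  obtain ⟨⟨x₀, t₀⟩, hmem, hmin⟩ := hcpt.exists_isMinOn hne ((hu.mono hsub).sub hφ.continuousOn)
  rw [isMinOn_iff] at hmin
  simp only [mem_prod, mem_closedBall, dist_zero_right, mem_Icc] at hmem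
  obtain ⟨hx₀, ht₀, ht₀τ⟩ := hmem
  have key : φ x₀ t₀ ≤ u x₀ t₀ := by
    by_contra! hlt
    have hx₁ : ‖x₀‖ < 1 := lt_of_le_of_ne hx₀ fun h =>
      absurd (hlat x₀ h t₀ ⟨ht₀, ht₀τ⟩) (not_le.2 hlt)
    have ht₁ : 0 < t₀ := lt_of_le_of_ne ht₀ fun h => by
      subst h
      exact absurd (hinit x₀ hx₀) (not_le.2 hlt)
    obtain ⟨r, hr, hrx, hrt⟩ : ∃ r : ℝ, 0 < r ∧ r ≤ 1 - ‖x₀‖ ∧ r ^ 2 ≤ t₀ :=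
      ⟨min (1 - ‖x₀‖) (√t₀), lt_min (by linarith) (Real.sqrt_pos.2 ht₁), min_le_left _ _, by
        have h0 : 0 ≤ min (1 - ‖x₀‖) (√t₀) := le_min (by linarith) (Real.sqrt_nonneg _)
        calc _ ≤ (√t₀) ^ 2 := by gcongr; exact min_le_right _ _
          _ = t₀ := Real.sq_sqrt ht₀⟩
    have hcyl : ∀ p ∈ parCyl n x₀ t₀ r, ‖p.1‖ < 1 ∧ 0 < p.2 ∧ p.2 ≤ t₀ := by
      rintro ⟨x, t⟩ ⟨hx, ht⟩
      simp only [mem_ball, dist_eq_norm, mem_Ioc] at hx ht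
      refine ⟨?_, by linarith, ht.2⟩
      have := norm_le_norm_add_norm_sub' x x₀
      dsimp only
      linarith
    have h := hsol φ x₀ t₀ r hr ⟨by simpa using hx₁, ht₁, ht₀τ.trans hτT⟩
      (fun p hp => by
        obtain ⟨h1, h2, h3⟩ := hcyl p hp
        exact ⟨by simpa using h1, h2, h3.trans (ht₀τ.trans hτT)⟩) hφx hφt
      (fun p hp => by
        obtain ⟨h1, h2, h3⟩ := hcyl p hp
        exact hmin p ⟨by simpa using h1.le, h2.le, h3.trans ht₀τ⟩)
    exact absurd (hstrict x₀ hx₁ t₀ ⟨ht₁, ht₀τ⟩ hlt) (not_lt.2 h)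
  intro x hx t ht
  have := hmin (x, t) ⟨by simpa using hx, ht⟩
  dsimp only [Pi.sub_apply] at this
  linarith

theorem le_pucciMinus {n : ℕ} {K : ℝ} (hK : 1 ≤ K) {N : Matrix (Fin n) (Fin n) ℝ} {c : ℝ}
    (h : ∀ A ∈ PucciSet n K, c ≤ (A * N).trace) : c ≤ PucciMinus n K N := by
  refine le_csInf (Nonempty.image _ ⟨1, Matrix.isSymm_one, ?_, ?_⟩) ?_
  · have : (1 : Matrix (Fin n) (Fin n) ℝ) - K⁻¹ • 1 = (1 - K⁻¹) • 1 := by rw [sub_smul, one_smul]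
    rw [this]
    exact Matrix.PosSemidef.one.smul (sub_nonneg.2 (inv_le_one_of_one_le₀ hK))
  · have : K • (1 : Matrix (Fin n) (Fin n) ℝ) - 1 = (K - 1) • 1 := by rw [sub_smul, one_smul]
    rw [this]
    exact Matrix.PosSemidef.one.smul (sub_nonneg.2 hK)
  · rintro _ ⟨A, hA, rfl⟩
    exact h A hA

theorem trace_le_of_mem_pucciSet {n : ℕ} {K : ℝ} {A : Matrix (Fin n) (Fin n) ℝ}
    (hA : A ∈ PucciSet n K) : A.trace ≤ K * n := by
  have h := hA.2.2.trace_nonneg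
  simp only [Matrix.trace_sub, Matrix.trace_smul, Matrix.trace_one, Fintype.card_fin,
    smul_eq_mul] at h
  linarith

theorem le_quadratic_of_mem_pucciSet {n : ℕ} {K : ℝ} {A : Matrix (Fin n) (Fin n) ℝ}
    (hA : A ∈ PucciSet n K) (x : En n) :
    K⁻¹ * ‖x‖ ^ 2 ≤ ∑ i, ∑ j, A i j * (x j * x i) := by
  have h := hA.2.1.dotProduct_mulVec_nonneg x.ofLp
  have h2 : ‖x‖ ^ 2 = ∑ i, x i * x i := by
    simp [EuclideanSpace.norm_sq_eq, ← sq]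
  rw [Matrix.sub_mulVec, dotProduct_sub, Matrix.smul_mulVec, Matrix.one_mulVec,
    dotProduct_smul] at h
  simp only [dotProduct, star_trivial, Matrix.mulVec, smul_eq_mul] at h
  rw [h2]
  refine (sub_nonneg.1 h).trans_eq (Finset.sum_congr rfl fun i _ => ?_)
  rw [Finset.mul_sum]
  exact Finset.sum_congr rfl fun j _ => by ring

theorem le_pucciMinus_radial {n : ℕ} {K : ℝ} (hK : 1 ≤ K) {a b : ℝ} (ha : 0 ≤ a) (hb : 0 ≤ b)
    (x : En n) :
    a * (K⁻¹ * ‖x‖ ^ 2) - b * (K * n) ≤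
      PucciMinus n K (Matrix.of fun i j => a * (x i * x j) - b * (1 : Matrix (Fin n) (Fin n) ℝ) i j) := by
  refine le_pucciMinus hK fun A hA => ?_
  have h : (A * Matrix.of fun i j => a * (x i * x j) -
      b * (1 : Matrix (Fin n) (Fin n) ℝ) i j).trace =
      a * (∑ i, ∑ j, A i j * (x j * x i)) - b * A.trace := by
    simp only [Matrix.trace, Matrix.diag, Matrix.mul_apply, Matrix.of_apply, mul_sub, Finset.sum_sub_distrib,
      Finset.mul_sum, Matrix.one_apply]
    congr 1
    · exact Finset.sum_congr rfl fun i _ => Finset.sum_congr rfl fun j _ => by ring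
    · refine Finset.sum_congr rfl fun i _ => ?_
      simp [mul_comm]
  rw [h]
  have h1 := mul_le_mul_of_nonneg_left (le_quadratic_of_mem_pucciSet hA x) ha
  have h2 := mul_le_mul_of_nonneg_left (trace_le_of_mem_pucciSet hA) hb
  linarith

theorem hessian_gaussian (n : ℕ) (c d α : ℝ) (x : En n) :
    hessian n (fun y => c * (Real.exp (-α * ‖y‖ ^ 2) - d)) x =
      Matrix.of fun i j => c * Real.exp (-α * ‖x‖ ^ 2) * (4 * α ^ 2) * (x i * x j) -
        c * Real.exp (-α * ‖x‖ ^ 2) * (2 * α) * (1 : Matrix (Fin n) (Fin n) ℝ) i j := by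
  have hE : ∀ y : En n, HasFDerivAt (fun y : En n => Real.exp (-α * ‖y‖ ^ 2))
      (Real.exp (-α * ‖y‖ ^ 2) • (-α) • (2 • innerSL ℝ y)) y := fun y =>
    (((hasStrictFDerivAt_norm_sq y).hasFDerivAt).const_mul (-α)).exp
  funext i j
  have h1 : (fun y : En n => fderiv ℝ (fun y => c * (Real.exp (-α * ‖y‖ ^ 2) - d)) y
      (EuclideanSpace.single j (1:ℝ))) =
      fun y => (-2 * α * c) * (Real.exp (-α * ‖y‖ ^ 2) * EuclideanSpace.proj (𝕜 := ℝ) j y) := by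
    funext y
    rw [(((hE y).sub_const d).const_mul c).fderiv]
    simp [EuclideanSpace.inner_single_right]
    ring
  have h2 : HasFDerivAt
      (fun y => (-2 * α * c) * (Real.exp (-α * ‖y‖ ^ 2) * EuclideanSpace.proj (𝕜 := ℝ) j y)) _ x :=
    ((hE x).mul (EuclideanSpace.proj (𝕜 := ℝ) j).hasFDerivAt).const_mul _
  rw [hessian, h1, h2.fderiv]
  simp [EuclideanSpace.inner_single_right, Matrix.one_apply]
  rcases eq_or_ne i j with rfl | hij
  · simp
    ring
  · simp [hij, hij.symm]
    ring

/-- Constants for the barrier `exp (-λ t) * (exp (-α ‖x‖²) - exp (-α R(t)))`. Here `E` and `G`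
stand for the two spatial exponentials, and `ρ` for `R'`. -/
theorem exists_barrier_constants {K T T₁ δ N : ℝ} (hK : 0 < K) (hN : 0 ≤ N) (hT : 0 < T)
    (hT₁ : 0 < T₁) (hδ : 0 < δ) :
    ∃ α lam κ : ℝ, 0 < α ∧ 0 < lam ∧ 0 < κ ∧
      ∀ s R ρ t : ℝ, 0 ≤ s → s ≤ 1 → δ ^ 2 ≤ R → 0 ≤ ρ → ρ ≤ T₁⁻¹ → t ≤ T →
        -(2 * κ * T) < Real.exp (-lam * t) * (Real.exp (-α * s) - Real.exp (-α * R)) →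
        Real.exp (-lam * t) * (-lam * (Real.exp (-α * s) - Real.exp (-α * R)) +
          α * ρ * Real.exp (-α * R) -
          Real.exp (-α * s) * (4 * α ^ 2 * (K⁻¹ * s) - 2 * α * (K * N))) < -κ := by
  obtain ⟨α, hα, hαeq⟩ : ∃ α : ℝ, 0 < α ∧ 2 * α * δ ^ 2 * K⁻¹ = T₁⁻¹ + 2 * (K * N) + 1 :=
    ⟨K * (T₁⁻¹ + 2 * (K * N) + 1) / (2 * δ ^ 2), by positivity, by field_simp⟩
  have hanti : ∀ {p q : ℝ}, p ≤ q → Real.exp (-α * q) ≤ Real.exp (-α * p) := fun h =>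
    Real.exp_le_exp.2 (mul_le_mul_of_nonpos_left h (neg_nonpos.2 hα.le))
  set d := Real.exp (-α * (δ ^ 2 / 2)) - Real.exp (-α * δ ^ 2) with hd
  have hd0 : 0 < d := sub_pos.2 (Real.exp_lt_exp.2 (by nlinarith [mul_pos hα (pow_pos hδ 2)]))
  obtain ⟨lam, hlam, hlameq⟩ : ∃ l : ℝ, 0 < l ∧ l * d = α * T₁⁻¹ + 2 * α * (K * N) + 1 :=
    ⟨(α * T₁⁻¹ + 2 * α * (K * N) + 1) / d, by positivity, by field_simp⟩
  set m := min 1 (α * Real.exp (-α) / 2) with hm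
  have hm0 : 0 < m := lt_min one_pos (by positivity)
  set b := lam + α * T₁⁻¹ with hb
  have hb0 : 0 < b := by positivity
  obtain ⟨η, hη, hη1, hη2⟩ : ∃ η : ℝ, 0 < η ∧ η < m ∧ b * (2 * η * T) ≤ m := by
    refine ⟨m / (2 + 2 * b * T), by positivity, ?_, ?_⟩
    · rw [div_lt_iff₀ (by positivity)]
      nlinarith [mul_pos hm0 (mul_pos hb0 hT)]
    · have : b * (2 * (m / (2 + 2 * b * T)) * T) = m * ((2 * b * T) / (2 + 2 * b * T)) := by
        field_simp
      rw [this]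
      refine mul_le_of_le_one_right hm0.le ((div_le_one (by positivity)).2 (by linarith))
  refine ⟨α, lam, Real.exp (-lam * T) * η, hα, hlam, by positivity, ?_⟩
  intro s R ρ t hs hs1 hR hρ hρ1 htT hlow
  have hexpt : Real.exp (-lam * T) ≤ Real.exp (-lam * t) := Real.exp_le_exp.2
    (mul_le_mul_of_nonpos_left htT (neg_nonpos.2 hlam.le))
  have hpos := Real.exp_pos (-lam * t)
  set E := Real.exp (-α * s) with hE
  set G := Real.exp (-α * R) with hG
  have hE0 : 0 < E := Real.exp_pos _
  have hG0 : 0 < G := Real.exp_pos _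
  have hE1 : E ≤ 1 := (hanti hs).trans_eq (by simp)
  have hG1 : G ≤ 1 := (hanti ((sq_nonneg δ).trans hR)).trans_eq (by simp)
  have hEm : Real.exp (-α) ≤ E := (hanti hs1).trans_eq' (by simp)
  have hD : -(2 * η * T) < E - G := by
    have : Real.exp (-lam * T) * (2 * η * T) ≤ Real.exp (-lam * t) * (2 * η * T) :=
      mul_le_mul_of_nonneg_right hexpt (by positivity)
    refine lt_of_mul_lt_mul_left ?_ hpos.le
    linarith
  have hρG : α * ρ * G ≤ α * T₁⁻¹ * G := by gcongr
  have main : -lam * (E - G) + α * ρ * G -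
      E * (4 * α ^ 2 * (K⁻¹ * s) - 2 * α * (K * N)) ≤ -m := by
    rcases le_total s (δ ^ 2 / 2) with hsd | hsd
    · have h1 : d ≤ E - G := sub_le_sub (hanti hsd) (hanti hR)
      have h2 : lam * d ≤ lam * (E - G) := by gcongr
      have h3 : α * T₁⁻¹ * G ≤ α * T₁⁻¹ := mul_le_of_le_one_right (by positivity) hG1
      have h4 : 2 * α * (K * N) * E ≤ 2 * α * (K * N) := mul_le_of_le_one_right (by positivity) hE1
      have h5 : 0 ≤ E * (4 * α ^ 2 * (K⁻¹ * s)) := by positivity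
      have h6 : m ≤ 1 := min_le_left _ _
      have h7 : -lam * (E - G) + α * ρ * G - E * (4 * α ^ 2 * (K⁻¹ * s) - 2 * α * (K * N)) =
          -(lam * (E - G)) + α * ρ * G - E * (4 * α ^ 2 * (K⁻¹ * s)) + 2 * α * (K * N) * E := by
        ring
      linarith
    · have h1 : E * (4 * α ^ 2 * (K⁻¹ * (δ ^ 2 / 2))) ≤ E * (4 * α ^ 2 * (K⁻¹ * s)) := by gcongr
      have h2 : E * (4 * α ^ 2 * (K⁻¹ * (δ ^ 2 / 2))) = E * α * (T₁⁻¹ + 2 * (K * N) + 1) := by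
        rw [← hαeq]; ring
      have h3 : b * (G - E) ≤ b * (2 * η * T) := by gcongr; linarith
      have h4 : α * Real.exp (-α) ≤ α * E := by gcongr
      have h5 : m ≤ α * Real.exp (-α) / 2 := min_le_right _ _
      have h6 : -lam * (E - G) + α * ρ * G - E * (4 * α ^ 2 * (K⁻¹ * s) - 2 * α * (K * N)) =
          b * (G - E) + (α * ρ * G - α * T₁⁻¹ * G) + (E * α * (T₁⁻¹ + 2 * (K * N) + 1) -
            E * (4 * α ^ 2 * (K⁻¹ * s))) - α * E := by
        rw [hb]; ring
      linarith
  calc _ ≤ Real.exp (-lam * t) * (-m) := by gcongr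
    _ < Real.exp (-lam * t) * (-η) := by gcongr
    _ ≤ -(Real.exp (-lam * T) * η) := by
      rw [mul_neg]
      exact neg_le_neg (mul_le_mul_of_nonneg_right hexpt hη.le)

theorem infDist_sphere_le {n : ℕ} (hn : 1 ≤ n) {x : En n} (hx : ‖x‖ ≤ 1) :
    infDist x (sphere (0 : En n) 1) ≤ 1 - ‖x‖ := by
  rcases eq_or_ne x 0 with rfl | h0
  · have hmem : EuclideanSpace.single (⟨0, hn⟩ : Fin n) (1:ℝ) ∈ sphere (0 : En n) 1 := by simp
    simpa using infDist_le_dist_of_mem (x := (0 : En n)) hmem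
  · have hx0 : 0 < ‖x‖ := norm_pos_iff.2 h0
    have hmem : ‖x‖⁻¹ • x ∈ sphere (0 : En n) 1 := by
      simp [norm_smul, hx0.ne']
    refine (infDist_le_dist_of_mem hmem).trans_eq ?_
    have : x - ‖x‖⁻¹ • x = (1 - ‖x‖⁻¹) • x := by rw [sub_smul, one_smul]
    rw [dist_eq_norm, this, norm_smul, Real.norm_eq_abs,
      abs_of_nonpos (sub_nonpos.2 ((one_le_inv₀ hx0).2 hx))]
    field_simp
    ring

theorem IsViscSuperSol.neg_le {n : ℕ} {K κ T : ℝ} (hK : 1 ≤ K) (hκ : 0 < κ) (hT : 0 < T)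
    {u : En n → ℝ → ℝ}
    (hu : ContinuousOn (fun p : En n × ℝ => u p.1 p.2) (closedBall (0 : En n) 1 ×ˢ Icc (0:ℝ) T))
    (hsol : IsViscSuperSol n (PucciMinus n K) (fun _ _ => -κ)
      (ball (0 : En n) 1 ×ˢ Ioc (0:ℝ) T) u)
    (hinit : ∀ x : En n, ‖x‖ ≤ 1 → 0 ≤ u x 0)
    (hlat : ∀ x : En n, ‖x‖ = 1 → ∀ t ∈ Icc (0:ℝ) T, 0 ≤ u x t) :
    ∀ x : En n, ‖x‖ ≤ 1 → ∀ t ∈ Icc (0:ℝ) T, -(2 * κ * T) ≤ u x t := by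
  intro x hx t ht
  have h := hsol.le_of_strict_subsolution (φ := fun _ t => -(2 * κ) * t) hT le_rfl hu
    (by fun_prop) (fun _ => contDiff_const) (fun _ => by fun_prop)
    (fun x hx => by simpa using hinit x hx)
    (fun x hx t ht => le_trans (by nlinarith [ht.1]) (hlat x hx t ht))
    (fun x hx t ht _ => by
      have h0 : 0 ≤ PucciMinus n K (hessian n (fun _ => -(2 * κ) * t) x) := by
        refine le_pucciMinus hK fun A _ => ?_
        have : hessian n (fun _ => -(2 * κ) * t) x = 0 := by
          funext i j
          simp [hessian]
        rw [this, mul_zero, Matrix.trace_zero]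
      have h1 : deriv (fun s : ℝ => -(2 * κ) * s) t = -(2 * κ) := by simp
      rw [h1]
      linarith) x hx t ht
  nlinarith [ht.2]

/-- Proposition: parabolic Hopf–Oleinik lemma for fully nonlinear
parabolic equations. -/
theorem statement1 (n : ℕ) (hn : 1 ≤ n) (K T T₁ δ : ℝ) (hK : 1 < K)
    (hT₁ : 0 < T₁) (hT : T₁ < T) (hδ : 0 < δ) (hδ1 : δ < 1) :
    ∃ κ μ : ℝ, 0 < κ ∧ 0 < μ ∧
      ∀ u : En n → ℝ → ℝ,
        ContinuousOn (fun p : En n × ℝ => u p.1 p.2)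
          (Metric.closedBall (0 : En n) 1 ×ˢ Set.Icc (0:ℝ) T) →
        IsViscSuperSol n (PucciMinus n K) (fun _ _ => -κ)
          (Metric.ball (0 : En n) 1 ×ˢ Set.Ioc (0:ℝ) T) u →
        (∀ x : En n, ‖x‖ ≤ δ → 1 ≤ u x 0) →
        (∀ p ∈ (Metric.closedBall (0 : En n) 1 ×ˢ ({0} : Set ℝ)) ∪
            (Metric.sphere (0 : En n) 1 ×ˢ Set.Icc (0:ℝ) T), 0 ≤ u p.1 p.2) →
        ∀ x ∈ Metric.ball (0 : En n) 1, ∀ t ∈ Set.Icc T₁ T,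
          μ * Metric.infDist x (Metric.sphere (0 : En n) 1) ≤ u x t := by
  have hT0 : 0 < T := hT₁.trans hT
  have hK0 : 0 < K := one_pos.trans hK
  obtain ⟨α, lam, κ, hα, hlam, hκ, hbar⟩ :=
    exists_barrier_constants (N := n) hK0 n.cast_nonneg hT0 hT₁ hδ
  refine ⟨κ, Real.exp (-lam * T) * (α * Real.exp (-α)), hκ, by positivity, ?_⟩
  intro u hu hsol hδu hbdry x hx τ hτ
  have hinit : ∀ x : En n, ‖x‖ ≤ 1 → 0 ≤ u x 0 := fun x hx =>
    hbdry (x, 0) (Or.inl ⟨by simpa using hx, rfl⟩)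
  have hlat : ∀ x : En n, ‖x‖ = 1 → ∀ t ∈ Icc (0:ℝ) T, 0 ≤ u x t := fun x hx t ht =>
    hbdry (x, t) (Or.inr ⟨by simpa using hx, ht⟩)
  have hlow := hsol.neg_le hK.le hκ hT0 hu hinit hlat
  have hτ0 : 0 < τ := hT₁.trans_le hτ.1
  have hδ2 : δ ^ 2 < 1 := by nlinarith
  set ρ := (1 - δ ^ 2) / τ with hρ
  have hρ0 : 0 ≤ ρ := div_nonneg (by linarith) hτ0.le
  have hρτ : ρ * τ = 1 - δ ^ 2 := div_mul_cancel₀ _ hτ0.ne'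
  have hρ1 : ρ ≤ T₁⁻¹ := by
    rw [hρ, inv_eq_one_div]
    exact div_le_div₀ zero_le_one (by nlinarith) hT₁ hτ.1
  have hx1 : ‖x‖ < 1 := by simpa using hx
  have hcomp := hsol.le_of_strict_subsolution (φ := fun y t => Real.exp (-lam * t) *
      (Real.exp (-α * ‖y‖ ^ 2) - Real.exp (-α * (δ ^ 2 + ρ * t)))) hτ0 hτ.2 hu
    (by fun_prop)
    (fun t => by
      have := contDiff_norm_sq ℝ (E := En n) (n := 2)
      fun_prop)
    (fun y => by fun_prop)
    (fun y hy => by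
      simp only [mul_zero, Real.exp_zero, one_mul, add_zero]
      rcases le_total ‖y‖ δ with h | h
      · have h1 : Real.exp (-α * ‖y‖ ^ 2) ≤ 1 := Real.exp_le_one_iff.2 (by nlinarith [sq_nonneg ‖y‖])
        linarith [hδu y h, Real.exp_pos (-α * δ ^ 2)]
      · have h1 : Real.exp (-α * ‖y‖ ^ 2) ≤ Real.exp (-α * δ ^ 2) := by
          have : δ ^ 2 ≤ ‖y‖ ^ 2 := by gcongr
          exact Real.exp_le_exp.2 (by nlinarith)
        linarith [hinit y hy])
    (fun y hy t ht => by
      refine le_trans (mul_nonpos_of_nonneg_of_nonpos (Real.exp_pos _).le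
        (sub_nonpos.2 (Real.exp_le_exp.2 ?_))) (hlat y hy t ⟨ht.1, ht.2.trans hτ.2⟩)
      have : ρ * t ≤ ρ * τ := mul_le_mul_of_nonneg_left ht.2 hρ0
      rw [hy]
      nlinarith)
    (fun y hy t ht hlt => by
      have hy2 : ‖y‖ ^ 2 ≤ 1 := by nlinarith [norm_nonneg y]
      have hb := hbar (‖y‖ ^ 2) (δ ^ 2 + ρ * t) ρ t (by positivity) hy2
        (by nlinarith [mul_nonneg hρ0 ht.1.le]) hρ0 hρ1 (ht.2.trans hτ.2)
        ((hlow y hy.le t ⟨ht.1.le, ht.2.trans hτ.2⟩).trans_lt hlt)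
      have hd : HasDerivAt (fun s => Real.exp (-lam * s) *
          (Real.exp (-α * ‖y‖ ^ 2) - Real.exp (-α * (δ ^ 2 + ρ * s))))
          (Real.exp (-lam * t) * (-lam) *
            (Real.exp (-α * ‖y‖ ^ 2) - Real.exp (-α * (δ ^ 2 + ρ * t))) +
            Real.exp (-lam * t) * (-(Real.exp (-α * (δ ^ 2 + ρ * t)) * (-α * ρ)))) t := by
        have h1 : HasDerivAt (fun s => -lam * s) (-lam) t := by
          simpa using (hasDerivAt_id t).const_mul (-lam)
        have h2 : HasDerivAt (fun s => -α * (δ ^ 2 + ρ * s)) (-α * ρ) t := by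
          simpa using (((hasDerivAt_id t).const_mul ρ).const_add (δ ^ 2)).const_mul (-α)
        exact h1.exp.mul (h2.exp.const_sub _)
      rw [hd.deriv, hessian_gaussian]
      have hp := le_pucciMinus_radial (n := n) hK.le
        (a := Real.exp (-lam * t) * Real.exp (-α * ‖y‖ ^ 2) * (4 * α ^ 2))
        (b := Real.exp (-lam * t) * Real.exp (-α * ‖y‖ ^ 2) * (2 * α))
        (by positivity) (by positivity) y
      refine lt_of_le_of_lt (sub_le_sub_left hp _) (lt_of_eq_of_lt ?_ hb)
      ring) x hx1.le τ ⟨hτ0.le, le_rfl⟩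
  refine le_trans ?_ hcomp
  have hR : -α * (δ ^ 2 + ρ * τ) = -α := by rw [hρτ]; ring
  rw [hR, mul_assoc]
  have hdist : infDist x (sphere (0 : En n) 1) ≤ 1 - ‖x‖ ^ 2 := by
    nlinarith [infDist_sphere_le hn hx1.le, norm_nonneg x]
  have hexp : α * Real.exp (-α) * (1 - ‖x‖ ^ 2) ≤ Real.exp (-α * ‖x‖ ^ 2) - Real.exp (-α) := by
    have h1 : Real.exp (-α * ‖x‖ ^ 2) = Real.exp (-α) * Real.exp (α * (1 - ‖x‖ ^ 2)) := by
      rw [← Real.exp_add]; ring_nf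
    rw [h1]
    nlinarith [Real.add_one_le_exp (α * (1 - ‖x‖ ^ 2)), Real.exp_pos (-α)]
  have hexpT : Real.exp (-lam * T) ≤ Real.exp (-lam * τ) := Real.exp_le_exp.2 (by nlinarith [hτ.2])
  refine mul_le_mul hexpT (le_trans ?_ hexp) (mul_nonneg (by positivity) infDist_nonneg)
    (Real.exp_pos _).le
  gcongr
end
end

section
/- Parabolic weak Harnack inequality: let n ≥ 1, K > 1, and let F be uniformly K-elliptic with F(0) = 0. There exist constants p₀ ∈ (0,1) and C_H > 0 depending only on n and K such that: if f is continuous and bounded on 𝒫₁ = B₁ × (0,1] and u is a nonnegative continuous viscosity supersolution of ∂_t u − F(D²u) ≥ f in 𝒫₁, then for every 0 < r < 1/4, (⨍_{B_r × (r², 2r²)} u^{p₀} dx dt)^{1/p₀} ≤ C_H ( inf_{B_r × (3r², 4r²)} u + r² ‖f‖_{L^∞(𝒫₁)} ). -/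
open MeasureTheory Metric Set

noncomputable section

/-- Pucci maximal operator `M_K⁺`. -/
def PucciPlus (n : ℕ) (K : ℝ) (N : Matrix (Fin n) (Fin n) ℝ) : ℝ :=
  sSup ((fun A => (A * N).trace) '' PucciSet n K)

def UniformlyElliptic (n : ℕ) (K : ℝ) (F : Matrix (Fin n) (Fin n) ℝ → ℝ) : Prop :=
  ∀ M N : Matrix (Fin n) (Fin n) ℝ, M.IsSymm → N.IsSymm → N.PosSemidef →
    PucciMinus n K N ≤ F (M + N) - F M ∧ F (M + N) - F M ≤ PucciPlus n K N

/-- the unit parabolic cylinder `𝒫₁ = B₁ × (0,1]` -/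
def P1 (n : ℕ) : Set (En n × ℝ) := Metric.ball (0 : En n) 1 ×ˢ Set.Ioc (0:ℝ) 1

section

open Filter Topology

/-- The coordinate trace of an endomorphism of `En n`. -/
def coordTrace {n : ℕ} (P : En n →L[ℝ] En n) : ℝ := ∑ i, P (EuclideanSpace.single i 1) i

/-- Symmetric and positive semidefinite endomorphisms. -/
def IsPsd {n : ℕ} (P : En n →L[ℝ] En n) : Prop :=
  (∀ v w, inner ℝ (P v) w = inner ℝ (P w) v) ∧ ∀ v, 0 ≤ inner ℝ (P v) v

/-- `u` is a supersolution of `∂ₜ u - M_K⁻(D²u) ≥ -c` in `U`, tested only with the quadratic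
polynomials whose Hessian is `P - θ I` with `P ≥ 0` and `θ ≥ 0`. -/
def PucciSuper (n : ℕ) (K c : ℝ) (U : Set (En n × ℝ)) (u : En n → ℝ → ℝ) : Prop :=
  ∀ (x₀ : En n) (t₀ r b : ℝ) (p : En n) (P : En n →L[ℝ] En n) (θ : ℝ), 0 < r →
    parCyl n x₀ t₀ r ⊆ U → IsPsd P → 0 ≤ θ →
    (∀ z s, (z, s) ∈ parCyl n x₀ t₀ r →
      u x₀ t₀ + b * (s - t₀) + inner ℝ p (z - x₀) + 1 / 2 * inner ℝ (P (z - x₀)) (z - x₀)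
        - θ / 2 * ‖z - x₀‖ ^ 2 ≤ u z s) →
    K⁻¹ * coordTrace P ≤ b + K * n * θ + c

lemma trace_mul_nonneg_of_posSemidef {n : ℕ} {B N : Matrix (Fin n) (Fin n) ℝ}
    (hB : B.PosSemidef) (hN : N.PosSemidef) : 0 ≤ (B * N).trace := by
  obtain ⟨m, a, rfl⟩ := Matrix.posSemidef_iff_eq_sum_vecMulVec.1 hN
  rw [Matrix.mul_sum, Matrix.trace_sum]
  refine Finset.sum_nonneg fun i _ => ?_
  rw [Matrix.mul_vecMulVec, Matrix.trace_vecMulVec, dotProduct_comm]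
  exact hB.dotProduct_mulVec_nonneg (a i)

lemma pucciSet_nonempty {n : ℕ} {K : ℝ} (hK : 1 < K) : (PucciSet n K).Nonempty := by
  refine ⟨1, Matrix.isSymm_one, ?_, ?_⟩
  · have : (1 : Matrix (Fin n) (Fin n) ℝ) - K⁻¹ • 1 = (1 - K⁻¹) • 1 := by rw [sub_smul, one_smul]
    rw [this]
    exact Matrix.PosSemidef.one.smul (sub_nonneg.2 (inv_le_one_of_one_le₀ hK.le))
  · have : K • (1 : Matrix (Fin n) (Fin n) ℝ) - 1 = (K - 1) • 1 := by rw [sub_smul, one_smul]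
    rw [this]
    exact Matrix.PosSemidef.one.smul (sub_nonneg.2 hK.le)

lemma le_pucciMinus_s4 {n : ℕ} {K : ℝ} (hK : 1 < K) {N : Matrix (Fin n) (Fin n) ℝ}
    (hN : N.PosSemidef) : K⁻¹ * N.trace ≤ PucciMinus n K N := by
  refine le_csInf ((pucciSet_nonempty hK).image _) ?_
  rintro _ ⟨A, ⟨-, hA, -⟩, rfl⟩
  have := trace_mul_nonneg_of_posSemidef hA hN
  simp only [Matrix.sub_mul, Matrix.trace_sub, Matrix.smul_mul, Matrix.one_mul,
    Matrix.trace_smul, smul_eq_mul] at this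
  linarith

lemma pucciPlus_smul_one_le {n : ℕ} {K θ : ℝ} (hK : 1 < K) (hθ : 0 ≤ θ) :
    PucciPlus n K (θ • 1) ≤ K * n * θ := by
  refine csSup_le ((pucciSet_nonempty hK).image _) ?_
  rintro _ ⟨A, ⟨-, -, hA⟩, rfl⟩
  have := hA.trace_nonneg
  simp only [Matrix.trace_sub, Matrix.trace_smul, Matrix.trace_one, smul_eq_mul,
    Fintype.card_fin] at this
  simp only [Matrix.mul_smul, Matrix.mul_one, Matrix.trace_smul, smul_eq_mul]
  nlinarith

lemma UniformlyElliptic.le_sub_smul_one {n : ℕ} {K θ : ℝ} {F : Matrix (Fin n) (Fin n) ℝ → ℝ}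
    (hF : UniformlyElliptic n K F) (hK : 1 < K) (h0 : F 0 = 0) {N : Matrix (Fin n) (Fin n) ℝ}
    (hN : N.PosSemidef) (hθ : 0 ≤ θ) :
    K⁻¹ * N.trace - K * n * θ ≤ F (N - θ • 1) := by
  have hs : N.IsSymm := by simpa [Matrix.IsHermitian, Matrix.IsSymm] using hN.isHermitian
  have h1s : (θ • (1 : Matrix (Fin n) (Fin n) ℝ)).IsSymm := by
    simp [Matrix.IsSymm]
  have h1 := (hF 0 N (by simp [Matrix.IsSymm]) hs hN).1
  have h2 := (hF (N - θ • 1) (θ • 1) (hs.sub h1s) h1s (Matrix.PosSemidef.one.smul hθ)).2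
  rw [sub_add_cancel] at h2
  rw [zero_add, h0, sub_zero] at h1
  linarith [le_pucciMinus_s4 hK hN, pucciPlus_smul_one_le (n := n) hK hθ]

/-- The Hessian of a quadratic polynomial. -/
lemma hessian_quadratic {n : ℕ} (x₀ p : En n) (P : En n →L[ℝ] En n)
    (hP : ∀ v w, inner ℝ (P v) w = inner ℝ (P w) v) (k θ : ℝ) :
    hessian n (fun z => k + inner ℝ p (z - x₀) + 1 / 2 * inner ℝ (P (z - x₀)) (z - x₀)
        - θ / 2 * ‖z - x₀‖ ^ 2) x₀ =
      (Matrix.of fun i j => P (EuclideanSpace.single i 1) j) - θ • 1 := by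
  have h1 : ∀ y, HasFDerivAt (fun z : En n => k + inner ℝ p (z - x₀)
      + 1 / 2 * inner ℝ (P (z - x₀)) (z - x₀) - θ / 2 * ‖z - x₀‖ ^ 2)
      (innerSL ℝ (p + P (y - x₀) - θ • (y - x₀))) y := by
    intro y
    have hs : HasFDerivAt (fun z : En n => z - x₀) (ContinuousLinearMap.id ℝ (En n)) y :=
      (hasFDerivAt_id y).sub_const x₀
    have ha := ((hasFDerivAt_const p y).inner ℝ hs).const_add k
    have hb := ((P.hasFDerivAt.comp y hs).inner ℝ hs).const_mul (1 / 2)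
    have hc := (hs.norm_sq).const_mul (θ / 2)
    refine ((ha.add hb).sub hc).congr_fderiv ?_
    ext v
    have := hP v (y - x₀)
    simp only [map_sub, inner_sub_left, inner_sub_right] at this
    simp [inner_sub_left, inner_sub_right]
    linarith
  ext i j
  have h2 : (fun y => fderiv ℝ (fun z : En n => k + inner ℝ p (z - x₀)
      + 1 / 2 * inner ℝ (P (z - x₀)) (z - x₀) - θ / 2 * ‖z - x₀‖ ^ 2) y
        (EuclideanSpace.single j (1:ℝ))) =
      fun y => innerSL ℝ (EuclideanSpace.single j (1:ℝ)) (p + P (y - x₀) - θ • (y - x₀)) := by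
    funext y
    rw [(h1 y).fderiv]
    simp only [innerSL_apply_apply]
    exact real_inner_comm _ _
  have h3 : HasFDerivAt (fun y => innerSL ℝ (EuclideanSpace.single j (1:ℝ))
      (p + P (y - x₀) - θ • (y - x₀)))
      ((innerSL ℝ (EuclideanSpace.single j (1:ℝ))).comp
        (P - θ • ContinuousLinearMap.id ℝ (En n))) x₀ := by
    have hs : HasFDerivAt (fun z : En n => z - x₀) (ContinuousLinearMap.id ℝ (En n)) x₀ :=
      (hasFDerivAt_id x₀).sub_const x₀
    refine ((innerSL ℝ (EuclideanSpace.single j (1:ℝ))).hasFDerivAt.comp x₀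
      (((P.hasFDerivAt.comp x₀ hs).const_add p).sub (hs.const_smul θ))).congr_fderiv ?_
    ext v
    simp
  unfold hessian
  rw [h2, h3.fderiv]
  simp [EuclideanSpace.inner_single_left, Matrix.one_apply, eq_comm]

lemma IsPsd.posSemidef {n : ℕ} {P : En n →L[ℝ] En n} (hP : IsPsd P) :
    (Matrix.of fun i j => P (EuclideanSpace.single i 1) j).PosSemidef := by
  refine Matrix.PosSemidef.of_dotProduct_mulVec_nonneg ?_ ?_
  · ext i j
    have := hP.1 (EuclideanSpace.single i 1) (EuclideanSpace.single j 1)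
    simpa [EuclideanSpace.inner_single_right] using this.symm
  · intro x
    have hx : P (WithLp.toLp 2 x) = ∑ i, x i • P (EuclideanSpace.single i 1) := by
      have : (WithLp.toLp 2 x : En n) = ∑ i, x i • EuclideanSpace.single i (1:ℝ) := by
        ext j
        simp [Finset.sum_apply, Pi.single_apply]
      rw [this, map_sum]
      simp
    have h := hP.2 (WithLp.toLp 2 x)
    rw [hx, sum_inner] at h
    refine h.trans_eq (Finset.sum_congr rfl fun i _ => ?_)
    simp [inner_smul_left, PiLp.inner_apply, Matrix.mulVec, dotProduct, mul_comm]

theorem IsViscSuperSol.pucciSuper {n : ℕ} {K c : ℝ} (hK : 1 < K)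
    {F : Matrix (Fin n) (Fin n) ℝ → ℝ} {f u : En n → ℝ → ℝ} {U : Set (En n × ℝ)}
    (hF : UniformlyElliptic n K F) (h0 : F 0 = 0) (hf : ∀ p ∈ U, -c ≤ f p.1 p.2)
    (hu : IsViscSuperSol n F f U u) : PucciSuper n K c U u := by
  intro x₀ t₀ r b p P θ hr hU hP hθ htouch
  have hmem : (x₀, t₀) ∈ parCyl n x₀ t₀ r :=
    ⟨mem_ball_self hr, by simp only [mem_Ioc]; constructor <;> nlinarith⟩
  have key := hu (fun z s => u x₀ t₀ + b * (s - t₀) + inner ℝ p (z - x₀)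
    + 1 / 2 * inner ℝ (P (z - x₀)) (z - x₀) - θ / 2 * ‖z - x₀‖ ^ 2) x₀ t₀ r hr (hU hmem) hU
    (fun t => by
      have : ContDiff ℝ 2 (fun z : En n => P (z - x₀)) := P.contDiff.comp (by fun_prop)
      have h2 : ContDiff ℝ 2 (fun z : En n => z - x₀) := by fun_prop
      exact ((contDiff_const.add (contDiff_const.inner ℝ h2)).add
        (contDiff_const.mul (this.inner ℝ h2))).sub (contDiff_const.mul (h2.norm_sq ℝ)))
    (fun x => by fun_prop)
    (fun q hq => by
      have := htouch q.1 q.2 hq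
      simp only [sub_self, mul_zero, inner_zero_right, add_zero, norm_zero, ne_eq,
        OfNat.ofNat_ne_zero, not_false_eq_true, zero_pow, sub_zero]
      linarith)
  have hd : deriv (fun s => u x₀ t₀ + b * (s - t₀) + inner ℝ p (x₀ - x₀)
      + 1 / 2 * inner ℝ (P (x₀ - x₀)) (x₀ - x₀) - θ / 2 * ‖x₀ - x₀‖ ^ 2) t₀ = b := by
    have : HasDerivAt (fun s => u x₀ t₀ + b * (s - t₀) + inner ℝ p (x₀ - x₀)
      + 1 / 2 * inner ℝ (P (x₀ - x₀)) (x₀ - x₀) - θ / 2 * ‖x₀ - x₀‖ ^ 2) (b * 1) t₀ :=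
      (((((((hasDerivAt_id t₀).sub_const t₀).const_mul b).const_add (u x₀ t₀)).add_const
        _).add_const _).sub_const _)
    rw [this.deriv, mul_one]
  rw [hd, hessian_quadratic x₀ p P hP.1] at key
  have h1 := hF.le_sub_smul_one hK h0 hP.posSemidef hθ
  have h2 : (Matrix.of fun i j => P (EuclideanSpace.single i 1) j).trace = coordTrace P := rfl
  rw [h2] at h1
  have := hf _ (hU hmem)
  simp only at this
  linarith

lemma IsPsd.abs_det_le {n : ℕ} {D : En n →L[ℝ] En n} (hD : IsPsd D) {Θ : ℝ}
    (h : coordTrace D ≤ Θ) : |D.det| ≤ Θ ^ n := by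
  set A : Matrix (Fin n) (Fin n) ℝ := Matrix.of fun i j => D (EuclideanSpace.single i 1) j with hA
  have hpsd : A.PosSemidef := hD.posSemidef
  have hdet : D.det = A.det := by
    rw [← Matrix.det_transpose, ContinuousLinearMap.det,
      ← LinearMap.det_toMatrix (EuclideanSpace.basisFun (Fin n) ℝ).toBasis]
    congr 1
  have htr : A.trace = ∑ i, hpsd.isHermitian.eigenvalues i := by
    simpa using hpsd.isHermitian.trace_eq_sum_eigenvalues
  have hle : ∀ i, hpsd.isHermitian.eigenvalues i ≤ Θ := fun i => by
    refine (Finset.single_le_sum (fun j _ => hpsd.eigenvalues_nonneg j)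
      (Finset.mem_univ i)).trans ?_
    rw [← htr]; exact h
  rw [hdet, hpsd.isHermitian.det_eq_prod_eigenvalues]
  have h0 : ∀ i, 0 ≤ hpsd.isHermitian.eigenvalues i := hpsd.eigenvalues_nonneg
  simp only [RCLike.ofReal_real_eq_id, id_eq]
  rw [abs_of_nonneg (Finset.prod_nonneg fun i _ => h0 i)]
  calc _ ≤ ∏ _i : Fin n, Θ := Finset.prod_le_prod (fun i _ => h0 i) fun i _ => hle i
    _ = Θ ^ n := by simp

section Legendre

variable {E : Type*} [NormedAddCommGroup E] [InnerProductSpace ℝ E]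

/-- `Y x` maximises `y ↦ ⟪x, y⟫ - h y`, with value `G x` and a quadratic gap `lam / 4`. -/
structure LegendreData (h : E → ℝ) (lam : ℝ) (Y : E → E) (G : E → ℝ) : Prop where
  eq : ∀ x, inner ℝ x (Y x) - h (Y x) = G x
  gap : ∀ x y, inner ℝ x y - h y + lam / 4 * ‖Y x - y‖ ^ 2 ≤ G x

lemma exists_legendreData [FiniteDimensional ℝ E] {h : E → ℝ} {lam C : ℝ} (hlam : 0 < lam)
    (hc : Continuous h)
    (hmid : ∀ y y', h ((1 / 2 : ℝ) • (y + y')) ≤ (h y + h y') / 2 - lam / 8 * ‖y - y'‖ ^ 2)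
    (hco : ∀ y, lam / 2 * ‖y‖ ^ 2 - C * (1 + ‖y‖) ≤ h y) :
    ∃ Y G, LegendreData h lam Y G := by
  have hex : ∀ x, ∃ y, ∀ y', inner ℝ x y' - h y' ≤ inner ℝ x y - h y := by
    intro x
    have ht : Tendsto (fun y => h y - inner ℝ x y) (cocompact E) atTop := by
      have h1 : Tendsto (fun s : ℝ => s * (lam / 2 * s - (C + ‖x‖)) + (-C)) atTop atTop := by
        refine tendsto_atTop_add_const_right _ _ ?_
        refine tendsto_id.atTop_mul_atTop₀ ?_
        refine tendsto_atTop_add_const_right _ _ ?_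
        exact tendsto_id.const_mul_atTop (by positivity)
      refine tendsto_atTop_mono (fun y => ?_) (h1.comp tendsto_norm_cocompact_atTop)
      have := hco y
      have h2 := real_inner_le_norm x y
      simp only [Function.comp]
      nlinarith
    obtain ⟨y, hy⟩ := Continuous.exists_forall_le (by fun_prop) ht
    exact ⟨y, fun y' => by have := hy y'; linarith⟩
  choose Y hY using hex
  refine ⟨Y, fun x => inner ℝ x (Y x) - h (Y x), fun x => rfl, fun x y => ?_⟩
  have h1 := hY x ((1 / 2 : ℝ) • (Y x + y))
  have h2 := hmid (Y x) y
  rw [inner_smul_right, inner_add_right] at h1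
  linarith

namespace LegendreData

variable {h G : E → ℝ} {lam : ℝ} {Y : E → E}

lemma add_le (L : LegendreData h lam Y G) (hlam : 0 ≤ lam) (x x' : E) :
    G x + inner ℝ (x' - x) (Y x) ≤ G x' := by
  have h1 := L.gap x' (Y x)
  have h2 := L.eq x
  have : 0 ≤ lam / 4 * ‖Y x' - Y x‖ ^ 2 := by positivity
  rw [inner_sub_left]; linarith

lemma strongMono (L : LegendreData h lam Y G) (x x' : E) :
    lam / 2 * ‖Y x' - Y x‖ ^ 2 ≤ inner ℝ (x' - x) (Y x' - Y x) := by
  have h1 := L.gap x' (Y x)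
  have h2 := L.gap x (Y x')
  have h3 := L.eq x
  have h4 := L.eq x'
  rw [norm_sub_rev] at h2
  simp only [inner_sub_left, inner_sub_right]; linarith

lemma norm_sub_le (L : LegendreData h lam Y G) (hlam : 0 < lam) (x x' : E) :
    ‖Y x' - Y x‖ ≤ 2 / lam * ‖x' - x‖ := by
  have h1 := (L.strongMono x x').trans (real_inner_le_norm _ _)
  rcases (norm_nonneg (Y x' - Y x)).eq_or_lt with h0 | h0
  · rw [← h0]; positivity
  · rw [div_mul_eq_mul_div, le_div_iff₀ hlam]
    nlinarith

lemma lipschitz (L : LegendreData h lam Y G) (hlam : 0 < lam) :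
    LipschitzWith (2 / lam).toNNReal Y := by
  refine LipschitzWith.of_dist_le_mul fun x y => ?_
  rw [dist_eq_norm, dist_eq_norm, Real.coe_toNNReal _ (by positivity)]
  exact L.norm_sub_le hlam y x

lemma hasFDerivAt (L : LegendreData h lam Y G) (hlam : 0 < lam) (x : E) :
    HasFDerivAt G (innerSL ℝ (Y x)) x := by
  refine HasFDerivAt.of_isLittleO ?_
  have hO : (fun x' => G x' - G x - innerSL ℝ (Y x) (x' - x)) =O[𝓝 x] fun x' => ‖x' - x‖ ^ 2 := by
    refine Asymptotics.IsBigO.of_bound (2 / lam) (Eventually.of_forall fun x' => ?_)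
    have h1 := L.add_le hlam.le x x'
    have h2 := L.add_le hlam.le x' x
    have h3 := L.norm_sub_le hlam x x'
    have h4 := real_inner_le_norm (x' - x) (Y x' - Y x)
    have h5 : inner ℝ (x' - x) (Y x' - Y x) = inner ℝ (x' - x) (Y x') - inner ℝ (x' - x) (Y x) :=
      inner_sub_right _ _ _
    have h6 : inner ℝ (x - x') (Y x') = - inner ℝ (x' - x) (Y x') := by
      rw [← inner_neg_left, neg_sub]
    rw [innerSL_apply_apply, real_inner_comm, Real.norm_eq_abs, abs_of_nonneg (by linarith),
      Real.norm_eq_abs, abs_of_nonneg (by positivity)]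
    have : ‖x' - x‖ * ‖Y x' - Y x‖ ≤ ‖x' - x‖ * (2 / lam * ‖x' - x‖) := by gcongr
    nlinarith
  refine hO.trans_isLittleO ?_
  have h2 : Tendsto (fun x' => x' - x) (𝓝 x) (𝓝 0) := by
    have : Tendsto (fun x' : E => x' - x) (𝓝 x) (𝓝 (x - x)) := by
      exact (continuous_id.sub continuous_const).tendsto x
    simpa using this
  exact (Asymptotics.isLittleO_norm_pow_id one_lt_two).comp_tendsto h2

lemma inner_deriv_symm (L : LegendreData h lam Y G) (hlam : 0 < lam) {x : E} {D : E →L[ℝ] E}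
    (hD : HasFDerivAt Y D x) (v w : E) : inner ℝ (D v) w = inner ℝ (D w) v := by
  have := second_derivative_symmetric (f := G) (f' := fun x => innerSL ℝ (Y x))
    (f'' := (innerSL ℝ).comp D) (x := x) (fun y => L.hasFDerivAt hlam y)
    ((innerSL ℝ).hasFDerivAt.comp x hD) v w
  simpa using this

lemma inner_deriv_nonneg (L : LegendreData h lam Y G) (hlam : 0 < lam) {x : E} {D : E →L[ℝ] E}
    (hD : HasFDerivAt Y D x) (v : E) : 0 ≤ inner ℝ (D v) v := by
  have h1 : HasDerivAt (fun t : ℝ => inner ℝ (Y (x + t • v)) v) (inner ℝ (D v) v) 0 := by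
    have hl : HasDerivAt (fun t : ℝ => x + t • v) v 0 := by
      simpa using ((hasDerivAt_id (0:ℝ)).smul_const v).const_add x
    have := (HasFDerivAt.comp_hasDerivAt_of_eq (0:ℝ) hD hl (by simp))
    simpa using this.inner ℝ (hasDerivAt_const (0:ℝ) v)
  have hmono : Monotone fun t : ℝ => inner ℝ (Y (x + t • v)) v := by
    intro s t hst
    rcases hst.eq_or_lt with rfl | hlt
    · exact le_rfl
    have := L.strongMono (x + s • v) (x + t • v)
    rw [show x + t • v - (x + s • v) = (t - s) • v by rw [sub_smul]; abel,
      inner_smul_left, inner_sub_right] at this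
    have h0 : 0 ≤ lam / 2 * ‖Y (x + t • v) - Y (x + s • v)‖ ^ 2 := by positivity
    have h2 := h0.trans this
    simp only [RCLike.conj_to_real] at h2
    have := nonneg_of_mul_nonneg_right h2 (sub_pos.2 hlt)
    simp only [real_inner_comm v] at *
    linarith
  rw [← h1.deriv]
  exact hmono.deriv_nonneg

lemma taylor (L : LegendreData h lam Y G) (hlam : 0 < lam) {x : E} {D : E →L[ℝ] E}
    (hD : HasFDerivAt Y D x) {ε : ℝ} (hε : 0 < ε) :
    ∀ᶠ ζ in 𝓝 (0 : E), G x + inner ℝ (Y x) ζ + 1 / 2 * inner ℝ (D ζ) ζ - ε * ‖ζ‖ ^ 2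
      ≤ G (x + ζ) := by
  have hl := hD.isLittleO.def hε
  rw [Metric.eventually_nhds_iff] at hl ⊢
  obtain ⟨δ, hδ, hl⟩ := hl
  refine ⟨δ, hδ, fun ζ hζ => ?_⟩
  rw [dist_zero_right] at hζ
  have hder : ∀ y ∈ closedBall x ‖ζ‖, HasFDerivWithinAt
      (fun y => G y - inner ℝ (Y x) (y - x) - 1 / 2 * inner ℝ (D (y - x)) (y - x))
      (innerSL ℝ (Y y - Y x - D (y - x))) (closedBall x ‖ζ‖) y := by
    intro y _
    have hs : HasFDerivAt (fun z : E => z - x) (ContinuousLinearMap.id ℝ E) y :=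
      (hasFDerivAt_id y).sub_const x
    have ha := (hasFDerivAt_const (Y x) y).inner ℝ hs
    have hb := ((D.hasFDerivAt.comp y hs).inner ℝ hs).const_mul (1 / 2)
    refine (((L.hasFDerivAt hlam y).sub ha).sub hb).hasFDerivWithinAt.congr_fderiv ?_
    ext v
    have := L.inner_deriv_symm hlam hD v (y - x)
    simp only [map_sub, inner_sub_left, inner_sub_right] at this
    simp [inner_sub_left, inner_sub_right]
    linarith
  have hb : ∀ y ∈ closedBall x ‖ζ‖, ‖innerSL ℝ (Y y - Y x - D (y - x))‖ ≤ ε * ‖ζ‖ := by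
    intro y hy
    rw [innerSL_apply_norm]
    have hy' : ‖y - x‖ ≤ ‖ζ‖ := by simpa [dist_eq_norm] using hy
    refine (hl (y := y) ?_).trans (by gcongr)
    exact (mem_closedBall.1 hy).trans_lt hζ
  have := (convex_closedBall x ‖ζ‖).norm_image_sub_le_of_norm_hasFDerivWithin_le hder hb
    (mem_closedBall_self (norm_nonneg _)) (y := x + ζ) (by simp)
  simp only [add_sub_cancel_left, sub_self, map_zero, inner_zero_right, mul_zero, sub_zero,
    Real.norm_eq_abs] at this
  have := (abs_le.1 this).1
  nlinarith

end LegendreData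
end Legendre

lemma LegendreData.isPsd {n : ℕ} {h G : En n → ℝ} {lam : ℝ} {Y : En n → En n}
    (L : LegendreData h lam Y G) (hlam : 0 < lam) {x : En n} {D : En n →L[ℝ] En n}
    (hD : HasFDerivAt Y D x) : IsPsd D :=
  ⟨L.inner_deriv_symm hlam hD, L.inner_deriv_nonneg hlam hD⟩

/-- Lipschitz images of null sets are null. -/
lemma LipschitzWith.volume_image_eq_zero {n : ℕ} {C : NNReal} {Y : En n → En n}
    (hY : LipschitzWith C Y) {N : Set (En n)} (hN : volume N = 0) : volume (Y '' N) = 0 := by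
  have h1 : μH[(Module.finrank ℝ (En n) : ℝ)] N = 0 :=
    Measure.absolutelyContinuous_isAddHaarMeasure _ volume hN
  refine Measure.absolutelyContinuous_isAddHaarMeasure volume
    μH[(Module.finrank ℝ (En n) : ℝ)] ?_
  refine le_antisymm ((hY.hausdorffMeasure_image_le (by positivity) N).trans ?_) bot_le
  rw [h1, mul_zero]

lemma LegendreData.volume_image_le {n : ℕ} {h G : En n → ℝ} {lam Θ : ℝ} {Y : En n → En n}
    (L : LegendreData h lam Y G) (hlam : 0 < lam) {S : Set (En n)} (hS : MeasurableSet S)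
    (hΘ : ∀ x ∈ S, ∀ D, HasFDerivAt Y D x → coordTrace D ≤ Θ) :
    volume (Y '' S) ≤ ENNReal.ofReal (Θ ^ n) * volume S := by
  have hlip := L.lipschitz hlam
  have hm := measurableSet_of_differentiableAt ℝ Y
  set M := {x | DifferentiableAt ℝ Y x}
  have hnull : volume (S \ M) = 0 := by
    refine measure_mono_null (fun x hx => hx.2) (ae_iff.1 (hlip.ae_differentiableAt (μ := volume)))
  calc volume (Y '' S) ≤ volume (Y '' (S ∩ M) ∪ Y '' (S \ M)) := by
        rw [← image_union, inter_union_sdiff]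
    _ ≤ volume (Y '' (S ∩ M)) + volume (Y '' (S \ M)) := measure_union_le _ _
    _ = volume (Y '' (S ∩ M)) := by rw [hlip.volume_image_eq_zero hnull, add_zero]
    _ ≤ ∫⁻ x in S ∩ M, ENNReal.ofReal |(fderiv ℝ Y x).det| :=
        addHaar_image_le_lintegral_abs_det_fderiv _ (hS.inter hm)
          fun x hx => (hx.2.hasFDerivAt).hasFDerivWithinAt
    _ ≤ ∫⁻ _ in S ∩ M, ENNReal.ofReal (Θ ^ n) := by
        refine setLIntegral_mono (by fun_prop) fun x hx => ?_
        refine ENNReal.ofReal_le_ofReal ((L.isPsd hlam hx.2.hasFDerivAt).abs_det_le ?_)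
        exact hΘ x hx.1 _ hx.2.hasFDerivAt
    _ ≤ ENNReal.ofReal (Θ ^ n) * volume S := by
        rw [setLIntegral_const]; gcongr; exact inter_subset_left

lemma exists_conjugate {E : Type*} [NormedAddCommGroup E] [InnerProductSpace ℝ E] {Ω : Set E}
    (hΩ : IsCompact Ω) (hne : Ω.Nonempty) {ψ : E → ℝ} (hψ : ContinuousOn ψ Ω) :
    ∃ H : E → ℝ, Continuous H ∧ (∀ z ∈ Ω, ∀ y, inner ℝ z y - ψ z ≤ H y) ∧
      ∀ y, ∃ z ∈ Ω, H y = inner ℝ z y - ψ z := by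
  have hex : ∀ y, ∃ z ∈ Ω, ∀ z' ∈ Ω, inner ℝ z' y - ψ z' ≤ inner ℝ z y - ψ z := fun y =>
    hΩ.exists_isMaxOn hne (f := fun z => inner ℝ z y - ψ z) (by fun_prop)
  choose Z hZ hmax using hex
  obtain ⟨R, hR⟩ := hΩ.isBounded.exists_norm_le
  have hR0 : 0 ≤ R := (norm_nonneg _).trans (hR _ (hZ 0))
  refine ⟨fun y => inner ℝ (Z y) y - ψ (Z y), ?_, fun z hz y => hmax y z hz,
    fun y => ⟨Z y, hZ y, rfl⟩⟩
  refine (LipschitzWith.of_le_add_mul R.toNNReal fun y y' => ?_).continuous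
  have h1 := hmax y' (Z y) (hZ y)
  have h2 : inner ℝ (Z y) y = inner ℝ (Z y) y' + inner ℝ (Z y) (y - y') := by
    rw [← inner_add_right]; congr 1; abel
  have h3 := real_inner_le_norm (Z y) (y - y')
  have h4 : ‖Z y‖ * ‖y - y'‖ ≤ R * ‖y - y'‖ := by gcongr; exact hR _ (hZ y)
  rw [Real.coe_toNNReal _ hR0, dist_eq_norm]
  linarith

/-- `z` minimises `w + a/2 |· - y|²` over `Ω`. -/
def IsContact {n : ℕ} (Ω : Set (En n)) (w : En n → ℝ) (a : ℝ) (z y : En n) : Prop :=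
  z ∈ Ω ∧ ∀ z' ∈ Ω, w z + a / 2 * ‖z - y‖ ^ 2 ≤ w z' + a / 2 * ‖z' - y‖ ^ 2

lemma isCompact_contact {n : ℕ} {Ω V : Set (En n)} (hΩ : IsCompact Ω) (hV : IsCompact V)
    {w : En n → ℝ} (hw : ContinuousOn w Ω) (a : ℝ) :
    IsCompact {q : En n × En n | IsContact Ω w a q.1 q.2 ∧ q.2 ∈ V} := by
  have : {q : En n × En n | IsContact Ω w a q.1 q.2 ∧ q.2 ∈ V} =
      (Ω ×ˢ V) ∩ ⋂ z' ∈ Ω, (Ω ×ˢ V) ∩ (fun q : En n × En n =>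
        w q.1 + a / 2 * ‖q.1 - q.2‖ ^ 2 - a / 2 * ‖z' - q.2‖ ^ 2 - w z') ⁻¹' Iic 0 := by
    ext q
    simp only [IsContact, mem_ofPred_eq, mem_inter_iff, mem_prod, mem_iInter, mem_preimage, mem_Iic]
    constructor
    · rintro ⟨⟨h1, h2⟩, h3⟩
      exact ⟨⟨h1, h3⟩, fun z' hz' => ⟨⟨h1, h3⟩, by linarith [h2 z' hz']⟩⟩
    · rintro ⟨⟨h1, h3⟩, h2⟩
      exact ⟨⟨h1, fun z' hz' => by linarith [(h2 z' hz').2]⟩, h3⟩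
  rw [this]
  refine (hΩ.prod hV).inter_right (isClosed_biInter fun z' _ => ?_)
  refine ContinuousOn.preimage_isClosed_of_isClosed ?_ (hΩ.prod hV).isClosed isClosed_Iic
  have h1 : ContinuousOn (fun q : En n × En n => w q.1) (Ω ×ˢ V) :=
    hw.comp continuousOn_fst fun q hq => hq.1
  exact ((h1.add (by fun_prop)).sub (by fun_prop)).sub continuousOn_const

/-- Aleksandrov-Bakelman-Pucci type estimate with paraboloids as test functions. -/
theorem volume_le_of_contact {n : ℕ} {K : ℝ} (hK : 1 < K) {Ω V S : Set (En n)}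
    (hΩ : IsCompact Ω) (hne : Ω.Nonempty) (hV : IsCompact V) (hS : IsCompact S)
    {w : En n → ℝ} (hw : ContinuousOn w Ω) {a c : ℝ} (ha : 0 < a)
    (hcS : ∀ z y, y ∈ V → IsContact Ω w a z y → z ∈ S)
    (hintg : ∀ z y, y ∈ V → IsContact Ω w a z y → Ω ∈ 𝓝 z)
    (hjet : ∀ z y, y ∈ V → IsContact Ω w a z y → ∀ (P : En n →L[ℝ] En n) (θ : ℝ), IsPsd P → 0 ≤ θ →
      (∀ᶠ ζ in 𝓝 (0 : En n), w z + inner ℝ (a • (y - z)) ζ + 1 / 2 * inner ℝ (P ζ) ζ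
        - θ / 2 * ‖ζ‖ ^ 2 ≤ w (z + ζ)) → K⁻¹ * coordTrace P ≤ K * n * θ + c) :
    volume V ≤ ENNReal.ofReal ((2 * K * (2 * K * n + c / a)) ^ n) * volume S := by
  set Θ : ℝ := 2 * K * (2 * K * n + c / a)
  set ψ : En n → ℝ := fun z => w z / a + 1 / 2 * ‖z‖ ^ 2 with hψ
  obtain ⟨H, hHc, hHle, hHeq⟩ := exists_conjugate hΩ hne (ψ := ψ) (by fun_prop)
  -- contact in terms of the conjugate
  have hcontact : ∀ z y, IsContact Ω w a z y → H y = inner ℝ z y - ψ z := by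
    intro z y hz
    obtain ⟨z', hz', h⟩ := hHeq y
    refine le_antisymm ?_ (hHle z hz.1 y)
    rw [h]
    have := hz.2 z' hz'
    rw [norm_sub_sq_real, norm_sub_sq_real] at this
    have h3 : (w z + a / 2 * (‖z‖ ^ 2 - 2 * inner ℝ z y + ‖y‖ ^ 2)) / a ≤
      (w z' + a / 2 * (‖z'‖ ^ 2 - 2 * inner ℝ z' y + ‖y‖ ^ 2)) / a := by gcongr
    have e : ∀ A B : ℝ, (A + a / 2 * B) / a = A / a + B / 2 := fun A B => by field_simp
    rw [e, e] at h3
    simp only [hψ]; linarith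
  obtain ⟨R, hR⟩ := (hΩ.union hV).isBounded.exists_norm_le
  -- estimate for fixed regularisation parameter
  have main : ∀ lam : ℝ, 0 < lam → lam ≤ 1 / 2 →
      volume V ≤ ENNReal.ofReal (Θ ^ n) * volume (cthickening (lam * (2 * R)) S) := by
    intro lam hlam hlam2
    obtain ⟨z0, hz0⟩ := hne
    obtain ⟨Y, G, L⟩ := exists_legendreData (h := fun y => (1 - lam) * H y + lam / 2 * ‖y‖ ^ 2)
      (C := ‖z0‖ + |ψ z0|) hlam (by fun_prop) (fun y y' => by
        obtain ⟨z, hz, h⟩ := hHeq ((1 / 2 : ℝ) • (y + y'))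
        have h1 := hHle z hz y
        have h2 := hHle z hz y'
        rw [inner_smul_right, inner_add_right] at h
        have h3 := parallelogram_law_with_norm ℝ y y'
        have h4 : ‖(1 / 2 : ℝ) • (y + y')‖ ^ 2 = 1 / 4 * ‖y + y'‖ ^ 2 := by
          rw [norm_smul, mul_pow]; norm_num
        rw [h4]
        have : H ((1 / 2 : ℝ) • (y + y')) ≤ (H y + H y') / 2 := by linarith
        nlinarith) (fun y => by
        have h1 := hHle z0 hz0 y
        have h2 := abs_real_inner_le_norm z0 y
        have h3 := neg_abs_le (inner ℝ z0 y)
        have h4 := le_abs_self (ψ z0)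
        have h5 : -(‖z0‖ * ‖y‖ + |ψ z0|) ≤ H y := by linarith
        have h6 := norm_nonneg z0
        have h7 := norm_nonneg y
        have h8 := abs_nonneg (ψ z0)
        have h9 : 0 ≤ ‖z0‖ * ‖y‖ := by positivity
        have h10 : 0 ≤ |ψ z0| * ‖y‖ := by positivity
        nlinarith)
    -- the key inequality
    have hGle : ∀ z ∈ Ω, ∀ y,
        G ((1 - lam) • z + lam • y) ≤ lam / 2 * ‖y‖ ^ 2 + (1 - lam) * ψ z := by
      intro z hz y
      rw [← L.eq]
      set y' := Y ((1 - lam) • z + lam • y)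
      have h1 := hHle z hz y'
      have h2 : 0 ≤ ‖y - y'‖ ^ 2 := by positivity
      rw [norm_sub_sq_real] at h2
      rw [inner_add_left, inner_smul_left, inner_smul_left]
      simp only [RCLike.conj_to_real]
      nlinarith
    have hGeq : ∀ z y, IsContact Ω w a z y →
        G ((1 - lam) • z + lam • y) = lam / 2 * ‖y‖ ^ 2 + (1 - lam) * ψ z ∧
        Y ((1 - lam) • z + lam • y) = y := by
      intro z y hz
      have h1 := hGle z hz.1 y
      have h2 := L.gap ((1 - lam) • z + lam • y) y
      rw [inner_add_left, inner_smul_left, inner_smul_left, hcontact z y hz,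
        real_inner_self_eq_norm_sq] at h2
      simp only [RCLike.conj_to_real] at h2
      have h3 : 0 ≤ lam / 4 * ‖Y ((1 - lam) • z + lam • y) - y‖ ^ 2 := by positivity
      have h4 : lam / 4 * ‖Y ((1 - lam) • z + lam • y) - y‖ ^ 2 ≤ 0 := by nlinarith
      refine ⟨by nlinarith, ?_⟩
      have h5 : ‖Y ((1 - lam) • z + lam • y) - y‖ ^ 2 = 0 := by
        have : 0 ≤ ‖Y ((1 - lam) • z + lam • y) - y‖ ^ 2 := by positivity
        nlinarith
      exact sub_eq_zero.1 (norm_eq_zero.1 (pow_eq_zero_iff two_ne_zero |>.1 h5))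
    set X : Set (En n) := (fun q : En n × En n => (1 - lam) • q.1 + lam • q.2) ''
      {q : En n × En n | IsContact Ω w a q.1 q.2 ∧ q.2 ∈ V} with hX
    have hXc : IsCompact X := (isCompact_contact hΩ hV hw a).image (by fun_prop)
    have hsub : V ⊆ Y '' X := by
      intro y hy
      obtain ⟨z, hz, hmin⟩ := hΩ.exists_isMinOn ⟨z0, hz0⟩
        (f := fun z => w z + a / 2 * ‖z - y‖ ^ 2) (by fun_prop)
      exact ⟨_, ⟨(z, y), ⟨⟨hz, hmin⟩, hy⟩, rfl⟩, (hGeq z y ⟨hz, hmin⟩).2⟩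
    have hthick : X ⊆ cthickening (lam * (2 * R)) S := by
      rintro _ ⟨⟨z, y⟩, ⟨hz, hy⟩, rfl⟩
      refine mem_cthickening_of_dist_le _ z _ _ (hcS z y hy hz) ?_
      have : (1 - lam) • z + lam • y - z = lam • (y - z) := by module
      rw [dist_eq_norm, this, norm_smul, Real.norm_of_nonneg hlam.le]
      have h1 := hR z (Or.inl hz.1)
      have h2 := hR y (Or.inr hy)
      have := norm_sub_le y z
      gcongr; linarith
    have htr : ∀ x ∈ X, ∀ D, HasFDerivAt Y D x → coordTrace D ≤ Θ := by
      rintro _ ⟨⟨z, y⟩, ⟨hz, hy⟩, rfl⟩ D hD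
      simp only at hD hz hy
      have hpsd := L.isPsd hlam hD
      have hl' : 0 < 1 - lam := by linarith
      have hP : IsPsd ((a * (1 - lam)) • D) := by
        constructor
        · intro v w
          simp [inner_smul_left, hpsd.1 v w]
        · intro v
          have := hpsd.2 v
          simp only [_root_.smul_apply, inner_smul_left, RCLike.conj_to_real]
          positivity
      have key := hjet z y hy hz _ (2 * a) hP (by positivity) (by
        have h1 := L.taylor hlam hD (ε := 1 / 2) (by norm_num)
        have ht : Tendsto (fun ζ : En n => (1 - lam) • ζ) (𝓝 0) (𝓝 0) := by
          have : Tendsto (fun ζ : En n => (1 - lam) • ζ) (𝓝 0) (𝓝 ((1 - lam) • 0)) :=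
            (continuous_const_smul _).tendsto _
          simpa using this
        have ht2 : Tendsto (fun ζ : En n => z + ζ) (𝓝 0) (𝓝 z) := by
          have : Tendsto (fun ζ : En n => z + ζ) (𝓝 0) (𝓝 (z + 0)) :=
            (continuous_const.add continuous_id).tendsto _
          simpa using this
        filter_upwards [ht.eventually h1, ht2.eventually (hintg z y hy hz)] with ζ h3 h4
        have h5 := hGle (z + ζ) h4 y
        rw [show (1 - lam) • (z + ζ) + lam • y = (1 - lam) • z + lam • y + (1 - lam) • ζ by
          module] at h5
        rw [(hGeq z y hz).1, (hGeq z y hz).2] at h3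
        simp only [map_smul, inner_smul_left, inner_smul_right, norm_smul,
          Real.norm_of_nonneg hl'.le, RCLike.conj_to_real, mul_pow] at h3
        have h6 : ψ z + inner ℝ y ζ + (1 - lam) * (1 / 2 * inner ℝ (D ζ) ζ - 1 / 2 * ‖ζ‖ ^ 2) ≤
            ψ (z + ζ) := by
          refine le_of_mul_le_mul_left ?_ hl'
          nlinarith
        have e1 : ∀ z, w z = a * ψ z - a / 2 * ‖z‖ ^ 2 := fun z => by
          simp only [hψ]; field_simp; ring
        rw [e1, e1, norm_add_sq_real]
        simp only [_root_.smul_apply, inner_smul_left, inner_sub_left,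
          RCLike.conj_to_real]
        have h7 := mul_le_mul_of_nonneg_left h6 ha.le
        have h8 : 0 ≤ a * lam * ‖ζ‖ ^ 2 := by positivity
        nlinarith)
      have e2 : coordTrace ((a * (1 - lam)) • D) = a * (1 - lam) * coordTrace D := by
        simp [coordTrace, Finset.mul_sum]
      rw [e2] at key
      have htr0 : 0 ≤ coordTrace D := by
        have := hpsd.posSemidef.trace_nonneg
        exact this
      have h1 : K⁻¹ * (a * (1 / 2) * coordTrace D) ≤ K * n * (2 * a) + c := by
        refine le_trans ?_ key
        have : 0 < K := by linarith
        gcongr; linarith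
      have h2 : coordTrace D = 2 * K * (K⁻¹ * (a * (1 / 2) * coordTrace D) / a) := by
        have : K ≠ 0 := by linarith
        field_simp
      rw [h2]
      have h3 : K⁻¹ * (a * (1 / 2) * coordTrace D) / a ≤ (K * n * (2 * a) + c) / a := by gcongr
      have h4 : (K * n * (2 * a) + c) / a = 2 * K * n + c / a := by field_simp
      rw [h4] at h3
      have : 0 ≤ 2 * K := by linarith
      exact mul_le_mul_of_nonneg_left h3 this
    calc volume V ≤ volume (Y '' X) := measure_mono hsub
      _ ≤ ENNReal.ofReal (Θ ^ n) * volume X := L.volume_image_le hlam hXc.measurableSet htr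
      _ ≤ _ := by gcongr
  have hlim : Tendsto
      (fun lam : ℝ => ENNReal.ofReal (Θ ^ n) * volume (cthickening (lam * (2 * R)) S))
      (𝓝[>] 0) (𝓝 (ENNReal.ofReal (Θ ^ n) * volume S)) := by
    refine ENNReal.Tendsto.const_mul ?_ (Or.inr ENNReal.ofReal_ne_top)
    refine (tendsto_measure_cthickening_of_isCompact hS).comp ?_
    have : Tendsto (fun lam : ℝ => lam * (2 * R)) (𝓝 0) (𝓝 (0 * (2 * R))) :=
      (continuous_id.mul continuous_const).tendsto _
    rw [zero_mul] at this
    exact this.mono_left nhdsWithin_le_nhds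
  refine ge_of_tendsto hlim ?_
  filter_upwards [Ioo_mem_nhdsGT (show (0:ℝ) < 1 / 2 by norm_num)] with lam h
  exact main lam h.1 h.2.le

lemma PucciSuper.mono {n : ℕ} {K c : ℝ} {U V : Set (En n × ℝ)} {u : En n → ℝ → ℝ}
    (h : PucciSuper n K c V u) (hUV : U ⊆ V) : PucciSuper n K c U u :=
  fun x₀ t₀ r b p P θ hr hU => h x₀ t₀ r b p P θ hr (hU.trans hUV)

lemma exists_parCyl_subset {n : ℕ} {x₀ : En n} {t₀ : ℝ} {p : En n × ℝ → Prop}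
    (h : ∀ᶠ q in 𝓝 (x₀, t₀), p q) : ∃ r > 0, ∀ q ∈ parCyl n x₀ t₀ r, p q := by
  obtain ⟨δ, hδ, h⟩ := Metric.eventually_nhds_iff.1 h
  refine ⟨min (δ / 2) 1, by positivity, fun q hq => h ?_⟩
  have h1 : min (δ / 2) 1 ≤ δ / 2 := min_le_left _ _
  have h2 : min (δ / 2) 1 ≤ 1 := min_le_right _ _
  have h0 : 0 < min (δ / 2) 1 := by positivity
  obtain ⟨ha, hb1, hb2⟩ := hq
  rw [Prod.dist_eq, Real.dist_eq, max_lt_iff, abs_lt]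
  refine ⟨(mem_ball.1 ha).trans (by linarith), ?_, ?_⟩ <;> simp only <;> nlinarith

/-- Version of the defining property of `PucciSuper` with a germ of a test function. -/
lemma PucciSuper.jet {n : ℕ} {K c : ℝ} {U : Set (En n × ℝ)} {u : En n → ℝ → ℝ}
    (h : PucciSuper n K c U u) {x₀ : En n} {t₀ b : ℝ} {p : En n} {P : En n →L[ℝ] En n} {θ : ℝ}
    (hU : ∀ᶠ q in 𝓝 (x₀, t₀), q.2 ≤ t₀ → q ∈ U) (hP : IsPsd P) (hθ : 0 ≤ θ)
    (ht : ∀ᶠ q in 𝓝 (x₀, t₀), q.2 ≤ t₀ →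
      u x₀ t₀ + b * (q.2 - t₀) + inner ℝ p (q.1 - x₀) + 1 / 2 * inner ℝ (P (q.1 - x₀)) (q.1 - x₀)
        - θ / 2 * ‖q.1 - x₀‖ ^ 2 ≤ u q.1 q.2) :
    K⁻¹ * coordTrace P ≤ b + K * n * θ + c := by
  obtain ⟨r, hr, hr'⟩ := exists_parCyl_subset (hU.and ht)
  exact h x₀ t₀ r b p P θ hr (fun q hq => (hr' q hq).1 hq.2.2) hP hθ
    fun z s hq => (hr' (z, s) hq).2 hq.2.2

/-- Times at which a function is strictly below all its earlier values. -/
def recordTimes (f : ℝ → ℝ) (a b : ℝ) : Set ℝ := {t | t ∈ Ioc a b ∧ ∀ s ∈ Ico a t, f t < f s}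

lemma volume_recordTimes_ge {f : ℝ → ℝ} {a b Λ : ℝ} (hab : a ≤ b) (hΛ : 0 ≤ Λ)
    (hf : ContinuousOn f (Icc a b)) (hanti : AntitoneOn f (Icc a b))
    (hlip : ∀ r t, a ≤ r → r ≤ t → t ≤ b → f r - f t ≤ Λ * (t - r)) :
    ENNReal.ofReal (f a - f b) ≤ ENNReal.ofReal Λ * volume (recordTimes f a b) := by
  have hsub : Ico (f b) (f a) ⊆ f '' recordTimes f a b := by
    intro v hv
    have hcl : IsCompact (Icc a b ∩ f ⁻¹' Iic v) :=
      isCompact_Icc.of_isClosed_subset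
        (hf.preimage_isClosed_of_isClosed isClosed_Icc isClosed_Iic) inter_subset_left
    obtain ⟨t, ⟨⟨hta, htb⟩, htv⟩, hleast⟩ := hcl.exists_isLeast ⟨b, ⟨hab, le_rfl⟩, hv.1⟩
    have hlt : ∀ s ∈ Ico a t, v < f s := by
      intro s hs
      by_contra hcon
      exact absurd (hleast ⟨⟨hs.1, hs.2.le.trans htb⟩, not_lt.1 hcon⟩) (not_le.2 hs.2)
    have hat : a < t := by
      refine hta.lt_of_ne ?_
      rintro rfl
      exact absurd hv.2 (not_lt.2 htv)
    refine ⟨t, ⟨⟨hat, htb⟩, fun s hs => lt_of_le_of_lt htv (hlt s hs)⟩, le_antisymm htv ?_⟩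
    obtain ⟨t', ht', h⟩ := intermediate_value_Icc' hta (hf.mono (Icc_subset_Icc le_rfl htb))
      ⟨htv, hv.2.le⟩
    have : t' = t := le_antisymm ht'.2 (hleast ⟨⟨ht'.1, ht'.2.trans htb⟩, h.le⟩)
    rw [← this, h]
  have hL : LipschitzOnWith Λ.toNNReal f (recordTimes f a b) := by
    refine LipschitzOnWith.of_dist_le_mul fun s hs t ht => ?_
    rw [Real.coe_toNNReal _ hΛ, Real.dist_eq, Real.dist_eq]
    rcases le_total s t with hst | hst
    · have h1 := hlip s t hs.1.1.le hst ht.1.2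
      have h2 := hanti ⟨hs.1.1.le, hs.1.2⟩ ⟨ht.1.1.le, ht.1.2⟩ hst
      rw [abs_of_nonneg (by linarith), abs_of_nonpos (by linarith)]; linarith
    · have h1 := hlip t s ht.1.1.le hst hs.1.2
      have h2 := hanti ⟨ht.1.1.le, ht.1.2⟩ ⟨hs.1.1.le, hs.1.2⟩ hst
      rw [abs_of_nonpos (by linarith), abs_of_nonneg (by linarith)]; linarith
  have h1 := hL.hausdorffMeasure_image_le (d := 1) zero_le_one
  rw [hausdorffMeasure_real, ENNReal.rpow_one] at h1
  calc ENNReal.ofReal (f a - f b) = volume (Ico (f b) (f a)) := Real.volume_Ico.symm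
    _ ≤ volume (f '' recordTimes f a b) := measure_mono hsub
    _ ≤ _ := h1

/-- Running infimum over space-time slabs. -/
lemma exists_runningMin {E F : Type*} [TopologicalSpace E] [TopologicalSpace F] {Ω : Set E}
    (hΩ : IsCompact Ω) (hne : Ω.Nonempty) {Φ : F → E → ℝ → ℝ}
    (hΦ : Continuous fun p : F × E × ℝ => Φ p.1 p.2.1 p.2.2) (t0 : ℝ) :
    ∃ m : F → ℝ → ℝ, Continuous (fun p : F × ℝ => m p.1 p.2) ∧
      (∀ y t x s, x ∈ Ω → s ∈ Icc t0 t → m y t ≤ Φ y x s) ∧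
      ∀ y t, t0 ≤ t → ∃ x ∈ Ω, ∃ s ∈ Icc t0 t, m y t = Φ y x s := by
  have hK : IsCompact (Ω ×ˢ Icc (0:ℝ) 1) := hΩ.prod isCompact_Icc
  set g : F × ℝ → E × ℝ → ℝ := fun p q => Φ p.1 q.1 (t0 + q.2 * (p.2 - t0)) with hg
  have hgc : Continuous (Function.uncurry g) := by
    have : Function.uncurry g = (fun p : F × E × ℝ => Φ p.1 p.2.1 p.2.2) ∘
      fun r : (F × ℝ) × (E × ℝ) => (r.1.1, r.2.1, t0 + r.2.2 * (r.1.2 - t0)) := rfl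
    rw [this]
    exact hΦ.comp (by fun_prop)
  have hKne : (Ω ×ˢ Icc (0:ℝ) 1).Nonempty := hne.prod ⟨0, by simp⟩
  have hgp : ∀ p, Continuous (g p) := fun p => hgc.comp (by fun_prop : Continuous fun q => (p, q))
  refine ⟨fun y t => sInf (g (y, t) '' (Ω ×ˢ Icc (0:ℝ) 1)), hK.continuous_sInf hgc, ?_, ?_⟩
  · intro y t x s hx hs
    refine csInf_le (hK.image (hgp _)).bddBelow ?_
    rcases (hs.1.trans hs.2).eq_or_lt with h | h
    · refine ⟨(x, 0), ⟨hx, by simp⟩, ?_⟩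
      have : t0 = s := le_antisymm hs.1 (by rw [h]; exact hs.2)
      simp [hg, this]
    · refine ⟨(x, (s - t0) / (t - t0)), ⟨hx, ?_, ?_⟩, ?_⟩
      · exact div_nonneg (by linarith [hs.1]) (by linarith)
      · rw [div_le_one (by linarith)]; linarith [hs.2]
      · simp only [hg]
        rw [div_mul_cancel₀ _ (by linarith)]; congr 1; ring
  · intro y t ht
    obtain ⟨q, hq, h⟩ := (hK.image (hgp (y, t))).sInf_mem (hKne.image _)
    refine ⟨q.1, hq.1, t0 + q.2 * (t - t0), ⟨?_, ?_⟩, h.symm⟩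
    · nlinarith [hq.2.1]
    · nlinarith [hq.2.2]

/-- Constant in the measure estimate. -/
def densityConst (n : ℕ) (K : ℝ) : ℝ :=
  3 / 4 / (8 ^ n * (2 * K * (2 * K * n + 1)) ^ n * (3 + 16 * K * n))

lemma densityConst_pos {n : ℕ} {K : ℝ} (hK : 1 < K) : 0 < densityConst n K := by
  have : 0 < K := by linarith
  unfold densityConst; positivity

lemma isPsd_zero (n : ℕ) : IsPsd (0 : En n →L[ℝ] En n) := ⟨by simp, by simp⟩

theorem PucciSuper.volume_sublevel_ge {n : ℕ} {K c : ℝ} (hK : 1 < K) (hc : 0 ≤ c)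
    {u : En n → ℝ → ℝ} (hu : Continuous fun p : En n × ℝ => u p.1 p.2) {x0 x1 : En n}
    {t0 t1 ρ s : ℝ} (hρ : 0 < ρ) (ht1 : t1 = t0 + 2 * ρ ^ 2) (hs : 0 < s) (hcs : c * ρ ^ 2 ≤ s)
    (hP : PucciSuper n K c (ball x0 ρ ×ˢ Ioc t0 t1) u)
    (hpos : ∀ x ∈ closedBall x0 ρ, ∀ t ∈ Icc t0 t1, 0 ≤ u x t)
    (hx1 : ‖x1 - x0‖ ≤ ρ / 8) (hu1 : u x1 t1 ≤ s) :
    ENNReal.ofReal (densityConst n K) * volume (ball x0 ρ ×ˢ Ioo t0 t1) ≤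
      volume {p : En n × ℝ | p ∈ ball x0 ρ ×ˢ Ioo t0 t1 ∧ u p.1 p.2 ≤ 3 * s} := by
  have hK0 : 0 < K := by linarith
  set Ω := closedBall x0 ρ with hΩdef
  have hΩ : IsCompact Ω := isCompact_closedBall _ _
  have hne : Ω.Nonempty := ⟨x0, mem_closedBall_self hρ.le⟩
  have ht01 : t0 ≤ t1 := by rw [ht1]; nlinarith
  set L : ℝ := 3 * s / (2 * ρ ^ 2) with hL
  set a : ℝ := 16 * s / ρ ^ 2 with ha
  have hL0 : 0 < L := by positivity
  have ha0 : 0 < a := by positivity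
  have hLρ : L * (2 * ρ ^ 2) = 3 * s := by rw [hL]; field_simp
  have haρ : a * ρ ^ 2 = 16 * s := by rw [ha]; field_simp
  set Λ : ℝ := (3 + 16 * K * n) * s / ρ ^ 2 with hΛ
  have hΛ0 : 0 < Λ := by positivity
  have hΛlt : L + K * n * a + c < Λ := by
    have : Λ = 3 * s / ρ ^ 2 + K * n * a := by rw [hΛ, ha]; field_simp
    have h2 : c ≤ s / ρ ^ 2 := by rw [le_div_iff₀ (by positivity)]; exact hcs
    have h3 : 3 * s / ρ ^ 2 = 2 * L := by rw [hL]; field_simp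
    have h4 : s / ρ ^ 2 = L * (2 / 3) := by rw [hL]; field_simp
    linarith
  set Φ : En n → En n → ℝ → ℝ := fun y x t => u x t + L * (t1 - t) + a / 2 * ‖x - y‖ ^ 2 with hΦ
  have hΦc : Continuous fun p : En n × En n × ℝ => Φ p.1 p.2.1 p.2.2 := by
    have : Continuous fun p : En n × En n × ℝ => u p.2.1 p.2.2 := hu.comp (by fun_prop)
    simp only [hΦ]; fun_prop
  obtain ⟨m, hmc, hmle, hmeq⟩ := exists_runningMin hΩ hne hΦc t0
  obtain ⟨w, hwc', hwle, hweq⟩ := exists_runningMin (E := Unit) (F := En n) (Ω := univ)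
    isCompact_univ univ_nonempty (Φ := fun x _ t => u x t + L * (t1 - t))
    (by
      have : Continuous fun p : En n × Unit × ℝ => u p.1 p.2.2 :=
        hu.comp (continuous_fst.prodMk (continuous_snd.comp continuous_snd))
      fun_prop) t0
  have hinterior : ∀ y ∈ ball x0 (ρ / 8), ∀ x ∈ Ω, ∀ t ∈ Icc t0 t1, Φ y x t < 3 * s →
      x ∈ ball x0 ρ ∧ u x t ≤ 3 * s := by
    intro y hy x hx t ht hlt
    have h1 := hpos x hx t ht
    have h2 : 0 ≤ L * (t1 - t) := mul_nonneg hL0.le (by linarith [ht.2])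
    have h3 : 0 ≤ a / 2 * ‖x - y‖ ^ 2 := by positivity
    simp only [hΦ] at hlt
    refine ⟨?_, by linarith⟩
    by_contra hcon
    rw [mem_ball, not_lt, dist_eq_norm] at hcon
    rw [mem_ball, dist_eq_norm] at hy
    have h4 : 7 / 8 * ρ ≤ ‖x - y‖ := by
      have : ‖x - x0‖ ≤ ‖x - y‖ + ‖y - x0‖ := by
        simpa using norm_add_le (x - y) (y - x0)
      linarith
    have h5 : (7 / 8 * ρ) ^ 2 ≤ ‖x - y‖ ^ 2 := by gcongr
    nlinarith
  set mh : En n → ℝ → ℝ := fun y t => min (m y t) (3 * s) with hmh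
  have hmhc : Continuous fun p : En n × ℝ => mh p.1 p.2 := hmc.min continuous_const
  have hmanti : ∀ y r t, t0 ≤ r → r ≤ t → m y t ≤ m y r := by
    intro y r t h1 h2
    obtain ⟨x, hx, s', hs', h⟩ := hmeq y r h1
    rw [h]; exact hmle y t x s' hx ⟨hs'.1, hs'.2.trans h2⟩
  have hmhanti : ∀ y, AntitoneOn (mh y) (Icc t0 t1) := fun y r hr t _ h =>
    min_le_min_right _ (hmanti y r t hr.1 h)
  have hmh0 : ∀ y, mh y t0 = 3 * s := by
    intro y
    obtain ⟨x, hx, s', hs', h⟩ := hmeq y t0 le_rfl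
    have : s' = t0 := le_antisymm hs'.2 hs'.1
    refine min_eq_right ?_
    rw [h, this]
    have h1 := hpos x hx t0 ⟨le_rfl, ht01⟩
    have h3 : 0 ≤ a / 2 * ‖x - y‖ ^ 2 := by positivity
    simp only [hΦ]
    rw [ht1, add_sub_cancel_left]; linarith
  have hmh1 : ∀ y ∈ ball x0 (ρ / 8), mh y t1 ≤ 3 / 2 * s := by
    intro y hy
    refine (min_le_left _ _).trans ?_
    refine (hmle y t1 x1 t1 ?_ ⟨ht01, le_rfl⟩).trans ?_
    · rw [hΩdef, mem_closedBall, dist_eq_norm]; linarith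
    · rw [mem_ball, dist_eq_norm] at hy
      have : ‖x1 - y‖ ≤ ρ / 4 := by
        have := norm_sub_le (x1 - x0) (y - x0)
        rw [sub_sub_sub_cancel_right] at this; linarith
      have h5 : ‖x1 - y‖ ^ 2 ≤ (ρ / 4) ^ 2 := by gcongr
      simp only [hΦ]
      nlinarith
  have hlip : ∀ y ∈ ball x0 (ρ / 8), ∀ r t, t0 ≤ r → r ≤ t → t ≤ t1 →
      mh y r - mh y t ≤ Λ * (t - r) := by
    intro y hy r t hr hrt ht
    have hnn : 0 ≤ Λ * (t - r) := mul_nonneg hΛ0.le (by linarith)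
    suffices h : mh y r - Λ * (t - r) ≤ m y t by
      have : mh y r - Λ * (t - r) ≤ mh y t := le_min h (by
        have := min_le_right (m y r) (3 * s); simp only [hmh]; linarith)
      linarith
    obtain ⟨x, hx, s', hs', h⟩ := hmeq y t (hr.trans hrt)
    rw [h]
    rcases le_total s' r with hsr | hsr
    · have := hmle y r x s' hx ⟨hs'.1, hsr⟩
      have := min_le_left (m y r) (3 * s)
      simp only [hmh]; linarith
    obtain ⟨⟨xb, sb⟩, ⟨hxb, hsb⟩, hmin⟩ := (hΩ.prod isCompact_Icc).exists_isMinOn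
      ⟨(x, s'), hx, hsr, hs'.2⟩ (f := fun q : En n × ℝ => Φ y q.1 q.2 + Λ * (q.2 - r))
      (by
        have : Continuous fun q : En n × ℝ => Φ y q.1 q.2 :=
          hΦc.comp (continuous_const.prodMk (continuous_fst.prodMk continuous_snd))
        exact (this.add (by fun_prop)).continuousOn)
    simp only at hxb hsb
    have hmin' : ∀ x ∈ Ω, ∀ s ∈ Icc r t, Φ y xb sb + Λ * (sb - r) ≤ Φ y x s + Λ * (s - r) :=
      fun x hx s hs => hmin (show (x, s) ∈ Ω ×ˢ Icc r t from ⟨hx, hs⟩)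
    have hxs := hmin' x hx s' ⟨hsr, hs'.2⟩
    have hst : Λ * (s' - r) ≤ Λ * (t - r) := by gcongr; exact hs'.2
    suffices hsuff : mh y r ≤ Φ y xb sb + Λ * (sb - r) by linarith
    by_contra! hcon
    have hsb0 : 0 ≤ Λ * (sb - r) := mul_nonneg hΛ0.le (by linarith [hsb.1])
    have hlt : Φ y xb sb < 3 * s := by
      have := min_le_right (m y r) (3 * s)
      simp only [hmh] at hcon; linarith
    have hrb : r < sb := by
      refine hsb.1.lt_of_ne ?_
      rintro rfl
      have h1 := hmle y r xb r hxb ⟨hr, le_rfl⟩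
      have := min_le_left (m y r) (3 * s)
      simp only [hmh] at hcon; linarith
    have hball := (hinterior y hy xb hxb sb ⟨hr.trans hsb.1, hsb.2.trans ht⟩ hlt).1
    have hnb : ∀ᶠ q in 𝓝 (xb, sb), q.1 ∈ ball x0 ρ ∧ r < q.2 :=
      ((continuous_fst.tendsto (xb, sb)).eventually (isOpen_ball.mem_nhds hball)).and
        ((continuous_snd.tendsto (xb, sb)).eventually (lt_mem_nhds hrb))
    have key := hP.jet (x₀ := xb) (t₀ := sb) (b := L - Λ) (p := -(a • (xb - y))) (P := 0)
      (θ := a) (hnb.mono fun q hq hq2 => ⟨hq.1, hr.trans_lt hq.2, hq2.trans (hsb.2.trans ht)⟩)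
      (isPsd_zero n) ha0.le (hnb.mono fun q hq hq2 => by
        have h1 := hmin' q.1 (ball_subset_closedBall hq.1) q.2 ⟨hq.2.le, hq2.trans hsb.2⟩
        simp only [hΦ] at h1
        have h2 : q.1 - y = (xb - y) + (q.1 - xb) := by abel
        rw [h2, norm_add_sq_real] at h1
        simp only [_root_.zero_apply, inner_zero_left, mul_zero, add_zero, inner_neg_left,
          inner_smul_left, RCLike.conj_to_real]
        linarith)
    simp [coordTrace] at key
    linarith
  set Θ : ℝ := 2 * K * (2 * K * n + 1) with hΘ
  have hΘ0 : 0 < Θ := by positivity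
  set E : Set (En n × ℝ) := {q | q.1 ∈ ball x0 (ρ / 8) ∧ q.2 ∈ recordTimes (mh q.1) t0 t1} with hE
  set S : Set (En n × ℝ) := {q | (q.1 ∈ Ω ∧ q.2 ∈ Icc t0 t1) ∧ u q.1 q.2 ≤ 3 * s} with hS
  have hScl : IsClosed S := by
    refine ((isClosed_closedBall.preimage continuous_fst).inter
      (isClosed_Icc.preimage continuous_snd)).inter (isClosed_le hu continuous_const)
  have hEm : MeasurableSet E := by
    have : E = (ball x0 (ρ / 8) ×ˢ Ioc t0 t1) ∩ ⋂ k : ℕ,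
        {q | mh q.1 q.2 < mh q.1 (max t0 (q.2 - 1 / (k + 1)))} := by
      ext ⟨y, t⟩
      simp only [hE, recordTimes, mem_ofPred_eq, mem_inter_iff, mem_prod, mem_iInter]
      constructor
      · rintro ⟨h1, h2, h3⟩
        refine ⟨⟨h1, h2⟩, fun k => h3 _ ⟨le_max_left _ _, max_lt h2.1 ?_⟩⟩
        have : (0:ℝ) < 1 / (k + 1) := by positivity
        linarith
      · rintro ⟨⟨h1, h2⟩, h3⟩
        refine ⟨h1, h2, fun r hr => ?_⟩
        obtain ⟨k, hk⟩ := exists_nat_one_div_lt (sub_pos.2 hr.2)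
        refine (h3 k).trans_le (hmhanti y ⟨hr.1, hr.2.le.trans h2.2⟩ ⟨le_max_left _ _, ?_⟩ ?_)
        · refine max_le ht01 ?_
          have : (0:ℝ) < 1 / (k + 1) := by positivity
          linarith [h2.2]
        · exact le_max_of_le_right (by linarith)
    rw [this]
    refine (measurableSet_ball.prod measurableSet_Ioc).inter (MeasurableSet.iInter fun k => ?_)
    refine (isOpen_lt hmhc ?_).measurableSet
    exact hmhc.comp (by fun_prop : Continuous fun q : En n × ℝ =>
      (q.1, max t0 (q.2 - 1 / ((k:ℝ) + 1))))
  have hslice : ∀ t, volume ((fun y => (y, t)) ⁻¹' E) ≤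
      ENNReal.ofReal (Θ ^ n) * volume ((fun y => (y, t)) ⁻¹' S) := by
    intro t
    have hmeas : MeasurableSet ((fun y => (y, t)) ⁻¹' E) := measurable_prodMk_right hEm
    rw [hmeas.measure_eq_iSup_isCompact]
    refine iSup₂_le fun V hVE => iSup_le fun hV => ?_
    rcases V.eq_empty_or_nonempty with rfl | ⟨y₀, hy₀⟩
    · simp
    have ht : t ∈ Ioc t0 t1 := (hVE hy₀).2.1
    have hSt : IsCompact ((fun y => (y, t)) ⁻¹' S) :=
      hΩ.of_isClosed_subset (hScl.preimage (by fun_prop)) fun x hx => hx.1.1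
    have hwc : ContinuousOn (fun x => w x t) Ω :=
      (hwc'.comp (by fun_prop : Continuous fun x : En n => (x, t))).continuousOn
    have hct : ∀ z y, y ∈ V → IsContact Ω (fun x => w x t) a z y →
        w z t = u z t + L * (t1 - t) ∧ Φ y z t < 3 * s := by
      intro z y hy hz
      obtain ⟨-, -, s', hs', h1⟩ := hweq z t ht.1.le
      obtain ⟨x, hx, s'', hs'', h2⟩ := hmeq y t ht.1.le
      have h3 := hwle x t () s'' (mem_univ _) hs''
      have h4 := hz.2 x hx
      have h5 := hmle y t z s' hz.1 hs'
      have hrec := (hVE hy).2.2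
      have hmlt : m y t < 3 * s := by
        have h6 := (hrec t0 ⟨le_rfl, ht.1⟩).trans_le (min_le_right _ _)
        simp only [hmh, min_lt_iff, lt_irrefl, or_false] at h6
        exact h6
      simp only [hΦ] at h2 h5
      rcases hs'.2.eq_or_lt with h6 | h6
      · rw [h6] at h1 h5
        exact ⟨h1, by simp only [hΦ]; linarith⟩
      · have h7 := hmle y s' z s' hz.1 ⟨hs'.1, le_rfl⟩
        simp only [hΦ] at h7
        have h8 : m y s' ≤ m y t := by linarith
        exact absurd (hrec s' ⟨hs'.1, h6⟩) (not_lt.2 (min_le_min_right _ h8))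
    have hin : ∀ z y, y ∈ V → IsContact Ω (fun x => w x t) a z y →
        z ∈ ball x0 ρ ∧ u z t ≤ 3 * s := fun z y hy hz =>
      hinterior y (hVE hy).1 z hz.1 t ⟨ht.1.le, ht.2⟩ (hct z y hy hz).2
    have key := volume_le_of_contact hK hΩ hne hV hSt hwc (c := L + c) ha0
      (fun z y hy hz => ⟨⟨hz.1, ht.1.le, ht.2⟩, (hin z y hy hz).2⟩)
      (fun z y hy hz => mem_of_superset (isOpen_ball.mem_nhds (hin z y hy hz).1)
        ball_subset_closedBall)
      (fun z y hy hz P θ hPs hθ hev => by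
        have hzb := (hin z y hy hz).1
        have hnb : ∀ᶠ q in 𝓝 (z, t), q.1 ∈ ball x0 ρ ∧ t0 < q.2 :=
          ((continuous_fst.tendsto (z, t)).eventually (isOpen_ball.mem_nhds hzb)).and
            ((continuous_snd.tendsto (z, t)).eventually (lt_mem_nhds ht.1))
        have htend : Tendsto (fun q : En n × ℝ => q.1 - z) (𝓝 (z, t)) (𝓝 0) := by
          have : Tendsto (fun q : En n × ℝ => q.1 - z) (𝓝 (z, t)) (𝓝 (z - z)) :=
            (continuous_fst.sub continuous_const).tendsto (z, t)
          simpa using this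
        have := hP.jet (x₀ := z) (t₀ := t) (b := L) (p := a • (y - z)) (P := P) (θ := θ)
          (hnb.mono fun q hq hq2 => ⟨hq.1, hq.2, hq2.trans ht.2⟩) hPs hθ
          ((hnb.and (htend.eventually hev)).mono fun q hq hq2 => by
            obtain ⟨⟨h1, h2⟩, h3⟩ := hq
            have h4 := hwle q.1 t () q.2 (mem_univ _) ⟨h2.le, hq2⟩
            rw [add_sub_cancel, (hct z y hy hz).1] at h3
            linarith)
        linarith)
    refine key.trans ?_
    gcongr
    rw [hΘ]
    have h2 : (L + c) / a ≤ 1 := by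
      rw [div_le_one ha0]
      have h2 : c ≤ s / ρ ^ 2 := by rw [le_div_iff₀ (by positivity)]; exact hcs
      have h3 : s / ρ ^ 2 = a / 16 := by rw [ha]; field_simp
      have h4 : L = a * (3 / 32) := by rw [hL, ha]; field_simp; norm_num
      linarith
    gcongr
  have hEy : ∀ y ∈ ball x0 (ρ / 8), ENNReal.ofReal (3 / 2 * s) ≤
      ENNReal.ofReal Λ * volume (Prod.mk y ⁻¹' E) := by
    intro y hy
    have h1 := volume_recordTimes_ge (f := mh y) ht01 hΛ0.le
      (hmhc.comp (by fun_prop : Continuous fun t : ℝ => (y, t))).continuousOn (hmhanti y)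
      (hlip y hy)
    have h2 : Prod.mk y ⁻¹' E = recordTimes (mh y) t0 t1 := by
      ext t; exact ⟨fun h => h.2, fun h => ⟨hy, h⟩⟩
    rw [h2]
    refine le_trans (ENNReal.ofReal_le_ofReal ?_) h1
    have := hmh1 y hy
    rw [hmh0]; linarith
  have hEvol : ENNReal.ofReal (3 / 2 * s) * volume (ball x0 (ρ / 8)) ≤
      ENNReal.ofReal Λ * volume E := by
    rw [Measure.volume_eq_prod, Measure.prod_apply hEm,
      ← lintegral_const_mul _ (measurable_measure_prodMk_left hEm), ← setLIntegral_const]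
    exact (setLIntegral_mono_ae (by
      exact ((measurable_measure_prodMk_left hEm).const_mul _).aemeasurable)
      (Eventually.of_forall fun y hy => hEy y hy)).trans (setLIntegral_le_lintegral _ _)
  have hES : volume E ≤ ENNReal.ofReal (Θ ^ n) * volume S := by
    rw [Measure.volume_eq_prod, Measure.prod_apply_symm hEm,
      Measure.prod_apply_symm hScl.measurableSet,
      ← lintegral_const_mul _ (measurable_measure_prodMk_right hScl.measurableSet)]
    exact lintegral_mono hslice
  have hSae : volume S ≤
      volume {p : En n × ℝ | p ∈ ball x0 ρ ×ˢ Ioo t0 t1 ∧ u p.1 p.2 ≤ 3 * s} := by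
    have hnull : volume ((Ω ×ˢ Icc t0 t1) \ (ball x0 ρ ×ˢ Ioo t0 t1)) = 0 := by
      have : (ball x0 ρ ×ˢ Ioo t0 t1 : Set (En n × ℝ)) =ᵐ[volume] (Ω ×ˢ Icc t0 t1 : Set _) := by
        rw [Measure.volume_eq_prod]
        refine Measure.set_prod_ae_eq ?_ Ioo_ae_eq_Icc
        rw [← measure_symmDiff_eq_zero_iff, symmDiff_of_le ball_subset_closedBall]
        change volume (closedBall x0 ρ \ ball x0 ρ) = 0
        rw [closedBall_sdiff_ball]
        exact Measure.addHaar_sphere_of_ne_zero _ _ hρ.ne'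
      exact ae_le_set.1 this.symm.le
    refine (measure_mono (t := {p : En n × ℝ | p ∈ ball x0 ρ ×ˢ Ioo t0 t1 ∧ u p.1 p.2 ≤ 3 * s} ∪
      ((Ω ×ˢ Icc t0 t1) \ (ball x0 ρ ×ˢ Ioo t0 t1))) ?_).trans ((measure_union_le _ _).trans ?_)
    · intro q hq
      by_cases h : q ∈ ball x0 ρ ×ˢ Ioo t0 t1
      · exact Or.inl ⟨h, hq.2⟩
      · exact Or.inr ⟨hq.1, h⟩
    · rw [hnull, add_zero]
  have hfin : ENNReal.ofReal (Λ * Θ ^ n) * (ENNReal.ofReal (densityConst n K) *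
      volume (ball x0 ρ ×ˢ Ioo t0 t1)) = ENNReal.ofReal (3 / 2 * s) * volume (ball x0 (ρ / 8)) := by
    rw [Measure.volume_eq_prod, Measure.prod_prod, Real.volume_Ioo,
      Measure.addHaar_ball_of_pos _ _ hρ,
      Measure.addHaar_ball_of_pos _ _ (by positivity : 0 < ρ / 8)]
    have h1 := densityConst_pos (n := n) hK
    have e : ∀ A B C D E' F : ℝ, 0 ≤ A → 0 ≤ B → 0 ≤ C → 0 ≤ D → 0 ≤ E' → ∀ V,
        A * B * C * D = E' * F → ENNReal.ofReal A * (ENNReal.ofReal B *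
        (ENNReal.ofReal C * V * ENNReal.ofReal D)) =
        ENNReal.ofReal E' * (ENNReal.ofReal F * V) := by
      intro A B C D E' F hA hB hC hD hE V h
      rw [← mul_assoc (ENNReal.ofReal E'), ← ENNReal.ofReal_mul hE, ← h,
        ENNReal.ofReal_mul (by positivity), ENNReal.ofReal_mul (by positivity),
        ENNReal.ofReal_mul hA]
      ring
    refine e _ _ _ _ _ _ (by positivity) h1.le (by positivity) (by rw [ht1]; nlinarith)
      (by positivity) _ ?_
    rw [ht1, add_sub_cancel_left, densityConst, ← hΘ, hΛ, finrank_euclideanSpace_fin, div_pow]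
    field_simp
    ring
  have hpos' : ENNReal.ofReal (Λ * Θ ^ n) ≠ 0 := by
    rw [ne_eq, ENNReal.ofReal_eq_zero, not_le]; positivity
  refine (ENNReal.mul_le_mul_iff_right hpos' ENNReal.ofReal_ne_top).1 ?_
  rw [hfin]
  refine hEvol.trans ?_
  rw [ENNReal.ofReal_mul hΛ0.le, mul_assoc]
  gcongr
  exact hES.trans (by gcongr)

/-- The rank one endomorphism `ζ ↦ k ⟪y, ζ⟫ y`. -/
def rankOne {n : ℕ} (k : ℝ) (y : En n) : En n →L[ℝ] En n :=
  k • (innerSL ℝ y).smulRight y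

lemma inner_rankOne {n : ℕ} (k : ℝ) (y v w : En n) :
    inner ℝ (rankOne k y v) w = k * (inner ℝ y v * inner ℝ y w) := by
  simp [rankOne, inner_smul_left]

lemma isPsd_rankOne {n : ℕ} {k : ℝ} (hk : 0 ≤ k) (y : En n) : IsPsd (rankOne k y) := by
  refine ⟨fun v w => ?_, fun v => ?_⟩
  · rw [inner_rankOne, inner_rankOne]; ring
  · rw [inner_rankOne]
    exact mul_nonneg hk (mul_self_nonneg _)

lemma coordTrace_rankOne {n : ℕ} (k : ℝ) (y : En n) : coordTrace (rankOne k y) = k * ‖y‖ ^ 2 := by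
  rw [EuclideanSpace.norm_sq_eq, Finset.mul_sum, coordTrace]
  refine Finset.sum_congr rfl fun i _ => ?_
  simp only [rankOne, _root_.smul_apply, ContinuousLinearMap.smulRight_apply, innerSL_apply_apply,
    EuclideanSpace.inner_single_right, PiLp.smul_apply, smul_eq_mul, Real.norm_eq_abs, sq_abs]
  simp only [conj_trivial, one_mul]
  ring

lemma le_add_of_sq_le_four_mul {a b m : ℝ} (ha : 0 ≤ a) (hb : 0 ≤ b) (h : m ^ 2 ≤ 4 * a * b) :
    m ≤ a + b :=
  (abs_le_of_sq_le_sq' (by nlinarith [sq_nonneg (a - b)]) (by positivity)).2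

lemma inv_pow_ge_tangent {g κ τ : ℝ} (q : ℕ) (hg : 0 < g) (hκ : 0 ≤ κ) (hτ : 0 ≤ τ)
    (h : κ * τ < g) : (g ^ q)⁻¹ * (1 + q * κ / g * τ) ≤ ((g - κ * τ) ^ q)⁻¹ := by
  have h1 : 1 + κ * τ / g ≤ g / (g - κ * τ) := by
    rw [le_div_iff₀ (by linarith)]
    have : (1 + κ * τ / g) * (g - κ * τ) = g - (κ * τ) ^ 2 / g := by field_simp; ring
    rw [this]
    have : 0 ≤ (κ * τ) ^ 2 / g := by positivity
    linarith
  have h0 : 0 ≤ κ * τ / g := by positivity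
  have h2 : 1 + q * (κ * τ / g) ≤ (g / (g - κ * τ)) ^ q :=
    (one_add_mul_le_pow (by linarith) q).trans (by gcongr)
  have h3 : ((g - κ * τ) ^ q)⁻¹ = (g ^ q)⁻¹ * (g / (g - κ * τ)) ^ q := by
    rw [div_pow]; field_simp
  rw [h3]
  gcongr
  calc 1 + q * κ / g * τ = 1 + q * (κ * τ / g) := by ring
    _ ≤ _ := h2

/-- Second order expansion from below, backwards in time, of
`(g - κ τ)⁻q (g - κ τ - |y + ζ|²)²`. -/
lemma barrier_expansion {n : ℕ} {g κ : ℝ} (q : ℕ) (hg : 0 < g) (hκ : 0 ≤ κ) {y : En n}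
    (hy : ‖y‖ ^ 2 < g) {ε : ℝ} (hε : 0 < ε) :
    ∀ᶠ r in 𝓝 ((0 : En n), (0 : ℝ)), 0 ≤ r.2 →
      (g ^ q)⁻¹ * ((g - ‖y‖ ^ 2) ^ 2 + (q * κ / g * (g - ‖y‖ ^ 2) ^ 2 - 2 * (g - ‖y‖ ^ 2) * κ) * r.2
        - 4 * (g - ‖y‖ ^ 2) * inner ℝ y r.1 + 4 * inner ℝ y r.1 ^ 2
        - 2 * (g - ‖y‖ ^ 2) * ‖r.1‖ ^ 2 - ε * (r.2 + ‖r.1‖ ^ 2)) ≤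
      ((g - κ * r.2) ^ q)⁻¹ * (g - κ * r.2 - ‖y + r.1‖ ^ 2) ^ 2 := by
  set X := g - ‖y‖ ^ 2 with hX
  have hX0 : 0 < X := by linarith
  have c1 : ∀ᶠ r in 𝓝 ((0 : En n), (0 : ℝ)), κ * r.2 < g := by
    have : Tendsto (fun r : En n × ℝ => κ * r.2) (𝓝 (0, 0)) (𝓝 (κ * 0)) :=
      (continuous_const.mul continuous_snd).tendsto (0, 0)
    rw [mul_zero] at this
    exact this.eventually_lt_const hg
  have c2 : ∀ᶠ r in 𝓝 ((0 : En n), (0 : ℝ)), 4 * ‖y‖ * ‖r.1‖ < ε := by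
    have : Tendsto (fun r : En n × ℝ => 4 * ‖y‖ * ‖r.1‖) (𝓝 (0, 0)) (𝓝 (4 * ‖y‖ * ‖(0 : En n)‖)) :=
      (continuous_const.mul continuous_fst.norm).tendsto (0, 0)
    rw [norm_zero, mul_zero] at this
    exact this.eventually_lt_const hε
  have c3 : ∀ᶠ r in 𝓝 ((0 : En n), (0 : ℝ)), 4 * ‖y‖ * ‖r.1‖ * κ
      + 2 * (q * κ / g) * X * (κ * r.2 + 2 * ‖y‖ * ‖r.1‖ + ‖r.1‖ ^ 2) < ε := by
    have : Tendsto (fun r : En n × ℝ => 4 * ‖y‖ * ‖r.1‖ * κ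
      + 2 * (q * κ / g) * X * (κ * r.2 + 2 * ‖y‖ * ‖r.1‖ + ‖r.1‖ ^ 2)) (𝓝 (0, 0))
      (𝓝 (4 * ‖y‖ * ‖(0 : En n)‖ * κ + 2 * (q * κ / g) * X *
        (κ * 0 + 2 * ‖y‖ * ‖(0 : En n)‖ + ‖(0 : En n)‖ ^ 2))) :=
      (by fun_prop : Continuous fun r : En n × ℝ => 4 * ‖y‖ * ‖r.1‖ * κ
      + 2 * (q * κ / g) * X * (κ * r.2 + 2 * ‖y‖ * ‖r.1‖ + ‖r.1‖ ^ 2)).tendsto (0, 0)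
    norm_num at this
    exact this.eventually_lt_const hε
  filter_upwards [c1, c2, c3] with ⟨ζ, τ⟩ h1 h2 h3 hτ
  simp only at h1 h2 h3 hτ ⊢
  have hT := inv_pow_ge_tangent q hg hκ hτ h1
  set e := q * κ / g with he
  have he0 : 0 ≤ e := by positivity
  have hT1 : 0 < (g ^ q)⁻¹ := by positivity
  set i := inner ℝ y ζ with hi
  have hi' : |i| ≤ ‖y‖ * ‖ζ‖ := abs_real_inner_le_norm y ζ
  set D := -κ * τ - 2 * i - ‖ζ‖ ^ 2 with hD
  have hXD : g - κ * τ - ‖y + ζ‖ ^ 2 = X + D := by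
    rw [norm_add_sq_real, hX, hD]; ring
  rw [hXD]
  refine le_trans ?_ (mul_le_mul_of_nonneg_right hT (sq_nonneg _))
  rw [mul_assoc ((g ^ q)⁻¹)]
  refine mul_le_mul_of_nonneg_left ?_ hT1.le
  have hi1 := (abs_le.1 hi').1
  have hi2 := (abs_le.1 hi').2
  have hy0 := norm_nonneg y
  have hζ0 := norm_nonneg ζ
  have a1 : -(4 * (‖y‖ * ‖ζ‖) * (κ * τ + ‖ζ‖ ^ 2)) ≤ 4 * i * (κ * τ + ‖ζ‖ ^ 2) := by
    have : 0 ≤ κ * τ + ‖ζ‖ ^ 2 := by positivity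
    nlinarith
  have a2 : 4 * i ^ 2 - 4 * (‖y‖ * ‖ζ‖) * (κ * τ + ‖ζ‖ ^ 2) ≤ D ^ 2 := by
    rw [hD]
    nlinarith [sq_nonneg (κ * τ + ‖ζ‖ ^ 2)]
  have a3 : -(κ * τ + 2 * (‖y‖ * ‖ζ‖) + ‖ζ‖ ^ 2) ≤ D := by rw [hD]; linarith
  have a4 : 0 ≤ e * τ * X := by positivity
  have a5 := mul_le_mul_of_nonneg_left a3 a4
  have a6 := mul_le_mul_of_nonneg_right h3.le hτ
  have a7 := mul_le_mul_of_nonneg_right h2.le (sq_nonneg ‖ζ‖)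
  have a8 : 0 ≤ e * τ * D ^ 2 := by positivity
  have a9 : (1 + e * τ) * (X + D) ^ 2 =
    X ^ 2 + 2 * X * D + D ^ 2 + e * τ * X ^ 2 + 2 * (e * τ * X * D) + e * τ * D ^ 2 := by ring
  rw [a9]
  have a10 : 2 * X * D = -2 * X * κ * τ - 4 * X * i - 2 * X * ‖ζ‖ ^ 2 := by rw [hD]; ring
  rw [a10]
  nlinarith

set_option maxHeartbeats 400000 in
theorem PucciSuper.barrier_le {n : ℕ} {K c : ℝ} (hK : 1 < K)
    {u : En n → ℝ → ℝ} (hu : Continuous fun p : En n × ℝ => u p.1 p.2) {x0 : En n}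
    {t0 t1 ρ s κ : ℝ} {q : ℕ} (hc : 0 ≤ c) (hρ : 0 < ρ) (hs : 0 ≤ s) (hκ : 0 < κ)
    (hq : (2 * κ + 4 * n * K + 8 / K) ^ 2 ≤ 32 * q * κ / K)
    (hP : PucciSuper n K c {p | p.2 ∈ Ioc t0 t1 ∧ ‖p.1 - x0‖ ^ 2 < ρ ^ 2 + κ * (p.2 - t0)} u)
    (hpos : ∀ x t, t ∈ Icc t0 t1 → ‖x - x0‖ ^ 2 ≤ ρ ^ 2 + κ * (t - t0) → 0 ≤ u x t)
    (hinit : ∀ x, ‖x - x0‖ ≤ ρ → s ≤ u x t0) {x : En n} {t : ℝ} (ht : t ∈ Icc t0 t1)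
    (hx : ‖x - x0‖ ^ 2 ≤ ρ ^ 2 + κ * (t - t0)) :
    s * (ρ ^ (2 * q) / ρ ^ 4) * (((ρ ^ 2 + κ * (t - t0)) ^ q)⁻¹ *
      (ρ ^ 2 + κ * (t - t0) - ‖x - x0‖ ^ 2) ^ 2) - c * (t - t0) ≤ u x t := by
  have hK0 : 0 < K := by linarith
  set A := s * (ρ ^ (2 * q) / ρ ^ 4) with hA
  have hA0 : 0 ≤ A := by positivity
  set g : ℝ → ℝ := fun t => ρ ^ 2 + κ * (t - t0) with hg
  have hgpos : ∀ t, t0 ≤ t → 0 < g t := fun t ht => by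
    have : 0 ≤ κ * (t - t0) := mul_nonneg hκ.le (by linarith)
    simp only [hg]; positivity
  set v : En n → ℝ → ℝ := fun x t => A * (((g t) ^ q)⁻¹ * (g t - ‖x - x0‖ ^ 2) ^ 2) with hv
  set Q : Set (En n × ℝ) := {p | p.2 ∈ Icc t0 t1 ∧ ‖p.1 - x0‖ ^ 2 ≤ g p.2} with hQ
  have hQc : IsCompact Q := by
    refine ((isCompact_closedBall x0 (g t1 + 1)).prod
      (isCompact_Icc (a := t0) (b := t1))).of_isClosed_subset ?_ ?_
    · exact (isClosed_Icc.preimage continuous_snd).inter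
        (isClosed_le (((continuous_fst.sub continuous_const).norm).pow 2)
          (by simp only [hg]; fun_prop))
    · rintro ⟨x, t⟩ ⟨h1, h2⟩
      refine ⟨?_, h1⟩
      rw [mem_closedBall, dist_eq_norm]
      have : g t ≤ g t1 := by simp only [hg]; gcongr; exact h1.2
      simp only at h2 ⊢
      nlinarith [norm_nonneg (x - x0)]
  suffices h : ∀ δ > 0, v x t - (c + δ) * (t - t0) ≤ u x t by
    have hlim : Tendsto (fun δ : ℝ => v x t - (c + δ) * (t - t0)) (𝓝[>] 0)
        (𝓝 (v x t - (c + 0) * (t - t0))) :=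
      ((by fun_prop : Continuous fun δ : ℝ => v x t - (c + δ) * (t - t0)).tendsto 0).mono_left
        nhdsWithin_le_nhds
    rw [add_zero] at hlim
    exact le_of_tendsto hlim (eventually_mem_nhdsWithin.mono fun δ hδ => h δ hδ)
  intro δ hδ
  have hvc : ContinuousOn (fun p : En n × ℝ => v p.1 p.2) Q := by
    simp only [hv]
    refine continuousOn_const.mul (ContinuousOn.mul (ContinuousOn.inv₀ (by fun_prop) ?_)
      (by fun_prop))
    intro p hp
    exact (pow_pos (hgpos _ hp.1.1) q).ne'
  obtain ⟨⟨x1, t1'⟩, h1Q, hmin⟩ := hQc.exists_isMinOn ⟨(x, t), ht, hx⟩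
    (f := fun p : En n × ℝ => u p.1 p.2 - v p.1 p.2 + (c + δ) * (p.2 - t0))
    ((hu.continuousOn.sub hvc).add (by fun_prop))
  have hmin' : ∀ x t, (x, t) ∈ Q → u x1 t1' - v x1 t1' + (c + δ) * (t1' - t0) ≤
      u x t - v x t + (c + δ) * (t - t0) := fun x t hxt => hmin hxt
  suffices hsuff : 0 ≤ u x1 t1' - v x1 t1' + (c + δ) * (t1' - t0) by
    linarith [hmin' x t ⟨ht, hx⟩]
  by_contra! hneg
  obtain ⟨⟨ha, hb⟩, hx1⟩ := h1Q
  simp only at ha hb hx1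
  have ht1 : t0 < t1' := by
    refine ha.lt_of_ne ?_
    rintro rfl
    have hg0 : g t0 = ρ ^ 2 := by simp [hg]
    rw [hg0] at hx1
    have h1 := hinit x1 (by nlinarith [norm_nonneg (x1 - x0)])
    have h2 : v x1 t0 ≤ s := by
      have : (ρ ^ 2 - ‖x1 - x0‖ ^ 2) ^ 2 ≤ ρ ^ 4 := by
        nlinarith [sq_nonneg ‖x1 - x0‖]
      calc v x1 t0 ≤ A * ((g t0 ^ q)⁻¹ * ρ ^ 4) := by
            simp only [hv]; rw [hg0]; gcongr
        _ = s := by rw [hg0, hA, pow_mul]; field_simp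
    rw [sub_self, mul_zero] at hneg
    linarith
  have hx1lt : ‖x1 - x0‖ ^ 2 < g t1' := by
    refine hx1.lt_of_ne fun h => ?_
    have h1 := hpos x1 t1' ⟨ha, hb⟩ hx1
    have h2 : v x1 t1' = 0 := by simp [hv, h]
    rw [h2] at hneg
    have h3 : 0 ≤ (c + δ) * (t1' - t0) := mul_nonneg (by linarith) (by linarith)
    linarith
  set y := x1 - x0 with hy
  set G := g t1' with hG
  have hG0 : 0 < G := hgpos _ ha
  set X := G - ‖y‖ ^ 2 with hX
  have hX0 : 0 < X := by linarith
  set T := A * (G ^ q)⁻¹ with hT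
  have hT0 : 0 ≤ T := by positivity
  set e := q * κ / G with he
  set ε := δ / (2 * (T * (1 + 2 * K * n) + 1)) with hε
  have hε0 : 0 < ε := by positivity
  have hεδ : T * ε * (1 + 2 * K * n) < δ := by
    have h1 : 0 ≤ T * (1 + 2 * K * n) := by positivity
    have h2 : ε * (2 * (T * (1 + 2 * K * n) + 1)) = δ := by rw [hε]; field_simp
    nlinarith
  have htend : Tendsto (fun q : En n × ℝ => (q.1 - x1, t1' - q.2)) (𝓝 (x1, t1')) (𝓝 (0, 0)) := by
    have : Tendsto (fun q : En n × ℝ => (q.1 - x1, t1' - q.2)) (𝓝 (x1, t1'))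
        (𝓝 (x1 - x1, t1' - t1')) := by
      exact (by fun_prop : Continuous fun q : En n × ℝ => (q.1 - x1, t1' - q.2)).tendsto (x1, t1')
    simpa using this
  have hnb : ∀ᶠ p in 𝓝 (x1, t1'), t0 < p.2 ∧ ‖p.1 - x0‖ ^ 2 < g p.2 :=
    ((continuous_snd.tendsto (x1, t1')).eventually (lt_mem_nhds ht1)).and
      ((isOpen_lt (((continuous_fst.sub continuous_const).norm).pow 2)
        (by simp only [hg]; fun_prop)).mem_nhds hx1lt)
  have key := hP.jet (x₀ := x1) (t₀ := t1') (b := T * (2 * X * κ - e * X ^ 2 + ε) - (c + δ))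
    (p := (-(4 * T * X)) • y) (P := rankOne (8 * T) y) (θ := T * (4 * X + 2 * ε))
    (hnb.mono fun p hp hp2 => ⟨⟨hp.1, hp2.trans hb⟩, hp.2⟩)
    (isPsd_rankOne (by positivity) y) (by positivity)
    ((hnb.and (htend.eventually (barrier_expansion q hG0 hκ.le hx1lt hε0))).mono
      fun p hp hp2 => by
        obtain ⟨⟨h1, h2⟩, h3⟩ := hp
        have h4 := hmin' p.1 p.2 ⟨⟨h1.le, hp2.trans hb⟩, h2.le⟩
        have h5 := mul_le_mul_of_nonneg_left (h3 (by simp only; linarith)) hA0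
        simp only at h5
        have h6 : G - κ * (t1' - p.2) = g p.2 := by simp only [hG, hg]; ring
        have h7 : y + (p.1 - x1) = p.1 - x0 := by rw [hy]; abel
        rw [h6, h7, ← hX, ← he, ← mul_assoc, ← hT] at h5
        have h8 : v x1 t1' = T * X ^ 2 := by simp only [hv, hT, hX, hy, hG]; ring
        rw [h8] at h4
        simp only [hv] at h4
        rw [inner_rankOne, inner_smul_left]
        simp only [RCLike.conj_to_real]
        linarith)
  rw [coordTrace_rankOne] at key
  set B := 2 * κ + 4 * n * K + 8 / K with hB
  have hyX : ‖y‖ ^ 2 = G - X := by rw [hX]; ring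
  have hamgm : B * X ≤ 8 * G / K + e * X ^ 2 := by
    have h1 : e * G = q * κ := by rw [he]; field_simp
    have h2 : (B * X) ^ 2 ≤ 4 * (8 * G / K) * (e * X ^ 2) := by
      calc (B * X) ^ 2 = B ^ 2 * X ^ 2 := by ring
        _ ≤ 32 * q * κ / K * X ^ 2 := by gcongr
        _ = 4 * (8 / K) * (q * κ) * X ^ 2 := by ring
        _ = _ := by rw [← h1]; ring
    exact le_add_of_sq_le_four_mul (by positivity) (by positivity) h2
  have hfinal : 0 ≤ T * (8 * G / K + e * X ^ 2 - B * X) := mul_nonneg hT0 (by linarith)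
  have hk : K⁻¹ * (8 * T * ‖y‖ ^ 2) = T * (8 * G / K) - T * (8 / K) * X := by
    rw [hyX]; field_simp
  rw [hk] at key
  rw [hB] at hfinal
  linarith

/-- Enlarging finitely many intervals to the left by the factor `1 + l` enlarges the measure of
their union at most by the same factor. -/
lemma volume_biUnion_Ioo_extend_le {l : ℝ} (hl : 0 ≤ l) (s : Finset (ℝ × ℝ))
    (hs : ∀ p ∈ s, p.1 < p.2) :
    volume (⋃ p ∈ s, Ioo (p.1 - l * (p.2 - p.1)) p.2) ≤
      ENNReal.ofReal (1 + l) * volume (⋃ p ∈ s, Ioo p.1 p.2) := by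
  induction h : s.card using Nat.strong_induction_on generalizing s with
  | _ k ih =>
  subst h
  by_cases hd : (s : Set (ℝ × ℝ)).PairwiseDisjoint fun p => Ioo p.1 p.2
  · rw [measure_biUnion_finset hd fun _ _ => measurableSet_Ioo, Finset.mul_sum]
    refine (measure_biUnion_finset_le _ _).trans (Finset.sum_le_sum fun p hp => ?_)
    rw [Real.volume_Ioo, Real.volume_Ioo, ← ENNReal.ofReal_mul (by positivity)]
    refine ENNReal.ofReal_le_ofReal (by linarith)
  · simp only [Set.PairwiseDisjoint, Set.Pairwise, not_forall] at hd
    obtain ⟨p, hp, q, hq, hpq, hd⟩ := hd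
    rw [Function.onFun, Set.not_disjoint_iff] at hd
    obtain ⟨x, hxp, hxq⟩ := hd
    have hp' := hs p hp
    have hq' := hs q hq
    set w : ℝ × ℝ := (min p.1 q.1, max p.2 q.2) with hw
    set s' := insert w ((s.erase p).erase q) with hs'
    have hcard : s'.card < s.card := by
      refine (Finset.card_insert_le _ _).trans_lt ?_
      have h1 := Finset.card_erase_lt_of_mem (Finset.mem_erase.2 ⟨hpq.symm, hq⟩)
      have h2 := Finset.card_erase_lt_of_mem (show p ∈ s from hp)
      omega
    have hIH := ih _ hcard s' (by
      intro z hz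
      rcases Finset.mem_insert.1 hz with rfl | hz
      · exact (min_le_left _ _).trans_lt (hp'.trans_le (le_max_left _ _))
      · exact hs z (Finset.mem_of_mem_erase (Finset.mem_of_mem_erase hz))) rfl
    refine (measure_mono ?_).trans (hIH.trans (mul_le_mul_right (measure_mono ?_) _))
    · refine iUnion₂_subset fun z hz => ?_
      by_cases hzpq : z = p ∨ z = q
      · refine Subset.trans ?_ (subset_biUnion_of_mem (show w ∈ s' from Finset.mem_insert_self _ _))
        have h1 : w.1 ≤ z.1 := by rcases hzpq with rfl | rfl <;> simp [hw]
        have h2 : z.2 ≤ w.2 := by rcases hzpq with rfl | rfl <;> simp [hw]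
        exact Ioo_subset_Ioo (by nlinarith) h2
      · push Not at hzpq
        exact subset_biUnion_of_mem (u := fun z : ℝ × ℝ => Ioo (z.1 - l * (z.2 - z.1)) z.2)
          (Finset.mem_insert_of_mem
          (Finset.mem_erase.2 ⟨hzpq.2, Finset.mem_erase.2 ⟨hzpq.1, hz⟩⟩))
    · refine iUnion₂_subset fun z hz => ?_
      rcases Finset.mem_insert.1 hz with rfl | hz
      · have : Ioo w.1 w.2 = Ioo p.1 p.2 ∪ Ioo q.1 q.2 := by
          rw [Ioo_union_Ioo]
          · rw [min_eq_left hp'.le, max_eq_right hq'.le]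
            exact hxp.1.trans hxq.2
          · rw [min_eq_left hq'.le, max_eq_right hp'.le]
            exact hxq.1.trans hxp.2
        rw [this]
        exact union_subset (subset_biUnion_of_mem (u := fun z : ℝ × ℝ => Ioo z.1 z.2) hp)
          (subset_biUnion_of_mem (u := fun z : ℝ × ℝ => Ioo z.1 z.2) hq)
      · exact subset_biUnion_of_mem (u := fun z : ℝ × ℝ => Ioo z.1 z.2)
          (Finset.mem_of_mem_erase (Finset.mem_of_mem_erase hz))

/-- The symmetric parabolic cylinder `B_r(x) × (t - r², t + r²)` around `p = (x, t)`. -/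
def symCyl {n : ℕ} (p : En n × ℝ) (r : ℝ) : Set (En n × ℝ) :=
  ball p.1 r ×ˢ Ioo (p.2 - r ^ 2) (p.2 + r ^ 2)

/-- The stack `B_r(x) × (t + r², t + (1 + M) r²)` on top of `symCyl (x, t) r`. -/
def stackCyl {n : ℕ} (M : ℝ) (p : En n × ℝ) (r : ℝ) : Set (En n × ℝ) :=
  ball p.1 r ×ˢ Ioo (p.2 + r ^ 2) (p.2 + (1 + M) * r ^ 2)

lemma isOpen_symCyl {n : ℕ} (p : En n × ℝ) (r : ℝ) : IsOpen (symCyl p r) :=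
  isOpen_ball.prod isOpen_Ioo

lemma isOpen_stackCyl {n : ℕ} (M : ℝ) (p : En n × ℝ) (r : ℝ) : IsOpen (stackCyl M p r) :=
  isOpen_ball.prod isOpen_Ioo

lemma mem_symCyl_self {n : ℕ} (p : En n × ℝ) {r : ℝ} (hr : 0 < r) : p ∈ symCyl p r :=
  ⟨mem_ball_self hr, by have := pow_pos hr 2; constructor <;> linarith⟩

lemma volume_symCyl_mul {n : ℕ} (p : En n × ℝ) (r : ℝ) {a : ℝ} (ha : 0 < a) :
    volume (symCyl p (a * r)) = ENNReal.ofReal (a ^ (n + 2)) * volume (symCyl p r) := by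
  rw [symCyl, symCyl, Measure.volume_eq_prod, Measure.prod_prod, Measure.prod_prod,
    Measure.addHaar_ball_mul_of_pos _ _ ha, Real.volume_Ioo, Real.volume_Ioo,
    finrank_euclideanSpace_fin]
  have : ENNReal.ofReal (p.2 + (a * r) ^ 2 - (p.2 - (a * r) ^ 2)) =
      ENNReal.ofReal (a ^ 2) * ENNReal.ofReal (p.2 + r ^ 2 - (p.2 - r ^ 2)) := by
    rw [← ENNReal.ofReal_mul (by positivity)]; congr 1; ring
  rw [this, pow_add, ENNReal.ofReal_mul (by positivity), ← Measure.addHaar_ball_center volume p.1 r]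
  ring

lemma volume_biUnion_symCyl_le {n : ℕ} {ι : Type*} {M : ℝ} (hM : 0 < M) (s : Finset ι)
    (p : ι → En n × ℝ) (r : ι → ℝ) (hr : ∀ i ∈ s, 0 < r i) :
    volume (⋃ i ∈ s, symCyl (p i) (r i)) ≤
      ENNReal.ofReal (1 + 2 / M) * volume (⋃ i ∈ s, stackCyl M (p i) (r i)) := by
  classical
  have h1 : MeasurableSet (⋃ i ∈ s, symCyl (p i) (r i)) :=
    (isOpen_biUnion fun i _ => isOpen_symCyl _ _).measurableSet
  have h2 : MeasurableSet (⋃ i ∈ s, stackCyl M (p i) (r i)) :=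
    (isOpen_biUnion fun i _ => isOpen_stackCyl _ _ _).measurableSet
  rw [Measure.volume_eq_prod, Measure.prod_apply h1, Measure.prod_apply h2,
    ← lintegral_const_mul _ (measurable_measure_prodMk_left h2)]
  refine lintegral_mono fun x => ?_
  set s' := ((s.filter fun i => x ∈ ball (p i).1 (r i)).image
    fun i => ((p i).2 + r i ^ 2, (p i).2 + (1 + M) * r i ^ 2)) with hs'
  have key := volume_biUnion_Ioo_extend_le (l := 2 / M) (by positivity) s' (by
    intro z hz
    obtain ⟨i, hi, rfl⟩ := Finset.mem_image.1 hz
    have := pow_pos (hr i (Finset.mem_filter.1 hi).1) 2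
    simp only
    nlinarith)
  refine (measure_mono ?_).trans (key.trans (mul_le_mul_right (measure_mono ?_) _))
  · rintro t ht
    simp only [mem_preimage, mem_iUnion] at ht
    obtain ⟨i, hi, hx, ht⟩ := ht
    rw [hs', Finset.set_biUnion_finset_image]
    refine mem_biUnion (Finset.mem_filter.2 ⟨hi, hx⟩) ?_
    have := pow_pos (hr i hi) 2
    have h3 : 2 / M * ((p i).2 + (1 + M) * r i ^ 2 - ((p i).2 + r i ^ 2)) = 2 * r i ^ 2 := by
      field_simp; ring
    simp only at ht ⊢
    rw [h3]
    exact ⟨by linarith [ht.1], by nlinarith [ht.2]⟩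
  · rw [hs', Finset.set_biUnion_finset_image]
    intro t ht
    simp only [mem_iUnion] at ht
    obtain ⟨i, hi, ht⟩ := ht
    obtain ⟨hi, hx⟩ := Finset.mem_filter.1 hi
    exact mem_biUnion hi ⟨hx, ht⟩

lemma symCyl_subset_of_inter {n : ℕ} {p q : En n × ℝ} {r r' : ℝ} (h0 : 0 < r) (h : r ≤ 2 * r')
    (hne : (symCyl p r ∩ symCyl q r').Nonempty) : symCyl p r ⊆ symCyl q (5 * r') := by
  obtain ⟨z, ⟨hz1, hz2⟩, hz3, hz4⟩ := hne
  rintro w ⟨hw1, hw2⟩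
  simp only [mem_ball, mem_Ioo] at hz1 hz2 hz3 hz4 hw1 hw2
  have hr : r ^ 2 ≤ 4 * r' ^ 2 := by nlinarith
  refine ⟨?_, ?_, ?_⟩
  · rw [mem_ball]
    have h1 := dist_triangle w.1 p.1 q.1
    have h2 := dist_triangle p.1 z.1 q.1
    rw [dist_comm p.1 z.1] at h2
    linarith
  · nlinarith
  · nlinarith

lemma exists_critical_radius {n : ℕ} {A : Set (En n × ℝ)} (hA : IsOpen A) {μ R : ℝ} (hμ : 0 < μ)
    (hR : 0 < R) {p : En n × ℝ} (hp : p ∈ A)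
    (hbad : ENNReal.ofReal μ * volume (symCyl p R) ≤ volume (symCyl p R \ A)) :
    ∃ r, 0 < r ∧ r ≤ R ∧ ENNReal.ofReal μ * volume (symCyl p r) ≤ volume (symCyl p r \ A) ∧
      volume (symCyl p (r / 2) \ A) < ENNReal.ofReal μ * volume (symCyl p (r / 2)) := by
  classical
  have hex : ∃ j : ℕ, volume (symCyl p (R / 2 ^ j) \ A) <
      ENNReal.ofReal μ * volume (symCyl p (R / 2 ^ j)) := by
    obtain ⟨ε, hε, hεA⟩ := Metric.isOpen_iff.1 hA p hp
    obtain ⟨j, hj⟩ := exists_pow_lt_of_lt_one (show 0 < min ε 1 / R by positivity)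
      (show (1 / 2 : ℝ) < 1 by norm_num)
    have hr : R / 2 ^ j < min ε 1 := by
      rw [lt_div_iff₀ hR] at hj
      calc R / 2 ^ j = (1 / 2) ^ j * R := by rw [one_div, inv_pow]; ring
        _ < _ := hj
    have hr0 : 0 < R / 2 ^ j := by positivity
    refine ⟨j, ?_⟩
    have hsub : symCyl p (R / 2 ^ j) ⊆ A := by
      refine Subset.trans ?_ hεA
      rintro ⟨x, t⟩ ⟨hx, ht⟩
      have h1 := hr.trans_le (min_le_left _ _)
      have h2 := hr.trans_le (min_le_right _ _)
      rw [mem_ball, Prod.dist_eq, max_lt_iff]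
      refine ⟨(mem_ball.1 hx).trans h1, ?_⟩
      simp only [mem_Ioo] at ht
      rw [Real.dist_eq, abs_lt]
      constructor <;> nlinarith [ht.1, ht.2]
    rw [sdiff_eq_empty.2 hsub, measure_empty]
    exact ENNReal.mul_pos (ENNReal.ofReal_pos.2 hμ).ne'
      ((isOpen_symCyl _ _).measure_pos _ ⟨p, mem_symCyl_self p hr0⟩).ne'
  obtain ⟨k, hk⟩ : ∃ k, Nat.find hex = k + 1 := by
    refine Nat.exists_eq_succ_of_ne_zero fun h => ?_
    have := Nat.find_spec hex
    rw [h, pow_zero, div_one] at this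
    exact absurd this hbad.not_gt
  refine ⟨R / 2 ^ k, by positivity, div_le_self hR.le (one_le_pow₀ (by norm_num)), ?_, ?_⟩
  · exact not_lt.1 (Nat.find_min hex (m := k) (by omega))
  · have := Nat.find_spec hex
    rwa [hk, pow_succ, ← div_div] at this

/-- Parabolic covering argument: if every cylinder in which `A` has large density carries a stack
contained in `B`, then `B` is larger than `A` by a fixed factor. -/
theorem volume_le_of_stackCyl_subset {n : ℕ} {A B : Set (En n × ℝ)} (hA : IsOpen A) {μ M R : ℝ}
    (hμ : 0 < μ) (hM : 0 < M) (hR : 0 < R)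
    (hbad : ∀ p ∈ A, ENNReal.ofReal μ * volume (symCyl p R) ≤ volume (symCyl p R \ A))
    (hst : ∀ p ∈ A, ∀ r, 0 < r → r ≤ R →
      volume (symCyl p (r / 2) \ A) < ENNReal.ofReal μ * volume (symCyl p (r / 2)) →
      stackCyl M p r ⊆ B) :
    ENNReal.ofReal (1 + μ / 5 ^ (n + 2)) * volume A ≤ ENNReal.ofReal (1 + 2 / M) * volume B := by
  choose! r hr0 hrR hrb hrg using fun p hp => exists_critical_radius hA hμ hR hp (hbad p hp)
  rw [hA.measure_eq_iSup_isCompact]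
  simp only [ENNReal.mul_iSup]
  refine iSup₂_le fun Z hZA => iSup_le fun hZ => ?_
  obtain ⟨t, htZ, hZt⟩ := hZ.elim_nhds_subcover (fun p => symCyl p (r p)) fun p hp =>
    (isOpen_symCyl _ _).mem_nhds (mem_symCyl_self p (hr0 p (hZA hp)))
  have htA : ∀ p ∈ t, p ∈ A := fun p hp => hZA (htZ p hp)
  obtain ⟨v, hvt, hvd, hv⟩ := Vitali.exists_disjoint_subfamily_covering_enlargement
    (fun p => symCyl p (r p)) (t : Set (En n × ℝ)) r 2 one_lt_two
    (fun p hp => (hr0 p (htA p hp)).le) R (fun p hp => hrR p (htA p hp))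
    (fun p hp => ⟨p, mem_symCyl_self p (hr0 p (htA p hp))⟩)
  lift v to Finset (En n × ℝ) using t.finite_toSet.subset hvt
  have hvt' : ∀ p ∈ v, p ∈ t := fun p hp => hvt hp
  set W := ⋃ p ∈ t, symCyl p (r p) with hW
  set S := ∑ p ∈ v, volume (symCyl p (r p)) with hS
  have h1 : volume W ≤ ENNReal.ofReal (5 ^ (n + 2)) * S := by
    have : W ⊆ ⋃ p ∈ v, symCyl p (5 * r p) := by
      refine iUnion₂_subset fun p hp => ?_
      obtain ⟨q, hq, hne, hle⟩ := hv p hp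
      exact (symCyl_subset_of_inter (hr0 p (htA p hp)) hle hne).trans
        (subset_biUnion_of_mem (u := fun q => symCyl q (5 * r q)) hq)
    refine (measure_mono this).trans ((measure_biUnion_finset_le _ _).trans_eq ?_)
    rw [hS, Finset.mul_sum]
    exact Finset.sum_congr rfl fun p _ => volume_symCyl_mul p _ (by norm_num)
  have h2 : volume Z + ENNReal.ofReal μ * S ≤ volume W := by
    rw [← measure_inter_add_sdiff W hA.measurableSet]
    refine add_le_add (measure_mono (subset_inter hZt hZA)) ?_
    rw [hS, Finset.mul_sum]
    calc ∑ p ∈ v, ENNReal.ofReal μ * volume (symCyl p (r p))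
        ≤ ∑ p ∈ v, volume (symCyl p (r p) \ A) :=
          Finset.sum_le_sum fun p hp => hrb p (htA p (hvt' p hp))
      _ = volume (⋃ p ∈ v, symCyl p (r p) \ A) := by
          rw [measure_biUnion_finset (hvd.mono fun p => sdiff_subset) fun p _ =>
            ((isOpen_symCyl _ _).measurableSet.diff hA.measurableSet)]
      _ ≤ _ := by
          refine measure_mono (iUnion₂_subset fun p hp => ?_)
          exact sdiff_subset_sdiff_left
            (subset_biUnion_of_mem (u := fun q => symCyl q (r q)) (hvt' p hp))
  have h3 : ENNReal.ofReal (1 + μ / 5 ^ (n + 2)) * volume Z ≤ volume W := by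
    rw [ENNReal.ofReal_add zero_le_one (by positivity), ENNReal.ofReal_one, add_mul, one_mul]
    refine le_trans (add_le_add_right ?_ _) h2
    calc ENNReal.ofReal (μ / 5 ^ (n + 2)) * volume Z
        ≤ ENNReal.ofReal (μ / 5 ^ (n + 2)) * (ENNReal.ofReal (5 ^ (n + 2)) * S) := by
          gcongr
          exact (measure_mono hZt).trans h1
      _ = _ := by
          rw [← mul_assoc, ← ENNReal.ofReal_mul (by positivity),
            div_mul_cancel₀ _ (by positivity)]
  refine h3.trans ((volume_biUnion_symCyl_le hM t id r fun p hp => hr0 p (htA p hp)).trans ?_)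
  gcongr
  refine iUnion₂_subset fun p hp => ?_
  exact hst p (htA p hp) _ (hr0 p (htA p hp)) (hrR p (htA p hp)) (hrg p (htA p hp))

/-- An admissible exponent for the barriers with speed between `2` and `10`. -/
def barrierExp (n : ℕ) (K : ℝ) : ℕ := ⌈K * (20 + 4 * n * K + 8 / K) ^ 2 / 64⌉₊

lemma barrierExp_spec {n : ℕ} {K κ : ℝ} (hK : 1 < K) (h2 : 2 ≤ κ) (h10 : κ ≤ 10) :
    (2 * κ + 4 * n * K + 8 / K) ^ 2 ≤ 32 * barrierExp n K * κ / K := by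
  have hK0 : 0 < K := by linarith
  have h := Nat.le_ceil (K * (20 + 4 * n * K + 8 / K) ^ 2 / 64)
  rw [← barrierExp] at h
  have h1 : (2 * κ + 4 * n * K + 8 / K) ^ 2 ≤ (20 + 4 * n * K + 8 / K) ^ 2 := by
    gcongr; linarith
  have h3 : (20 + 4 * n * K + 8 / K) ^ 2 = 64 / K * (K * (20 + 4 * n * K + 8 / K) ^ 2 / 64) := by
    field_simp
  calc _ ≤ _ := h1
    _ = _ := h3
    _ ≤ 64 / K * barrierExp n K := by gcongr
    _ = 32 * barrierExp n K * 2 / K := by ring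
    _ ≤ _ := by gcongr

lemma norm_lt_four {n : ℕ} {x y : En n} (hx : ‖x‖ ≤ 11 / 10) (h : ‖y - x‖ ^ 2 ≤ 8) : ‖y‖ < 4 := by
  have h1 : ‖y - x‖ ≤ 2.83 := by nlinarith [norm_nonneg (y - x)]
  have h2 := norm_le_norm_add_norm_sub x y
  rw [norm_sub_rev] at h2
  linarith

section

variable {n : ℕ} {K c : ℝ} {u : En n → ℝ → ℝ}

lemma PucciSuper.barrier_le_of_ball_four (hK : 1 < K) (hc : 0 ≤ c)
    (hu : Continuous fun p : En n × ℝ => u p.1 p.2)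
    (hP : PucciSuper n K c (ball 0 4 ×ˢ Ioc (1 / 2) 16) u)
    (hpos : ∀ x ∈ closedBall (0 : En n) 4, ∀ t ∈ Icc (1 / 2 : ℝ) 16, 0 ≤ u x t)
    {x0 : En n} {t0 ρ s κ : ℝ} (hρ : 0 < ρ) (hs : 0 ≤ s) (h2 : 2 ≤ κ) (h10 : κ ≤ 10)
    (hx0 : ‖x0‖ ≤ 11 / 10) (ht0 : 1 ≤ t0) (hinit : ∀ x, ‖x - x0‖ ≤ ρ → s ≤ u x t0)
    {x : En n} {t : ℝ} (ht : t0 ≤ t) (ht16 : t ≤ 16) (h8 : ρ ^ 2 + κ * (t - t0) ≤ 8)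
    (hx : ‖x - x0‖ ^ 2 ≤ ρ ^ 2 + κ * (t - t0)) :
    s * (ρ ^ (2 * barrierExp n K) / ρ ^ 4) * (((ρ ^ 2 + κ * (t - t0)) ^ barrierExp n K)⁻¹ *
      (ρ ^ 2 + κ * (t - t0) - ‖x - x0‖ ^ 2) ^ 2) - c * (t - t0) ≤ u x t := by
  refine PucciSuper.barrier_le (t1 := t) hK hu hc hρ hs (by linarith) (barrierExp_spec hK h2 h10)
    (hP.mono ?_) ?_ hinit ⟨ht, le_rfl⟩ hx
  · rintro ⟨z, τ⟩ ⟨⟨h3, h4⟩, h5⟩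
    simp only at h3 h4 h5
    refine ⟨?_, by simp only; linarith, by simp only; linarith⟩
    rw [mem_ball_zero_iff]
    exact norm_lt_four hx0 (by nlinarith)
  · rintro z τ ⟨h3, h4⟩ h5
    refine hpos z ?_ τ ⟨by linarith, by linarith⟩
    rw [mem_closedBall_zero_iff]
    exact (norm_lt_four hx0 (by nlinarith)).le

lemma PucciSuper.le_of_dense (hK : 1 < K) (hc : 0 ≤ c)
    (hu : Continuous fun p : En n × ℝ => u p.1 p.2)
    (hP : PucciSuper n K c (ball 0 4 ×ˢ Ioc (1 / 2) 16) u)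
    (hpos : ∀ x ∈ closedBall (0 : En n) 4, ∀ t ∈ Icc (1 / 2 : ℝ) 16, 0 ≤ u x t)
    {p : En n × ℝ} {ρ s : ℝ} {A : Set (En n × ℝ)} (hp1 : ‖p.1‖ ≤ 11 / 10) (hp2 : 1 < p.2)
    (hp3 : p.2 ≤ 21 / 10) (hρ : 0 < ρ) (hρ1 : ρ ≤ 1 / 10) (hs : 0 < s) (hcs : c ≤ s)
    (hA : ∀ q ∈ A, 3 * s < u q.1 q.2)
    (hd : volume (symCyl p ρ \ A) < ENNReal.ofReal (densityConst n K) * volume (symCyl p ρ))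
    {x : En n} (hx : ‖x - p.1‖ ≤ ρ / 8) : s ≤ u x (p.2 + ρ ^ 2) := by
  by_contra! hlt
  have hρ2 : ρ ^ 2 ≤ 1 / 100 := by nlinarith
  have hsub : ∀ z ∈ closedBall p.1 ρ, ‖z‖ < 4 := by
    intro z hz
    rw [mem_closedBall, dist_eq_norm] at hz
    exact norm_lt_four hp1 (by nlinarith [norm_nonneg (z - p.1)])
  have := PucciSuper.volume_sublevel_ge (x0 := p.1) (x1 := x) (t0 := p.2 - ρ ^ 2)
    (t1 := p.2 + ρ ^ 2) hK hc hu hρ (by ring) hs (by nlinarith) (hP.mono (by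
      rintro ⟨z, τ⟩ ⟨h1, h2, h3⟩
      simp only at h1 h2 h3
      refine ⟨mem_ball_zero_iff.2 (hsub z (ball_subset_closedBall h1)), ?_, ?_⟩ <;>
      · simp only; linarith))
    (fun z hz τ hτ => hpos z (mem_closedBall_zero_iff.2 (hsub z hz).le) τ
      ⟨by linarith [hτ.1], by linarith [hτ.2]⟩) hx hlt.le
  refine absurd (this.trans (measure_mono ?_)) hd.not_ge
  rintro q ⟨h1, h2⟩
  exact ⟨h1, fun hq => absurd (hA q hq) h2.not_gt⟩

lemma PucciSuper.le_of_mem_stackCyl (hK : 1 < K) (hc : 0 ≤ c)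
    (hu : Continuous fun p : En n × ℝ => u p.1 p.2)
    (hP : PucciSuper n K c (ball 0 4 ×ˢ Ioc (1 / 2) 16) u)
    (hpos : ∀ x ∈ closedBall (0 : En n) 4, ∀ t ∈ Icc (1 / 2 : ℝ) 16, 0 ≤ u x t)
    {p : En n × ℝ} {r s M : ℝ} (hM : 0 ≤ M) (hp1 : ‖p.1‖ ≤ 11 / 10) (hp2 : 1 < p.2)
    (hp3 : p.2 ≤ 21 / 10) (hr : 0 < r) (hr1 : (1 + M) * r ≤ 1 / 10) (hs : 0 ≤ s)
    (hinit : ∀ x, ‖x - p.1‖ ≤ r / 2 / 8 → s ≤ u x (p.2 + (r / 2) ^ 2))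
    {q : En n × ℝ} (hq : q ∈ stackCyl M p r) :
    s / (768 * (1 + M)) ^ barrierExp n K - c ≤ u q.1 q.2 := by
  obtain ⟨y, τ⟩ := q
  obtain ⟨h1, h2, h3⟩ := hq
  simp only [mem_ball, dist_eq_norm] at h1 h2 h3 ⊢
  have hr2 : 0 < r ^ 2 := by positivity
  have hr3 : r ≤ 1 / 10 := by nlinarith
  have hMr : (1 + M) * r ^ 2 ≤ 1 / 100 := by nlinarith
  have hy : ‖y - p.1‖ ^ 2 ≤ r ^ 2 := by gcongr
  set N := barrierExp n K
  set G := (r / 2 / 8) ^ 2 + 3 * (τ - (p.2 + (r / 2) ^ 2)) with hG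
  have hG1 : 2 * r ^ 2 ≤ G := by rw [hG]; linarith
  have hG2 : G ≤ 3 * (1 + M) * r ^ 2 := by rw [hG]; linarith
  have hG0 : 0 < G := by linarith
  have key := hP.barrier_le_of_ball_four (x0 := p.1) (t0 := p.2 + (r / 2) ^ 2) (ρ := r / 2 / 8)
    (κ := 3) (x := y) (t := τ) hK hc hu hpos (by positivity) hs (by norm_num) (by norm_num) hp1
    (by nlinarith) hinit (by linarith) (by linarith) (by rw [← hG]; linarith)
    (by rw [← hG]; linarith)
  rw [← hG] at key
  have e1 : c * (τ - (p.2 + (r / 2) ^ 2)) ≤ c := by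
    refine mul_le_of_le_one_right hc ?_
    linarith
  have e2 : s / (768 * (1 + M)) ^ N ≤
      s * ((r / 2 / 8) ^ (2 * N) / (r / 2 / 8) ^ 4) * ((G ^ N)⁻¹ * (G - ‖y - p.1‖ ^ 2) ^ 2) := by
    have e3 : (r ^ 2) ^ 2 ≤ (G - ‖y - p.1‖ ^ 2) ^ 2 := by
      gcongr; linarith
    calc s / (768 * (1 + M)) ^ N ≤ 16 ^ 4 * (s / (768 * (1 + M)) ^ N) :=
          le_mul_of_one_le_left (by positivity) (by norm_num)
      _ = s * ((r / 2 / 8) ^ (2 * N) / (r / 2 / 8) ^ 4) *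
          (((3 * (1 + M) * r ^ 2) ^ N)⁻¹ * (r ^ 2) ^ 2) := by
          rw [pow_mul (r / 2 / 8)]
          have : (r / 2 / 8) ^ 2 = 3 * (1 + M) * r ^ 2 / (768 * (1 + M)) := by
            field_simp; norm_num
          rw [this, div_pow]
          field_simp
          ring
      _ ≤ _ := by gcongr
  linarith

lemma PucciSuper.le_of_late (hK : 1 < K) (hc : 0 ≤ c)
    (hu : Continuous fun p : En n × ℝ => u p.1 p.2)
    (hP : PucciSuper n K c (ball 0 4 ×ˢ Ioc (1 / 2) 16) u)
    (hpos : ∀ x ∈ closedBall (0 : En n) 4, ∀ t ∈ Icc (1 / 2 : ℝ) 16, 0 ≤ u x t)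
    {p : En n × ℝ} {ρ s : ℝ} (hp1 : ‖p.1‖ ≤ 11 / 10) (hp2 : 1 < p.2)
    (hp3 : p.2 ≤ 21 / 10) (hρ : 0 < ρ) (hρ1 : ρ ≤ 1 / 10) (hs : 0 ≤ s)
    (hinit : ∀ x, ‖x - p.1‖ ≤ ρ / 8 → s ≤ u x (p.2 + ρ ^ 2))
    {x : En n} {t : ℝ} (hx : ‖x‖ ≤ 1) (ht3 : 3 ≤ t) (ht4 : t ≤ 4) :
    s * (ρ ^ 2 / 512) ^ barrierExp n K - 3 * c ≤ u x t := by
  have hρ2 : 0 < ρ ^ 2 := by positivity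
  have hρ3 : ρ ^ 2 ≤ 1 / 100 := by nlinarith
  have hd : 0 < t - (p.2 + ρ ^ 2) := by linarith
  set κ := (8 - (ρ / 8) ^ 2) / (t - (p.2 + ρ ^ 2)) with hκ
  have hG : (ρ / 8) ^ 2 + κ * (t - (p.2 + ρ ^ 2)) = 8 := by
    rw [hκ, div_mul_cancel₀ _ hd.ne']; ring
  have hκ2 : 2 ≤ κ := by rw [hκ, le_div_iff₀ hd]; linarith
  have hκ10 : κ ≤ 10 := by rw [hκ, div_le_iff₀ hd]; linarith
  have hxp : ‖x - p.1‖ ^ 2 ≤ 7 := by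
    have := norm_sub_le x p.1
    nlinarith [norm_nonneg (x - p.1)]
  set N := barrierExp n K
  have key := hP.barrier_le_of_ball_four (x0 := p.1) (t0 := p.2 + ρ ^ 2) (ρ := ρ / 8)
    (κ := κ) (x := x) (t := t) hK hc hu hpos (by positivity) hs hκ2 hκ10 hp1
    (by nlinarith) hinit (by linarith) (by linarith) hG.le (by rw [hG]; linarith)
  rw [hG] at key
  have e1 : c * (t - (p.2 + ρ ^ 2)) ≤ 3 * c := by nlinarith
  have e2 : s * (ρ ^ 2 / 512) ^ N ≤
      s * ((ρ / 8) ^ (2 * N) / (ρ / 8) ^ 4) * ((8 ^ N)⁻¹ * (8 - ‖x - p.1‖ ^ 2) ^ 2) := by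
    have e3 : (1 : ℝ) ≤ (8 - ‖x - p.1‖ ^ 2) ^ 2 := one_le_pow₀ (by linarith)
    have e4 : (ρ / 8) ^ 4 ≤ 1 := pow_le_one₀ (by positivity) (by linarith)
    calc s * (ρ ^ 2 / 512) ^ N = s * ((ρ / 8) ^ (2 * N) / 1) * ((8 ^ N)⁻¹ * 1) := by
          rw [pow_mul, div_one, mul_one, mul_assoc, ← inv_pow, ← mul_pow]
          congr 2; ring
      _ ≤ _ := by gcongr
  linarith

end

/-- One step of the iteration. -/
lemma PucciSuper.volume_superlevel_le {n : ℕ} {K : ℝ} (hK : 1 < K) {η M : ℝ}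
    (hη : η = densityConst n K / 5 ^ (n + 2)) (hM : M = 4 / η + 2)
    {c : ℝ} {u : En n → ℝ → ℝ} (hc : 0 ≤ c)
    (hu : Continuous fun p : En n × ℝ => u p.1 p.2)
    (hP : PucciSuper n K c (ball 0 4 ×ˢ Ioc (1 / 2) 16) u)
    (hpos : ∀ x ∈ closedBall (0 : En n) 4, ∀ t ∈ Icc (1 / 2 : ℝ) 16, 0 ≤ u x t)
    {x : En n} {t : ℝ} (hx : ‖x‖ ≤ 1) (ht3 : 3 ≤ t) (ht4 : t ≤ 4)
    {s σ R : ℝ} (hs : 0 < s) (hcs : c ≤ s) (hσ : 0 ≤ σ) (hR : 0 < R)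
    (hσR : σ + (1 + M) * R ≤ 1 / 10)
    (hlate : u x t + 3 * c < 4 * (768 * (1 + M)) ^ barrierExp n K * s *
      (R ^ 2 / 512) ^ barrierExp n K) :
    ENNReal.ofReal (1 + η / 2) * volume {q : En n × ℝ |
      q ∈ ball (0 : En n) (1 + σ) ×ˢ Ioo 1 (2 + σ) ∧
        12 * (768 * (1 + M)) ^ barrierExp n K * s < u q.1 q.2} ≤
      volume {q : En n × ℝ | q ∈ ball (0 : En n) (1 + (σ + (1 + M) * R)) ×ˢ
        Ioo 1 (2 + (σ + (1 + M) * R)) ∧ s < u q.1 q.2} := by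
  have hη0 : 0 < η := by
    have := densityConst_pos (n := n) hK
    rw [hη]; positivity
  have hM0 : 2 ≤ M := by rw [hM]; linarith [show 0 < 4 / η by positivity]
  have hMR : 0 < (1 + M) * R := by positivity
  have hRs : R ≤ 1 / 10 := by nlinarith
  set N := barrierExp n K with hN
  set s' := 4 * (768 * (1 + M)) ^ N * s with hs'
  have hpow : (1 : ℝ) ≤ (768 * (1 + M)) ^ N := one_le_pow₀ (by linarith)
  have hs's : s ≤ s' := by rw [hs']; nlinarith
  have hs'0 : 0 < s' := by linarith
  set A := {q : En n × ℝ | q ∈ ball (0 : En n) (1 + σ) ×ˢ Ioo 1 (2 + σ) ∧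
        12 * (768 * (1 + M)) ^ N * s < u q.1 q.2} with hA
  have hAo : IsOpen A := (isOpen_ball.prod isOpen_Ioo).inter (isOpen_lt continuous_const hu)
  have hA3 : ∀ q ∈ A, 3 * s' < u q.1 q.2 := fun q hq => by
    have := hq.2
    rw [hs']; linarith
  have hAn : ∀ p ∈ A, ‖p.1‖ ≤ 11 / 10 ∧ 1 < p.2 ∧ p.2 ≤ 21 / 10 := fun p hp =>
    ⟨by linarith [mem_ball_zero_iff.1 hp.1.1], hp.1.2.1, by linarith [hp.1.2.2]⟩
  have key := volume_le_of_stackCyl_subset (B := {q : En n × ℝ | q ∈ ball (0 : En n)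
      (1 + (σ + (1 + M) * R)) ×ˢ Ioo 1 (2 + (σ + (1 + M) * R)) ∧ s < u q.1 q.2})
    (M := M) (R := R) hAo (densityConst_pos (n := n) hK) (by linarith) hR ?_ ?_
  · rw [← hη] at key
    have h1 : ENNReal.ofReal (1 + η / 2) =
        ENNReal.ofReal ((1 + 2 / M)⁻¹) * ENNReal.ofReal (1 + η) := by
      rw [← ENNReal.ofReal_mul (by positivity)]
      congr 1
      rw [hM]
      field_simp
      ring
    rw [h1, mul_assoc]
    refine (mul_le_mul_right key _).trans_eq ?_
    rw [← mul_assoc, ← ENNReal.ofReal_mul (by positivity), inv_mul_cancel₀ (by positivity),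
      ENNReal.ofReal_one, one_mul]
  · intro p hp
    obtain ⟨h1, h2, h3⟩ := hAn p hp
    by_contra! hd
    have := hP.le_of_late hK hc hu hpos h1 h2 h3 hR hRs hs'0.le
      (fun z hz => hP.le_of_dense hK hc hu hpos h1 h2 h3 hR hRs hs'0 (hcs.trans hs's) hA3 hd hz)
      hx ht3 ht4
    linarith
  · intro p hp r hr hrR hd q hq
    obtain ⟨h1, h2, h3⟩ := hAn p hp
    have hMr : (1 + M) * r ≤ (1 + M) * R := by gcongr
    have h4 := hP.le_of_mem_stackCyl hK hc hu hpos (by linarith) h1 h2 h3 hr (by linarith) hs'0.le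
      (fun z hz => hP.le_of_dense hK hc hu hpos h1 h2 h3 (half_pos hr) (by linarith) hs'0
        (hcs.trans hs's) hA3 hd hz) hq
    have h5 : s' / (768 * (1 + M)) ^ N = 4 * s := by
      rw [hs']; field_simp
    rw [h5] at h4
    refine ⟨⟨?_, ?_, ?_⟩, by linarith⟩
    · rw [mem_ball_zero_iff]
      have h6 := mem_ball_zero_iff.1 hp.1.1
      have h7 : ‖q.1 - p.1‖ < r := by rw [← dist_eq_norm]; exact hq.1
      have h8 := norm_le_norm_add_norm_sub p.1 q.1
      rw [norm_sub_rev] at h8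
      nlinarith
    · have := hq.2.1
      nlinarith
    · have h6 := hq.2.2
      have h7 := hp.1.2.2
      have : (1 + M) * r ^ 2 ≤ (1 + M) * r := by
        gcongr; nlinarith
      linarith

/-- Geometric decay of the distribution function of a supersolution. -/
theorem PucciSuper.exists_decay (n : ℕ) {K : ℝ} (hK : 1 < K) :
    ∃ H Λ θ : ℝ, 0 < H ∧ 1 < Λ ∧ 1 < θ ∧ ∀ (c : ℝ) (u : En n → ℝ → ℝ), 0 ≤ c →
      (Continuous fun p : En n × ℝ => u p.1 p.2) →
      PucciSuper n K c (ball 0 4 ×ˢ Ioc (1 / 2) 16) u →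
      (∀ x ∈ closedBall (0 : En n) 4, ∀ t ∈ Icc (1 / 2 : ℝ) 16, 0 ≤ u x t) →
      ∀ (x : En n) (t I : ℝ), ‖x‖ ≤ 1 → 3 ≤ t → t ≤ 4 → u x t + 3 * c < I → ∀ k : ℕ,
        ENNReal.ofReal θ ^ k * volume {q : En n × ℝ | q ∈ ball (0 : En n) 1 ×ˢ Ioo 1 2 ∧
          H * I * Λ ^ k < u q.1 q.2} ≤
          volume (ball (0 : En n) (11 / 10) ×ˢ Ioo (1 : ℝ) (21 / 10)) := by
  set η := densityConst n K / 5 ^ (n + 2) with hη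
  set M := 4 / η + 2 with hM
  have hη0 : 0 < η := by
    have := densityConst_pos (n := n) hK
    rw [hη]; positivity
  have hM0 : 2 ≤ M := by rw [hM]; linarith [show 0 < 4 / η by positivity]
  set N := barrierExp n K with hN
  set R := 1 / (10 * (1 + M)) with hR
  have hR0 : 0 < R := by positivity
  have hR1 : R ≤ 1 := by rw [hR, div_le_one (by positivity)]; linarith
  set Λ := 12 * (768 * (1 + M)) ^ N with hΛ
  have hpow : (1 : ℝ) ≤ (768 * (1 + M)) ^ N := one_le_pow₀ (by linarith)
  have hΛ1 : 1 < Λ := by linarith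
  have hΛ4 : 4 ^ N ≤ Λ := by
    have : (4 : ℝ) ^ N ≤ (768 * (1 + M)) ^ N := by gcongr; linarith
    linarith
  set H := (4 * 512 / R ^ 2) ^ N with hH
  have hH1 : 1 ≤ H := one_le_pow₀ (by rw [le_div_iff₀ (by positivity)]; nlinarith)
  refine ⟨H, Λ, 1 + η / 2, by positivity, hΛ1, by linarith, ?_⟩
  intro c u hc hu hP hpos x t I hx ht3 ht4 hI
  have hu0 : 0 ≤ u x t := hpos x (mem_closedBall_zero_iff.2 (by linarith)) t
    ⟨by linarith, by linarith⟩
  have hI0 : 0 < I := by linarith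
  suffices h : ∀ (k : ℕ) (σ : ℝ), 0 ≤ σ → σ ≤ 1 / 10 * (1 / 2) ^ k →
      ENNReal.ofReal (1 + η / 2) ^ k * volume {q : En n × ℝ |
        q ∈ ball (0 : En n) (1 + σ) ×ˢ Ioo 1 (2 + σ) ∧ H * I * Λ ^ k < u q.1 q.2} ≤
        volume (ball (0 : En n) (11 / 10) ×ˢ Ioo (1 : ℝ) (21 / 10)) by
    intro k
    simpa using h k 0 le_rfl (by positivity)
  intro k
  induction k with
  | zero =>
    intro σ hσ hσ1
    rw [pow_zero, one_mul]
    refine measure_mono fun q hq => ?_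
    exact prod_mono (ball_subset_ball (by linarith)) (Ioo_subset_Ioo le_rfl (by linarith)) hq.1
  | succ k ih =>
    intro σ hσ hσ1
    have hMR : (1 + M) * (R * (1 / 2) ^ (k + 1)) = 1 / 10 * (1 / 2) ^ (k + 1) := by
      rw [hR]; field_simp
    have hhalf : (1 / 2 : ℝ) ^ (k + 1) = (1 / 2) ^ k / 2 := by rw [pow_succ]; ring
    have hhalf1 : (1 / 2 : ℝ) ^ k ≤ 1 := pow_le_one₀ (by norm_num) (by norm_num)
    have hΛk : 1 ≤ Λ ^ k := one_le_pow₀ hΛ1.le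
    have hs : I ≤ H * I * Λ ^ k := by
      calc I = 1 * I * 1 := by ring
        _ ≤ _ := by gcongr
    have hstep := PucciSuper.volume_superlevel_le (R := R * (1 / 2) ^ (k + 1)) (σ := σ)
      (s := H * I * Λ ^ k) hK hη hM hc hu hP hpos hx ht3 ht4 (by linarith)
      (by linarith) hσ (by positivity) (by rw [hMR]; linarith) (by
        refine hI.trans_le ?_
        rw [← hN]
        have e1 : ((R * (1 / 2) ^ (k + 1)) ^ 2 / 512) ^ N * (H * (4 ^ N) ^ k) = 1 := by
          rw [hH, ← pow_mul, mul_comm N k, pow_mul, ← mul_pow, ← mul_pow]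
          convert one_pow N
          have : ((1 / 2 : ℝ) ^ (k + 1)) ^ 2 = 1 / (4 * 4 ^ k) := by
            rw [← pow_succ', ← pow_mul, mul_comm, pow_mul, ← one_div_pow]; norm_num
          rw [mul_pow, this]
          field_simp
        have e2 : (4 ^ N) ^ k ≤ Λ ^ k := by gcongr
        have e3 : 0 ≤ ((R * (1 / 2) ^ (k + 1)) ^ 2 / 512) ^ N := by positivity
        calc I = ((R * (1 / 2) ^ (k + 1)) ^ 2 / 512) ^ N * (H * (4 ^ N) ^ k) * I := by
              rw [e1, one_mul]
          _ ≤ ((R * (1 / 2) ^ (k + 1)) ^ 2 / 512) ^ N * (H * Λ ^ k) * I := by gcongr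
          _ = 1 * (((R * (1 / 2) ^ (k + 1)) ^ 2 / 512) ^ N * (H * Λ ^ k) * I) := by ring
          _ ≤ (4 * (768 * (1 + M)) ^ N) *
              (((R * (1 / 2) ^ (k + 1)) ^ 2 / 512) ^ N * (H * Λ ^ k) * I) := by
              gcongr
              linarith
          _ = _ := by ring)
    rw [← hN, ← hΛ] at hstep
    have hlev : H * I * Λ ^ (k + 1) = Λ * (H * I * Λ ^ k) := by ring
    rw [hlev, pow_succ, mul_assoc]
    refine (mul_le_mul_right hstep _).trans (ih _ (by positivity) ?_)
    rw [hMR]; linarith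

lemma exists_rpow_sq_le {Λ θ : ℝ} (hΛ : 1 < Λ) (hθ : 1 < θ) :
    ∃ p : ℝ, 0 < p ∧ p < 1 ∧ (Λ ^ p) ^ 2 ≤ θ := by
  have h1 := Real.log_pos hΛ
  have h2 := Real.log_pos hθ
  refine ⟨min (1 / 2) (Real.log θ / (2 * Real.log Λ)), by positivity,
    (min_le_left _ _).trans_lt (by norm_num), ?_⟩
  rw [← Real.rpow_natCast, ← Real.rpow_mul (by linarith), Real.rpow_def_of_pos (by linarith),
    ← Real.le_log_iff_exp_le (by linarith)]
  have h3 := min_le_right (1 / 2) (Real.log θ / (2 * Real.log Λ))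
  rw [le_div_iff₀ (by positivity)] at h3
  push_cast
  linarith

/-- Geometric decay of superlevel sets gives a bound for a small power. -/
lemma lintegral_rpow_le_of_decay {α : Type*} [MeasurableSpace α] {ν : Measure α} {D : Set α}
    (hD : MeasurableSet D) {g : α → ℝ} (hgm : Measurable g) (hg : ∀ q ∈ D, 0 ≤ g q)
    {Λ θ s p : ℝ} (hΛ : 1 < Λ) (hθ : 1 < θ) (hs : 0 < s) (hp : 0 < p)
    (hpθ : (Λ ^ p) ^ 2 ≤ θ) {V : ENNReal}
    (hdecay : ∀ k : ℕ, ENNReal.ofReal θ ^ k * ν {q | q ∈ D ∧ s * Λ ^ k < g q} ≤ V)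
    (hDV : ν D ≤ V) :
    ∫⁻ q in D, ENNReal.ofReal (g q ^ p) ∂ν ≤
      ENNReal.ofReal (s ^ p * (1 + Λ ^ p * (1 - (Λ ^ p)⁻¹)⁻¹)) * V := by
  set l := Λ ^ p with hl
  have hl1 : 1 < l := Real.one_lt_rpow hΛ hp
  have hl2 : l⁻¹ < 1 := inv_lt_one_of_one_lt₀ hl1
  set E : ℕ → Set α := fun k => {q | q ∈ D ∧ s * Λ ^ k < g q} with hE
  have hEm : ∀ k, MeasurableSet (E k) := fun k => hD.inter (measurableSet_lt measurable_const hgm)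
  have hpt : ∀ q ∈ D, ENNReal.ofReal (g q ^ p) ≤ ENNReal.ofReal (s ^ p) +
      ∑' k, (E k).indicator (fun _ => ENNReal.ofReal (s ^ p * l ^ (k + 1))) q := by
    intro q hq
    by_cases hgs : g q ≤ s
    · refine le_add_right (ENNReal.ofReal_le_ofReal ?_)
      exact Real.rpow_le_rpow (hg q hq) hgs hp.le
    · push Not at hgs
      have h1 : 1 ≤ g q / s := by rw [le_div_iff₀ hs]; linarith
      have hex : ∃ j : ℕ, g q ≤ s * Λ ^ j := by
        obtain ⟨j, hj⟩ := pow_unbounded_of_one_lt (g q / s) hΛ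
        rw [div_lt_iff₀ hs] at hj
        exact ⟨j, by linarith⟩
      classical
      obtain ⟨k, hk⟩ : ∃ k, Nat.find hex = k + 1 := by
        refine Nat.exists_eq_succ_of_ne_zero fun h => ?_
        have := Nat.find_spec hex
        rw [h, pow_zero, mul_one] at this
        linarith
      have hk1 : g q ≤ s * Λ ^ (k + 1) := hk ▸ Nat.find_spec hex
      have hk2 : s * Λ ^ k < g q := not_le.1 (Nat.find_min hex (m := k) (by omega))
      refine le_add_left (le_trans ?_ (ENNReal.le_tsum k))
      rw [indicator_of_mem (show q ∈ E k from ⟨hq, hk2⟩)]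
      refine ENNReal.ofReal_le_ofReal ?_
      calc g q ^ p ≤ (s * Λ ^ (k + 1)) ^ p := Real.rpow_le_rpow (hg q hq) hk1 hp.le
        _ = s ^ p * l ^ (k + 1) := by
          rw [Real.mul_rpow hs.le (by positivity), hl, ← Real.rpow_natCast, ← Real.rpow_natCast,
            ← Real.rpow_mul (by linarith), ← Real.rpow_mul (by linarith), mul_comm p]
  have hterm : ∀ k, ENNReal.ofReal (s ^ p * l ^ (k + 1)) * ν (E k) ≤
      ENNReal.ofReal (s ^ p * l * (l⁻¹) ^ k) * V := by
    intro k
    calc ENNReal.ofReal (s ^ p * l ^ (k + 1)) * ν (E k)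
        ≤ ENNReal.ofReal (s ^ p * l * (l⁻¹) ^ k) * ENNReal.ofReal θ ^ k * ν (E k) := by
          gcongr
          rw [← ENNReal.ofReal_pow (by linarith), ← ENNReal.ofReal_mul (by positivity)]
          refine ENNReal.ofReal_le_ofReal ?_
          have : l ^ (k + 1) = l * (l⁻¹) ^ k * (l ^ 2) ^ k := by
            rw [inv_pow]; field_simp; ring
          rw [this, ← mul_assoc, ← mul_assoc]
          gcongr
      _ ≤ _ := by
          rw [mul_assoc]
          exact mul_le_mul_right (hdecay k) _
  calc ∫⁻ q in D, ENNReal.ofReal (g q ^ p) ∂ν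
      ≤ ∫⁻ q in D, (ENNReal.ofReal (s ^ p) +
        ∑' k, (E k).indicator (fun _ => ENNReal.ofReal (s ^ p * l ^ (k + 1))) q) ∂ν :=
        setLIntegral_mono' hD hpt
    _ = ENNReal.ofReal (s ^ p) * ν D +
        ∑' k, ENNReal.ofReal (s ^ p * l ^ (k + 1)) * (ν.restrict D) (E k) := by
        rw [lintegral_add_left measurable_const, setLIntegral_const, lintegral_tsum
          (fun k => (measurable_const.indicator (hEm k)).aemeasurable)]
        congr 2
        ext k
        rw [lintegral_indicator_const (hEm k)]
    _ ≤ ENNReal.ofReal (s ^ p) * V + ∑' k, ENNReal.ofReal (s ^ p * l * (l⁻¹) ^ k) * V := by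
        refine add_le_add (mul_le_mul_right hDV _) (ENNReal.tsum_le_tsum fun k => ?_)
        exact (mul_le_mul_right (Measure.restrict_apply_le _ _) _).trans (hterm k)
    _ = _ := by
        rw [ENNReal.tsum_mul_right, ← ENNReal.ofReal_tsum_of_nonneg (fun k => by positivity)
          ((summable_geometric_of_lt_one (by positivity) hl2).mul_left _), tsum_mul_left,
          tsum_geometric_of_lt_one (by positivity) hl2, ← add_mul, ← ENNReal.ofReal_add
          (by positivity) (mul_nonneg (by positivity) (inv_nonneg.2 (by linarith)))]
        congr 2
        ring

/-- Weak Harnack inequality at unit scale. -/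
theorem PucciSuper.exists_lintegral_rpow_le (n : ℕ) {K : ℝ} (hK : 1 < K) :
    ∃ p C : ℝ, 0 < p ∧ p < 1 ∧ 0 < C ∧ ∀ (c : ℝ) (u : En n → ℝ → ℝ), 0 ≤ c →
      (Continuous fun p : En n × ℝ => u p.1 p.2) →
      PucciSuper n K c (ball 0 4 ×ˢ Ioc (1 / 2) 16) u →
      (∀ x ∈ closedBall (0 : En n) 4, ∀ t ∈ Icc (1 / 2 : ℝ) 16, 0 ≤ u x t) →
      ∀ (x : En n) (t I : ℝ), ‖x‖ ≤ 1 → 3 ≤ t → t ≤ 4 → u x t + 3 * c < I →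
        ∫⁻ q in ball (0 : En n) 1 ×ˢ Ioo (1 : ℝ) 2, ENNReal.ofReal (u q.1 q.2 ^ p) ≤
          ENNReal.ofReal (C * I ^ p) := by
  obtain ⟨H, Λ, θ, hH, hΛ, hθ, hdecay⟩ := PucciSuper.exists_decay n hK
  obtain ⟨p, hp0, hp1, hpθ⟩ := exists_rpow_sq_le hΛ hθ
  set V := volume (ball (0 : En n) (11 / 10) ×ˢ Ioo (1 : ℝ) (21 / 10)) with hV
  have hVtop : V ≠ ⊤ := by
    rw [hV, Measure.volume_eq_prod, Measure.prod_prod]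
    exact ENNReal.mul_ne_top measure_ball_lt_top.ne measure_Ioo_lt_top.ne
  have hl1 : 1 < Λ ^ p := Real.one_lt_rpow hΛ hp0
  have hl2 : 0 < 1 - (Λ ^ p)⁻¹ := by linarith [inv_lt_one_of_one_lt₀ hl1]
  refine ⟨p, H ^ p * (1 + Λ ^ p * (1 - (Λ ^ p)⁻¹)⁻¹) * (V.toReal + 1), hp0, hp1, by positivity, ?_⟩
  intro c u hc hu hP hpos x t I hx ht3 ht4 hI
  have hu0 : 0 ≤ u x t := hpos x (mem_closedBall_zero_iff.2 (by linarith)) t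
    ⟨by linarith, by linarith⟩
  have hI0 : 0 < I := by linarith
  refine (lintegral_rpow_le_of_decay (isOpen_ball.prod isOpen_Ioo).measurableSet hu.measurable
    (fun q hq => hpos q.1 ?_ q.2 ?_) hΛ hθ (mul_pos hH hI0) hp0 hpθ
    (hdecay c u hc hu hP hpos x t I hx ht3 ht4 hI) ?_).trans ?_
  · exact ball_subset_closedBall (ball_subset_ball (by norm_num) hq.1)
  · exact ⟨by linarith [hq.2.1], by linarith [hq.2.2]⟩
  · exact measure_mono (prod_mono (ball_subset_ball (by norm_num))
      (Ioo_subset_Ioo le_rfl (by norm_num)))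
  · nth_rewrite 1 [← ENNReal.ofReal_toReal hVtop]
    rw [← ENNReal.ofReal_mul (by positivity),
      Real.mul_rpow hH.le hI0.le]
    refine ENNReal.ofReal_le_ofReal ?_
    calc H ^ p * I ^ p * (1 + Λ ^ p * (1 - (Λ ^ p)⁻¹)⁻¹) * V.toReal
        ≤ H ^ p * I ^ p * (1 + Λ ^ p * (1 - (Λ ^ p)⁻¹)⁻¹) * (V.toReal + 1) := by
          gcongr; linarith
      _ = _ := by ring

lemma coordTrace_smul {n : ℕ} (a : ℝ) (P : En n →L[ℝ] En n) :
    coordTrace (a • P) = a * coordTrace P := by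
  simp [coordTrace, Finset.mul_sum]

lemma PucciSuper.scale {n : ℕ} {K c r : ℝ} {U V : Set (En n × ℝ)} {u : En n → ℝ → ℝ}
    (h : PucciSuper n K c V u) (hr : 0 < r) (hUV : ∀ x t, (x, t) ∈ U → (r • x, r ^ 2 * t) ∈ V) :
    PucciSuper n K (r ^ 2 * c) U fun x t => u (r • x) (r ^ 2 * t) := by
  intro x₀ t₀ ρ b p P θ hρ hU hP hθ ht
  have hr2 : 0 < r ^ 2 := by positivity
  have hmem : ∀ z s, (z, s) ∈ parCyl n (r • x₀) (r ^ 2 * t₀) (r * ρ) →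
      ∃ z' s', z = r • z' ∧ s = r ^ 2 * s' ∧ (z', s') ∈ parCyl n x₀ t₀ ρ := by
    rintro z s ⟨h1, h2, h3⟩
    have hz : z = r • (r⁻¹ • z) := by rw [smul_inv_smul₀ hr.ne']
    have hs : s = r ^ 2 * (s / r ^ 2) := by field_simp
    refine ⟨r⁻¹ • z, s / r ^ 2, hz, hs, ?_, ?_, ?_⟩
    · rw [hz, mem_ball, dist_smul₀, Real.norm_of_nonneg hr.le] at h1
      exact lt_of_mul_lt_mul_left h1 hr.le
    · simp only at h2 ⊢
      rw [lt_div_iff₀ hr2]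
      nlinarith
    · simp only at h3 ⊢
      rw [div_le_iff₀ hr2]
      linarith
  have key := h (r • x₀) (r ^ 2 * t₀) (r * ρ) (b / r ^ 2) (r⁻¹ • p) ((r ^ 2)⁻¹ • P) (θ / r ^ 2)
    (by positivity) (by
      rintro ⟨z, s⟩ hzs
      obtain ⟨z', s', rfl, rfl, h'⟩ := hmem z s hzs
      exact hUV _ _ (hU h')) (by
      refine ⟨fun v w => ?_, fun v => ?_⟩
      · simp only [_root_.smul_apply, inner_smul_left, hP.1 v w]
      · simp only [_root_.smul_apply, inner_smul_left]
        exact mul_nonneg (by simp; positivity) (hP.2 v)) (by positivity) (by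
      intro z s hzs
      obtain ⟨z', s', rfl, rfl, h'⟩ := hmem z s hzs
      refine le_trans (le_of_eq ?_) (ht z' s' h')
      rw [← smul_sub, ← mul_sub, norm_smul, Real.norm_of_nonneg hr.le]
      simp only [_root_.smul_apply, map_smul, inner_smul_left, inner_smul_right, conj_trivial]
      field_simp)
  rw [coordTrace_smul] at key
  have := mul_le_mul_of_nonneg_left key hr2.le
  have e1 : r ^ 2 * (K⁻¹ * ((r ^ 2)⁻¹ * coordTrace P)) = K⁻¹ * coordTrace P := by field_simp
  have e2 : r ^ 2 * (b / r ^ 2 + K * n * (θ / r ^ 2) + c) = b + K * n * θ + r ^ 2 * c := by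
    field_simp
  rwa [e1, e2] at this

lemma PucciSuper.congr {n : ℕ} {K c : ℝ} {U : Set (En n × ℝ)} {u v : En n → ℝ → ℝ}
    (h : PucciSuper n K c U u) (huv : ∀ p ∈ U, v p.1 p.2 = u p.1 p.2) :
    PucciSuper n K c U v := by
  intro x₀ t₀ r b p P θ hr hU hP hθ ht
  refine h x₀ t₀ r b p P θ hr hU hP hθ fun z s hzs => ?_
  have h0 : (x₀, t₀) ∈ parCyl n x₀ t₀ r :=
    ⟨mem_ball_self hr, by have := pow_pos hr 2; simp only; linarith, le_rfl⟩
  have h1 := huv _ (hU h0)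
  have h2 := huv _ (hU hzs)
  simp only at h1 h2
  rw [← h1, ← h2]
  exact ht z s hzs

/-- Averages are invariant under invertible linear changes of variables. -/
lemma setAverage_linearEquiv {E : Type*} [NormedAddCommGroup E] [NormedSpace ℝ E]
    [FiniteDimensional ℝ E] [MeasurableSpace E] [BorelSpace E] (ν : Measure E)
    [ν.IsAddHaarMeasure] (e : E ≃ₗ[ℝ] E) (S : Set E) (g : E → ℝ) :
    ⨍ p in S, g p ∂ν = ⨍ p in e ⁻¹' S, g (e p) ∂ν := by
  have hdet : LinearMap.det (e : E →ₗ[ℝ] E) ≠ 0 := e.isUnit_det'.ne_zero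
  have hmap := Measure.map_linearMap_addHaar_eq_smul_addHaar ν hdet
  set k := ENNReal.ofReal |(LinearMap.det (e : E →ₗ[ℝ] E))⁻¹| with hk
  have hk0 : k.toReal ≠ 0 := by
    rw [hk, ENNReal.toReal_ofReal (abs_nonneg _)]
    exact abs_ne_zero.2 (inv_ne_zero hdet)
  have hemb : MeasurableEmbedding e :=
    e.toContinuousLinearEquiv.toHomeomorph.measurableEmbedding
  have h1 : ∫ p in e ⁻¹' S, g (e p) ∂ν = k.toReal * ∫ p in S, g p ∂ν := by
    have := hemb.setIntegral_map (μ := ν) g S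
    rw [← this]
    have hmap' : Measure.map e ν = k • ν := hmap
    rw [hmap', Measure.restrict_smul, integral_smul_measure, smul_eq_mul]
  have h2 : ν.real (e ⁻¹' S) = k.toReal * ν.real S := by
    have hmap' : Measure.map e ν = k • ν := hmap
    rw [measureReal_def, ← hemb.map_apply, hmap', Measure.smul_apply, smul_eq_mul,
      ENNReal.toReal_mul, measureReal_def]
  rw [setAverage_eq, setAverage_eq, h1, h2, smul_eq_mul, smul_eq_mul, mul_inv]
  field_simp

end

/-- parabolic weak Harnack inequality for fully nonlinear
uniformly elliptic operators. -/
theorem statement4 (n : ℕ) (hn : 1 ≤ n) (K : ℝ) (hK : 1 < K) :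
    ∃ p₀ C_H : ℝ, p₀ ∈ Set.Ioo (0:ℝ) 1 ∧ 0 < C_H ∧
      ∀ (F : Matrix (Fin n) (Fin n) ℝ → ℝ) (f u : En n → ℝ → ℝ),
        UniformlyElliptic n K F → F 0 = 0 →
        ContinuousOn (fun p : En n × ℝ => f p.1 p.2) (P1 n) →
        (∃ M : ℝ, ∀ p ∈ P1 n, |f p.1 p.2| ≤ M) →
        ContinuousOn (fun p : En n × ℝ => u p.1 p.2) (P1 n) →
        (∀ p ∈ P1 n, 0 ≤ u p.1 p.2) →
        IsViscSuperSol n F f (P1 n) u →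
        ∀ r : ℝ, 0 < r → r < 1/4 →
          (⨍ p in Metric.ball (0 : En n) r ×ˢ Set.Ioo (r ^ 2) (2 * r ^ 2),
              (u p.1 p.2) ^ p₀) ^ (1 / p₀) ≤
            C_H * (sInf ((fun p : En n × ℝ => u p.1 p.2) ''
                (Metric.ball (0 : En n) r ×ˢ Set.Ioo (3 * r ^ 2) (4 * r ^ 2))) +
              r ^ 2 * sSup ((fun p : En n × ℝ => |f p.1 p.2|) '' P1 n)) := by
  obtain ⟨p, C, hp0, hp1, hC, hmain⟩ := PucciSuper.exists_lintegral_rpow_le n hK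
  set D := ball (0 : En n) 1 ×ˢ Ioo (1 : ℝ) 2 with hD
  have hDo : IsOpen D := isOpen_ball.prod isOpen_Ioo
  set m := volume.real D with hm
  have hm0 : 0 < m := by
    rw [hm, measureReal_def]
    refine ENNReal.toReal_pos (hDo.measure_pos _ ⟨(0, 3 / 2), ?_⟩).ne' ?_
    · exact ⟨mem_ball_self one_pos, by norm_num⟩
    · rw [hD, Measure.volume_eq_prod, Measure.prod_prod]
      exact ENNReal.mul_ne_top measure_ball_lt_top.ne measure_Ioo_lt_top.ne
  set C1 := (C / m) ^ (1 / p) with hC1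
  have hC10 : 0 < C1 := by positivity
  refine ⟨p, 3 * C1, ⟨hp0, hp1⟩, by positivity, ?_⟩
  intro F f u hF h0 hf ⟨B, hB⟩ hu hpos hsol r hr hr4
  have hr2 : 0 < r ^ 2 := by positivity
  set c := sSup ((fun p : En n × ℝ => |f p.1 p.2|) '' P1 n) with hc
  have hfc : ∀ p ∈ P1 n, |f p.1 p.2| ≤ c := fun p hp =>
    le_csSup ⟨B, by rintro _ ⟨q, hq, rfl⟩; exact hB q hq⟩ ⟨p, hp, rfl⟩
  have hc0 : 0 ≤ c := (abs_nonneg _).trans (hfc (0, 1) ⟨mem_ball_self one_pos, by norm_num⟩)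
  set S := closedBall (0 : En n) 4 ×ˢ Icc (1 / 2 : ℝ) 16 with hS
  have hSP : ∀ q ∈ S, (r • q.1, r ^ 2 * q.2) ∈ P1 n := by
    rintro ⟨x, t⟩ ⟨h1, h2, h3⟩
    simp only [mem_closedBall_zero_iff] at h1 h2 h3
    refine ⟨?_, ?_, ?_⟩
    · rw [mem_ball_zero_iff, norm_smul, Real.norm_of_nonneg hr.le]
      nlinarith
    · simp only; positivity
    · simp only; nlinarith
  have hcont : ContinuousOn (fun q : En n × ℝ => u (r • q.1) (r ^ 2 * q.2)) S :=
    hu.comp (f := fun q : En n × ℝ => (r • q.1, r ^ 2 * q.2)) (by fun_prop) hSP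
  obtain ⟨w, hw⟩ := ContinuousMap.exists_restrict_eq (Y := ℝ)
    (isClosed_closedBall.prod isClosed_Icc : IsClosed S)
    ⟨S.domRestrict fun q : En n × ℝ => u (r • q.1) (r ^ 2 * q.2), hcont.domRestrict⟩
  have hwS : ∀ q ∈ S, w q = u (r • q.1) (r ^ 2 * q.2) := fun q hq =>
    DFunLike.congr_fun hw ⟨q, hq⟩
  have hUS : ∀ q ∈ ball (0 : En n) 4 ×ˢ Ioc (1 / 2 : ℝ) 16, q ∈ S := fun q hq =>
    ⟨ball_subset_closedBall hq.1, Ioc_subset_Icc_self hq.2⟩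
  have hPw : PucciSuper n K (r ^ 2 * c) (ball 0 4 ×ˢ Ioc (1 / 2) 16) fun x t => w (x, t) := by
    have h1 : PucciSuper n K c (P1 n) u :=
      hsol.pucciSuper hK hF h0 fun q hq => (abs_le.1 (hfc q hq)).1
    have h2 : PucciSuper n K (r ^ 2 * c) (ball 0 4 ×ˢ Ioc (1 / 2) 16)
        fun x t => u (r • x) (r ^ 2 * t) := h1.scale hr fun x t hxt => hSP (x, t) (hUS _ hxt)
    exact h2.congr fun q hq => hwS q (hUS q hq)
  have hwpos : ∀ x ∈ closedBall (0 : En n) 4, ∀ t ∈ Icc (1 / 2 : ℝ) 16, 0 ≤ w (x, t) := by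
    intro x hx t ht
    rw [hwS (x, t) ⟨hx, ht⟩]
    exact hpos _ (hSP (x, t) ⟨hx, ht⟩)
  have hDS : ∀ q ∈ D, q ∈ S := fun q hq =>
    ⟨ball_subset_closedBall (ball_subset_ball (by norm_num) hq.1),
      by linarith [hq.2.1], by linarith [hq.2.2]⟩
  have hav : ⨍ q in ball (0 : En n) r ×ˢ Ioo (r ^ 2) (2 * r ^ 2), u q.1 q.2 ^ p =
      m⁻¹ * ∫ q in D, w q ^ p := by
    have : (volume : Measure (En n × ℝ)).IsAddHaarMeasure := by
      rw [Measure.volume_eq_prod]; infer_instance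
    rw [setAverage_linearEquiv volume ((LinearEquiv.smulOfNeZero ℝ (En n) r hr.ne').prodCongr
      (LinearEquiv.smulOfNeZero ℝ ℝ (r ^ 2) hr2.ne'))]
    have hpre : ((LinearEquiv.smulOfNeZero ℝ (En n) r hr.ne').prodCongr
        (LinearEquiv.smulOfNeZero ℝ ℝ (r ^ 2) hr2.ne')) ⁻¹'
        (ball (0 : En n) r ×ˢ Ioo (r ^ 2) (2 * r ^ 2)) = D := by
      ext ⟨x, t⟩
      simp [hD, norm_smul, abs_of_pos hr, hr, hr2, mul_comm (2 : ℝ)]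
    rw [hpre, setAverage_eq, smul_eq_mul]
    congr 1
    refine setIntegral_congr_fun hDo.measurableSet fun q hq => ?_
    simp only [hwS q (hDS q hq)]
    rfl
  have hint0 : 0 ≤ ∫ q in D, w q ^ p := setIntegral_nonneg hDo.measurableSet fun q hq =>
    Real.rpow_nonneg (hwpos q.1 (hDS q hq).1 q.2 (hDS q hq).2) _
  rw [hav]
  set X := (m⁻¹ * ∫ q in D, w q ^ p) ^ (1 / p) with hX
  suffices h : ∀ v ∈ (fun p : En n × ℝ => u p.1 p.2) ''
      (ball (0 : En n) r ×ˢ Ioo (3 * r ^ 2) (4 * r ^ 2)), X / (3 * C1) - r ^ 2 * c ≤ v by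
    have hne : (ball (0 : En n) r ×ˢ Ioo (3 * r ^ 2) (4 * r ^ 2)).Nonempty :=
      ⟨(0, 7 / 2 * r ^ 2), mem_ball_self hr, by constructor <;> simp only <;> linarith⟩
    have h1 := le_csInf (hne.image _) h
    rw [← div_le_iff₀' (by positivity)]
    linarith
  rintro _ ⟨⟨y, τ⟩, ⟨hy, hτ⟩, rfl⟩
  simp only [mem_ball_zero_iff, mem_Ioo] at hy hτ ⊢
  have hx1 : ‖r⁻¹ • y‖ ≤ 1 := by
    rw [norm_smul, norm_inv, Real.norm_of_nonneg hr.le, inv_mul_le_iff₀ hr]; linarith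
  have ht3 : 3 ≤ τ / r ^ 2 := by rw [le_div_iff₀ hr2]; linarith
  have ht4 : τ / r ^ 2 ≤ 4 := by rw [div_le_iff₀ hr2]; linarith
  have hwy : w (r⁻¹ • y, τ / r ^ 2) = u y τ := by
    rw [hwS _ ⟨mem_closedBall_zero_iff.2 (by linarith), by linarith, by linarith⟩]
    simp only
    rw [smul_inv_smul₀ hr.ne', mul_div_cancel₀ _ hr2.ne']
  have hbound : X / C1 ≤ u y τ + 3 * (r ^ 2 * c) := by
    refine le_of_forall_gt_imp_ge_of_dense fun I hI => ?_
    have hu0 : 0 ≤ u y τ := hwy ▸ hwpos _ (mem_closedBall_zero_iff.2 (by linarith)) _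
      ⟨by linarith, by linarith⟩
    have hI0 : 0 < I := lt_of_le_of_lt (by positivity) hI
    have hlint := hmain (r ^ 2 * c) (fun x t => w (x, t)) (by positivity) w.continuous hPw hwpos
      (r⁻¹ • y) (τ / r ^ 2) I hx1 ht3 ht4 (by rw [hwy]; exact hI)
    have hintg : ∫ q in D, w q ^ p ≤ C * I ^ p := by
      rw [integral_eq_lintegral_of_nonneg_ae]
      · exact ENNReal.toReal_le_of_le_ofReal (by positivity) hlint
      · exact ae_restrict_of_forall_mem hDo.measurableSet fun q hq =>
          Real.rpow_nonneg (hwpos q.1 (hDS q hq).1 q.2 (hDS q hq).2) _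
      · exact (w.continuous.measurable.pow_const p).aestronglyMeasurable
    rw [div_le_iff₀ hC10, hX, hC1]
    calc (m⁻¹ * ∫ q in D, w q ^ p) ^ (1 / p) ≤ (C / m * I ^ p) ^ (1 / p) := by
          refine Real.rpow_le_rpow (by positivity) ?_ (by positivity)
          rw [div_mul_eq_mul_div, inv_mul_le_iff₀ hm0, mul_div_cancel₀ _ hm0.ne']
          exact hintg
      _ = I * (C / m) ^ (1 / p) := by
          rw [Real.mul_rpow (by positivity) (by positivity), ← Real.rpow_mul hI0.le,
            mul_one_div_cancel hp0.ne', Real.rpow_one, mul_comm]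
  have hu0 : 0 ≤ u y τ := hwy ▸ hwpos _ (mem_closedBall_zero_iff.2 (by linarith)) _
    ⟨by linarith, by linarith⟩
  have : X / (3 * C1) = X / C1 / 3 := by rw [div_div, mul_comm]
  rw [this]
  linarith
end
end
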